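/- Let n ≥ 3 and m ∈ ℕ. For every ε > 0 there exists a constant C_ε > 0 such that for every u ∈ H¹(𝔹ⁿ) satisfying ∫_{S^{n-1}} p |u|^{2(n-1)/(n-2)} dμ_{S^{n-1}} = 0 for all p ∈ P̊_m, one has (∫_{S^{n-1}} |u|^{2(n-1)/(n-2)} dμ_{S^{n-1}})^{(n-2)/(n-1)} ≤ ( c(n, n/(n-2)) / Θ(m, (n-2)/(n-1), n-1) + ε ) ∫_{𝔹ⁿ} |∇u|² dx + C_ε ∫_{S^{n-1}} u² dμ_{S^{n-1}}, where c(n, n/(n-2)) = (2/(n-2)) |S^{n-1}|^{-1/(n-1)}. -/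

import Mathlib

open MeasureTheory Metric Filter
open scoped ENNReal RealInnerProductSpace

noncomputable section

abbrev E (n : ℕ) : Type := EuclideanSpace ℝ (Fin n)

/-- The standard surface measure on the unit sphere `S^{n-1}`, as a Borel measure on `ℝⁿ`. -/
def sphMeasure (n : ℕ) : Measure (E n) :=
  Measure.map Subtype.val ((volume : Measure (E n)).toSphere)

/-- `|S^{n-1}|` : the total mass of the surface measure. -/
def SA (n : ℕ) : ℝ := (sphMeasure n Set.univ).toReal

/-- `P̊_m` : polynomials of degree at most `m` with zero mean on the sphere. -/
def P0 (n m : ℕ) : Set (MvPolynomial (Fin n) ℝ) :=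
  {p | p.totalDegree ≤ m ∧ ∫ x, MvPolynomial.eval (fun i => x i) p ∂(sphMeasure n) = 0}

/-- `Θ(m, θ, n-1)` : the infimum of `Σ_i ν_iᶿ` over all probability measures
`ν = Σ_i ν_i δ_{ξ_i}` on `S^{n-1}` supported on countably many points such that
`∫ p dν = 0` for all `p ∈ P̊_m`. -/
def Theta (n m : ℕ) (θ : ℝ) : ℝ :=
  sInf {t : ℝ | ∃ (ξ : ℕ → E n) (w : ℕ → ℝ),
    (∀ i, ξ i ∈ Metric.sphere (0 : E n) 1) ∧ (∀ i, 0 ≤ w i) ∧ Summable w ∧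
    (∑' i, w i) = 1 ∧
    (∀ p ∈ P0 n m, (∑' i, w i * MvPolynomial.eval (fun j => ξ i j) p) = 0) ∧
    Summable (fun i => w i ^ θ) ∧ t = ∑' i, w i ^ θ}

lemma knothe1 {Z : Type} [TopologicalSpace Z] [FirstCountableTopology Z] [LocallyCompactSpace Z]
    (F G : Z → ℝ → ℝ) (hF : Continuous (Function.uncurry F)) (hG : Continuous (Function.uncurry G))
    (pF : ∀ z t, 0 < F z t) (pG : ∀ z t, 0 < G z t)
    (h : ∀ z, ∫ t in (0:ℝ)..1, F z t = ∫ t in (0:ℝ)..1, G z t) :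
    ∃ T D : Z → ℝ → ℝ, Continuous (Function.uncurry T) ∧ Continuous (Function.uncurry D) ∧
      (∀ z, T z 0 = 0) ∧ (∀ z, T z 1 = 1) ∧ (∀ z, ∀ t ∈ Set.Icc (0:ℝ) 1, T z t ∈ Set.Icc (0:ℝ) 1) ∧
      (∀ z t, 0 < D z t) ∧ (∀ z t, HasDerivAt (T z) (D z t) t) ∧
      (∀ z, ∀ t ∈ Set.Icc (0:ℝ) 1, D z t * G z (T z t) = F z t) := by
  set cl : ℝ → ℝ := fun t => max 0 (min 1 t) with hcl
  have ccl : Continuous cl := by fun_prop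
  have clid : ∀ t ∈ Set.Icc (0:ℝ) 1, cl t = t := by
    intro t ht; simp only [hcl]; rw [min_eq_right ht.2, max_eq_right ht.1]
  have clmem : ∀ t, cl t ∈ Set.Icc (0:ℝ) 1 := by
    intro t; exact ⟨le_max_left _ _, max_le zero_le_one (min_le_left _ _)⟩
  set F' : Z → ℝ → ℝ := fun z t => F z (cl t) with hF'
  set G' : Z → ℝ → ℝ := fun z t => G z (cl t) with hG'
  have cF' : Continuous (Function.uncurry F') := by
    exact hF.comp (continuous_fst.prodMk (ccl.comp continuous_snd))
  have cG' : Continuous (Function.uncurry G') := by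
    exact hG.comp (continuous_fst.prodMk (ccl.comp continuous_snd))
  have cF'z : ∀ z, Continuous (F' z) := fun z => cF'.comp (Continuous.prodMk_right z)
  have cG'z : ∀ z, Continuous (G' z) := fun z => cG'.comp (Continuous.prodMk_right z)
  set Φ : Z → ℝ → ℝ := fun z s => ∫ t in (0:ℝ)..s, G' z t with hΦ
  set Ψ : Z → ℝ → ℝ := fun z s => ∫ t in (0:ℝ)..s, F' z t with hΨ
  have cΦ : Continuous (Function.uncurry Φ) :=
    intervalIntegral.continuous_parametric_intervalIntegral_of_continuous
      (f := fun (p : Z × ℝ) t => G' p.1 t)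
      (by exact cG'.comp ((continuous_fst.comp continuous_fst).prodMk continuous_snd)) continuous_snd
  have cΨ : Continuous (Function.uncurry Ψ) :=
    intervalIntegral.continuous_parametric_intervalIntegral_of_continuous
      (f := fun (p : Z × ℝ) t => F' p.1 t)
      (by exact cF'.comp ((continuous_fst.comp continuous_fst).prodMk continuous_snd)) continuous_snd
  have dΦ : ∀ z s, HasDerivAt (Φ z) (G' z s) s := fun z s =>
    intervalIntegral.integral_hasDerivAt_right ((cG'z z).intervalIntegrable _ _)
      ((cG'z z).stronglyMeasurableAtFilter _ _) (cG'z z).continuousAt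
  have dΨ : ∀ z s, HasDerivAt (Ψ z) (F' z s) s := fun z s =>
    intervalIntegral.integral_hasDerivAt_right ((cF'z z).intervalIntegrable _ _)
      ((cF'z z).stronglyMeasurableAtFilter _ _) (cF'z z).continuousAt
  have mΦ : ∀ z, StrictMono (Φ z) := fun z =>
    strictMono_of_deriv_pos (fun x => by rw [(dΦ z x).deriv]; exact pG _ _)
  have mΨ : ∀ z, StrictMono (Ψ z) := fun z =>
    strictMono_of_deriv_pos (fun x => by rw [(dΨ z x).deriv]; exact pF _ _)
  have cΦz : ∀ z, Continuous (Φ z) := fun z => cΦ.comp (Continuous.prodMk_right z)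
  have sΦ : ∀ z, Function.Surjective (Φ z) := by
    intro z
    obtain ⟨x0, hx0, hmin⟩ := isCompact_Icc.exists_isMinOn (Set.nonempty_Icc.2 (zero_le_one (α := ℝ)))
      (f := G' z) (cG'z z).continuousOn
    set m := G' z x0
    have mpos : 0 < m := pG _ _
    have hm : ∀ t, m ≤ G' z t := by
      intro t
      have := hmin (clmem t)
      simp only [Set.mem_ofPred_eq] at this
      refine this.trans (le_of_eq ?_)
      simp only [hG']; rw [clid _ (clmem t)]
    have h0 : Φ z 0 = 0 := by simp [hΦ]
    have mono2 : Monotone (fun s => Φ z s - m * s) := by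
      refine monotone_of_deriv_nonneg ?_ ?_
      · intro x; exact ((dΦ z x).sub ((hasDerivAt_id x).const_mul m)).differentiableAt
      · intro x
        have := ((dΦ z x).sub ((hasDerivAt_id x).const_mul m)).deriv
        have e : (fun s => Φ z s - m * s) = (Φ z - fun y => m * id y) := by ext; simp
        rw [e, this]; have := hm x; linarith
    refine (cΦz z).surjective ?_ ?_
    · refine tendsto_atTop_mono' _ ?_ (tendsto_id.const_mul_atTop mpos)
      filter_upwards [eventually_ge_atTop 0] with s hs
      have := mono2 hs; simp [h0] at this; simpa using this
    · refine tendsto_atBot_mono' _ ?_ (tendsto_id.const_mul_atBot mpos)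
      filter_upwards [eventually_le_atBot 0] with s hs
      have := mono2 hs; simp [h0] at this; simpa using this
  choose Inv hInv using sΦ
  have cInv : Continuous (Function.uncurry Inv) := by
    rw [continuous_iff_continuousAt]
    rintro ⟨z, y⟩
    refine tendsto_order.2 ⟨fun a ha => ?_, fun a ha => ?_⟩
    · have h1 : Φ z a < y := by
        have := mΦ z ha; simpa [Function.uncurry, hInv] using this
      have c1 : Continuous fun p : Z × ℝ => Φ p.1 a := cΦ.comp (continuous_fst.prodMk continuous_const)
      filter_upwards [c1.continuousAt.eventually_lt (continuous_snd (X := Z) (Y := ℝ)).continuousAt h1] with p hp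
      have : Φ p.1 a < Φ p.1 (Inv p.1 p.2) := by rw [hInv]; exact hp
      exact (mΦ p.1).lt_iff_lt.1 this
    · have h1 : y < Φ z a := by
        have := mΦ z ha; simpa [Function.uncurry, hInv] using this
      have c1 : Continuous fun p : Z × ℝ => Φ p.1 a := cΦ.comp (continuous_fst.prodMk continuous_const)
      filter_upwards [(continuous_snd (X := Z) (Y := ℝ)).continuousAt.eventually_lt c1.continuousAt h1] with p hp
      have : Φ p.1 (Inv p.1 p.2) < Φ p.1 a := by rw [hInv]; exact hp
      exact (mΦ p.1).lt_iff_lt.1 this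
  set T : Z → ℝ → ℝ := fun z t => Inv z (Ψ z t) with hT
  have hΦT : ∀ z t, Φ z (T z t) = Ψ z t := fun z t => hInv z _
  have cT : Continuous (Function.uncurry T) := cInv.comp (continuous_fst.prodMk cΨ)
  have T0 : ∀ z, T z 0 = 0 := by
    intro z; apply (mΦ z).injective; rw [hΦT]; simp [hΦ, hΨ]
  have T1 : ∀ z, T z 1 = 1 := by
    intro z; apply (mΦ z).injective; rw [hΦT]
    have e1 : Φ z 1 = ∫ t in (0:ℝ)..1, G z t := by
      apply intervalIntegral.integral_congr
      intro t ht; rw [Set.uIcc_of_le zero_le_one] at ht; simp only [hG']; rw [clid t ht]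
    have e2 : Ψ z 1 = ∫ t in (0:ℝ)..1, F z t := by
      apply intervalIntegral.integral_congr
      intro t ht; rw [Set.uIcc_of_le zero_le_one] at ht; simp only [hF']; rw [clid t ht]
    rw [e1, e2, h]
  have mT : ∀ z, Monotone (T z) := by
    intro z a b hab
    apply (mΦ z).le_iff_le.1; rw [hΦT, hΦT]; exact (mΨ z).monotone hab
  have memT : ∀ z, ∀ t ∈ Set.Icc (0:ℝ) 1, T z t ∈ Set.Icc (0:ℝ) 1 := by
    intro z t ht
    exact ⟨by rw [← T0 z]; exact mT z ht.1, by rw [← T1 z]; exact mT z ht.2⟩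
  refine ⟨T, fun z t => F' z t / G' z (T z t), cT, ?_, T0, T1, memT, ?_, ?_, ?_⟩
  · exact cF'.div (cG'.comp (continuous_fst.prodMk cT)) (fun p => (pG _ _).ne')
  · intro z t; exact div_pos (pF _ _) (pG _ _)
  · intro z t
    have h1 : HasDerivAt (Inv z) (G' z (Inv z (Ψ z t)))⁻¹ (Ψ z t) :=
      HasDerivAt.of_local_left_inverse (cInv.comp (Continuous.prodMk_right z)).continuousAt
        (dΦ z _) (pG _ _).ne' (Eventually.of_forall (fun y => hInv z y))
    have := h1.comp t (dΨ z t)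
    rw [mul_comm, ← div_eq_mul_inv] at this
    exact this
  · intro z t ht
    simp only [hF', hG']
    rw [clid t ht, clid _ (memT z t ht), div_mul_cancel₀ _ (pG _ _).ne']

lemma cube_fubini {n : ℕ} (k : Fin (n+1)) (g : (Fin (n+1) → ℝ) → ℝ)
    (hg : ContinuousOn g (Set.Icc 0 1)) :
    ∫ x in Set.Icc (0 : Fin (n+1) → ℝ) 1, g x =
      ∫ y in Set.Icc (0 : Fin n → ℝ) 1, ∫ t in (0:ℝ)..1, g (k.insertNth t y) := by
  have mp := (volume_preserving_piFinSuccAbove (fun _ : Fin (n+1) => ℝ) k).symm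
  have hi : IntegrableOn g (Set.Icc 0 1) := hg.integrableOn_compact isCompact_Icc
  have pre : (MeasurableEquiv.piFinSuccAbove (fun _ : Fin (n+1) => ℝ) k).symm ⁻¹' (Set.Icc 0 1)
      = Set.Icc (0:ℝ) 1 ×ˢ Set.Icc (0 : Fin n → ℝ) 1 := by
    ext ⟨t, y⟩
    simp only [Set.mem_preimage, MeasurableEquiv.piFinSuccAbove_symm_apply, Set.mem_Icc, Set.mem_prod]
    simp only [Fin.insertNthEquiv, Equiv.coe_fn_mk, Fin.le_insertNth_iff, Fin.insertNth_le_iff]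
    simp only [Pi.le_def, Pi.zero_apply, Pi.one_apply]
    tauto
  have e1 := mp.setIntegral_preimage_emb (MeasurableEquiv.measurableEmbedding _) g (Set.Icc 0 1)
  rw [← e1, pre, Measure.volume_eq_prod]
  have hi2 : IntegrableOn (fun p : ℝ × (Fin n → ℝ) => g ((MeasurableEquiv.piFinSuccAbove (fun _ : Fin (n+1) => ℝ) k).symm p))
      (Set.Icc (0:ℝ) 1 ×ˢ Set.Icc (0 : Fin n → ℝ) 1) (Measure.prod volume volume) := by
    rw [← pre]
    exact (mp.integrableOn_comp_preimage (MeasurableEquiv.measurableEmbedding _)).2 hi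
  unfold IntegrableOn at hi2
  rw [← Measure.prod_restrict] at hi2 ⊢
  rw [integral_prod_symm _ hi2]
  refine integral_congr_ae (Eventually.of_forall fun y => ?_)
  simp only
  rw [intervalIntegral.integral_of_le zero_le_one, integral_Icc_eq_integral_Ioc]
  rfl

lemma cube_fubini' {n : ℕ} (k : Fin (n+1)) (g : (Fin (n+1) → ℝ) → ℝ)
    (hg : ContinuousOn g (Set.Icc 0 1)) :
    ∫ x in Set.Icc (0 : Fin (n+1) → ℝ) 1, g x =
      ∫ t in (0:ℝ)..1, ∫ y in Set.Icc (0 : Fin n → ℝ) 1, g (k.insertNth t y) := by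
  rw [cube_fubini k g hg]
  have hc : ContinuousOn (fun p : (Fin n → ℝ) × ℝ => g (k.insertNth p.2 p.1))
      (Set.Icc (0 : Fin n → ℝ) 1 ×ˢ Set.Icc (0:ℝ) 1) := by
    refine hg.comp (Continuous.continuousOn ?_) ?_
    · exact Continuous.finInsertNth k continuous_snd continuous_fst
    · rintro ⟨y, t⟩ ⟨hy, ht⟩
      simp only [Set.mem_Icc, Fin.le_insertNth_iff, Fin.insertNth_le_iff]
      exact ⟨⟨ht.1, fun i => hy.1 i⟩, ⟨ht.2, fun i => hy.2 i⟩⟩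
  have hi : IntegrableOn (fun p : (Fin n → ℝ) × ℝ => g (k.insertNth p.2 p.1))
      (Set.Icc (0 : Fin n → ℝ) 1 ×ˢ Set.Icc (0:ℝ) 1) (Measure.prod volume volume) :=
    hc.integrableOn_compact (isCompact_Icc.prod isCompact_Icc)
  unfold IntegrableOn at hi
  rw [← Measure.prod_restrict] at hi
  rw [intervalIntegral.integral_of_le zero_le_one, ← integral_Icc_eq_integral_Ioc]
  rw [← integral_integral_swap hi]
  refine integral_congr_ae (Eventually.of_forall fun y => ?_)
  simp only
  rw [intervalIntegral.integral_of_le zero_le_one, integral_Icc_eq_integral_Ioc]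

lemma cons_continuous {X : Type*} [TopologicalSpace X] {n : ℕ} {f : X → ℝ} {g : X → Fin n → ℝ}
    (hf : Continuous f) (hg : Continuous g) :
    Continuous (fun x => (Fin.cons (f x) (g x) : Fin (n+1) → ℝ)) :=
  Continuous.finCons (A := fun _ => ℝ) hf hg

lemma cons_mem_cube {n : ℕ} {t : ℝ} {y : Fin n → ℝ} :
    (Fin.cons t y : Fin (n+1) → ℝ) ∈ Set.Icc (0 : Fin (n+1) → ℝ) 1 ↔
      t ∈ Set.Icc (0:ℝ) 1 ∧ y ∈ Set.Icc (0 : Fin n → ℝ) 1 := by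
  simp only [Set.mem_Icc, Pi.le_def, Fin.forall_fin_succ, Fin.cons_zero, Fin.cons_succ,
    Pi.zero_apply, Pi.one_apply]
  tauto

lemma cube_vol_pos (n : ℕ) : 0 < volume.real (Set.Icc (0 : Fin n → ℝ) 1) := by
  simp [Measure.real, Real.volume_Icc_pi]

lemma knothe (n : ℕ) : ∀ (Z : Type) [TopologicalSpace Z] [FirstCountableTopology Z]
    [LocallyCompactSpace Z] (F G : Z → (Fin n → ℝ) → ℝ), Continuous (Function.uncurry F) →
    Continuous (Function.uncurry G) → (∀ z t, 0 < F z t) → (∀ z t, 0 < G z t) →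
    (∀ z, ∫ x in Set.Icc (0 : Fin n → ℝ) 1, F z x = ∫ x in Set.Icc (0 : Fin n → ℝ) 1, G z x) →
    ∃ T D : Z → (Fin n → ℝ) → (Fin n → ℝ), Continuous (Function.uncurry T) ∧
      Continuous (Function.uncurry D) ∧
      (∀ z, ∀ x ∈ Set.Icc (0 : Fin n → ℝ) 1, T z x ∈ Set.Icc (0 : Fin n → ℝ) 1) ∧
      (∀ z x k, 0 < D z x k) ∧
      (∀ z x k, HasDerivAt (fun t => T z (Function.update x k t) k) (D z x k) (x k)) ∧
      (∀ z, ∀ x ∈ Set.Icc (0 : Fin n → ℝ) 1, (∏ k, D z x k) * G z (T z x) = F z x) ∧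
      (∀ z, ∀ φ : (Fin n → ℝ) → ℝ, Continuous φ →
        ∫ x in Set.Icc (0 : Fin n → ℝ) 1, F z x * φ (T z x) =
          ∫ y in Set.Icc (0 : Fin n → ℝ) 1, G z y * φ y) := by
  induction n with
  | zero =>
    intro Z _ _ _ F G hF hG pF pG h
    have hFG : ∀ z x, F z x = G z x := by
      intro z x
      have e1 : ∀ H : (Fin 0 → ℝ) → ℝ, ∫ y in Set.Icc (0 : Fin 0 → ℝ) 1, H y
          = volume.real (Set.Icc (0 : Fin 0 → ℝ) 1) * H x := by
        intro H
        have : H = fun _ => H x := by ext y; rw [Subsingleton.elim y x]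
        rw [this, setIntegral_const]; simp
      have := h z
      rw [e1, e1] at this
      exact mul_left_cancel₀ (cube_vol_pos 0).ne' this
    refine ⟨fun z x => x, fun z x => x, continuous_snd, continuous_snd, fun z x hx => hx,
      fun z x k => k.elim0, fun z x k => k.elim0, ?_, ?_⟩
    · intro z x hx; simp [hFG]
    · intro z φ hφ; simp only [hFG]
  | succ n ih =>
    intro Z _ _ _ F G hF hG pF pG h
    have margc : ∀ H : Z → (Fin (n+1) → ℝ) → ℝ, Continuous (Function.uncurry H) →
        Continuous (fun p : Z × ℝ => ∫ y in Set.Icc (0 : Fin n → ℝ) 1, H p.1 (Fin.cons p.2 y)) := by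
      intro H hH
      refine continuous_parametric_integral_of_continuous ?_ isCompact_Icc
      refine hH.comp ((continuous_fst.comp continuous_fst).prodMk ?_)
      exact cons_continuous (continuous_snd.comp continuous_fst) continuous_snd
    have slicec : ∀ H : Z → (Fin (n+1) → ℝ) → ℝ, Continuous (Function.uncurry H) → ∀ z t,
        Continuous fun y : Fin n → ℝ => H z (Fin.cons t y) := by
      intro H hH z t
      refine hH.comp (continuous_const.prodMk ?_)
      exact cons_continuous continuous_const continuous_id
    have margp : ∀ H : Z → (Fin (n+1) → ℝ) → ℝ, Continuous (Function.uncurry H) →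
        (∀ z t, 0 < H z t) → ∀ z t, 0 < ∫ y in Set.Icc (0 : Fin n → ℝ) 1, H z (Fin.cons t y) := by
      intro H hH pH z t
      have hc := slicec H hH z t
      have hIntg : IntegrableOn (fun y : Fin n → ℝ => H z (Fin.cons t y)) (Set.Icc 0 1) :=
        hc.continuousOn.integrableOn_compact isCompact_Icc
      rw [setIntegral_pos_iff_support_of_nonneg_ae
        (Eventually.of_forall fun y => (pH _ _).le) hIntg]
      have : (Function.support fun y : Fin n → ℝ => H z (Fin.cons t y)) = Set.univ := by
        ext y; simp [(pH z (Fin.cons t y)).ne']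
      rw [this, Set.univ_inter]
      simp [Real.volume_Icc_pi]
    set F1 : Z → ℝ → ℝ := fun z t => ∫ y in Set.Icc (0 : Fin n → ℝ) 1, F z (Fin.cons t y) with hF1
    set G1 : Z → ℝ → ℝ := fun z t => ∫ y in Set.Icc (0 : Fin n → ℝ) 1, G z (Fin.cons t y) with hG1
    have cF1 : Continuous (Function.uncurry F1) := margc F hF
    have cG1 : Continuous (Function.uncurry G1) := margc G hG
    have pF1 : ∀ z t, 0 < F1 z t := margp F hF pF
    have pG1 : ∀ z t, 0 < G1 z t := margp G hG pG
    have hz : ∀ H : Z → (Fin (n+1) → ℝ) → ℝ, Continuous (Function.uncurry H) → ∀ z,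
        Continuous (H z) := fun H hH z => hH.comp (Continuous.prodMk_right z)
    have fub : ∀ g : (Fin (n+1) → ℝ) → ℝ, ContinuousOn g (Set.Icc 0 1) →
      ∫ x in Set.Icc (0 : Fin (n+1) → ℝ) 1, g x =
        ∫ t in (0:ℝ)..1, ∫ y in Set.Icc (0 : Fin n → ℝ) 1, g (Fin.cons t y) := by
      intro g hg
      rw [cube_fubini' 0 g hg]; simp only [Fin.insertNth_zero']
    have h1 : ∀ z, ∫ t in (0:ℝ)..1, F1 z t = ∫ t in (0:ℝ)..1, G1 z t := by
      intro z
      have := h z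
      rwa [fub _ (hz F hF z).continuousOn, fub _ (hz G hG z).continuousOn] at this
    obtain ⟨T1, D1, cT1, cD1, T10, T11, memT1, pD1, dT1, eqT1⟩ := knothe1 F1 G1 cF1 cG1 pF1 pG1 h1
    obtain ⟨T', D', cT', cD', memT', pD', dT', eqT', intT'⟩ := ih (Z × ℝ)
      (fun p y => F p.1 (Fin.cons p.2 y) / F1 p.1 p.2)
      (fun p y => G p.1 (Fin.cons (T1 p.1 p.2) y) / G1 p.1 (T1 p.1 p.2))
      (by
        refine Continuous.div ?_ ?_ (fun p => (pF1 _ _).ne')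
        · refine hF.comp ((continuous_fst.comp continuous_fst).prodMk ?_)
          exact cons_continuous (continuous_snd.comp continuous_fst) continuous_snd
        · exact cF1.comp continuous_fst)
      (by
        refine Continuous.div ?_ ?_ (fun p => (pG1 _ _).ne')
        · refine hG.comp ((continuous_fst.comp continuous_fst).prodMk ?_)
          exact cons_continuous (cT1.comp continuous_fst) continuous_snd
        · exact cG1.comp ((continuous_fst.comp continuous_fst).prodMk (cT1.comp continuous_fst)))
      (fun p y => div_pos (pF _ _) (pF1 _ _)) (fun p y => div_pos (pG _ _) (pG1 _ _))
      (by
        intro p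
        rw [integral_div, integral_div, div_self (pF1 _ _).ne', div_self (pG1 _ _).ne'])
    have ctail : Continuous (fun x : Fin (n+1) → ℝ => (Fin.tail x : Fin n → ℝ)) := by
      unfold Fin.tail; fun_prop
    have consc : ∀ x : Fin (n+1) → ℝ, x = Fin.cons (x 0) (Fin.tail x) := fun x =>
      (Fin.cons_self_tail x).symm
    refine ⟨fun z x => Fin.cons (T1 z (x 0)) (T' (z, x 0) (Fin.tail x)),
      fun z x => Fin.cons (D1 z (x 0)) (D' (z, x 0) (Fin.tail x)), ?_, ?_, ?_, ?_, ?_, ?_, ?_⟩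
    · refine cons_continuous (cT1.comp (continuous_fst.prodMk ((continuous_apply 0).comp continuous_snd))) ?_
      exact cT'.comp ((continuous_fst.prodMk ((continuous_apply 0).comp continuous_snd)).prodMk
        (ctail.comp continuous_snd))
    · refine cons_continuous (cD1.comp (continuous_fst.prodMk ((continuous_apply 0).comp continuous_snd))) ?_
      exact cD'.comp ((continuous_fst.prodMk ((continuous_apply 0).comp continuous_snd)).prodMk
        (ctail.comp continuous_snd))
    · intro z x hx
      rw [consc x, cons_mem_cube] at hx
      rw [cons_mem_cube]
      exact ⟨memT1 z _ hx.1, memT' _ _ hx.2⟩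
    · intro z x k
      refine Fin.cases ?_ (fun k => ?_) k
      · simpa using pD1 _ _
      · simpa using pD' _ _ _
    · intro z x k
      refine Fin.cases ?_ (fun k => ?_) k
      · simpa using dT1 z (x 0)
      · have := dT' (z, x 0) (Fin.tail x) k
        simp only [Fin.cons_succ]
        have e : ∀ t, Fin.tail (Function.update x k.succ t) = Function.update (Fin.tail x) k t := by
          intro t; exact Fin.tail_update_succ _ _ _
        have e2 : ∀ t, Function.update x k.succ t 0 = x 0 := by
          intro t; exact Function.update_of_ne (Fin.succ_ne_zero k).symm _ _
        simp only [e, e2]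
        exact this
    · intro z x hx
      have hx' := hx
      rw [consc x, cons_mem_cube] at hx
      have a1 := eqT1 z _ hx.1
      have a2 := eqT' (z, x 0) _ hx.2
      simp only [Fin.prod_univ_succ, Fin.cons_zero, Fin.cons_succ]
      simp only [Fin.cons_self_tail] at a2
      have g1 := (pG1 z (T1 z (x 0))).ne'
      have f1 := (pF1 z (x 0)).ne'
      field_simp at a2
      have : D1 z (x 0) * (∏ i, D' (z, x 0) (Fin.tail x) i) *
          G z (Fin.cons (T1 z (x 0)) (T' (z, x 0) (Fin.tail x))) * F1 z (x 0) = F z x * F1 z (x 0) := by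
        calc _ = D1 z (x 0) * (F1 z (x 0) * (∏ i, D' (z, x 0) (Fin.tail x) i) *
          G z (Fin.cons (T1 z (x 0)) (T' (z, x 0) (Fin.tail x)))) := by ring
          _ = (D1 z (x 0) * G1 z (T1 z (x 0))) * F z x := by linear_combination (D1 z (x 0)) * a2
          _ = _ := by rw [a1]; ring
      exact mul_right_cancel₀ f1 this
    · intro z φ hφ
      have cTz : Continuous fun x : Fin (n+1) → ℝ =>
          (Fin.cons (T1 z (x 0)) (T' (z, x 0) (Fin.tail x)) : Fin (n+1) → ℝ) := by
        refine cons_continuous (cT1.comp (continuous_const.prodMk (continuous_apply 0))) ?_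
        exact cT'.comp ((continuous_const.prodMk (continuous_apply 0)).prodMk ctail)
      have w1 := fub (fun x => F z x * φ (Fin.cons (T1 z (x 0)) (T' (z, x 0) (Fin.tail x))))
        ((hz F hF z).mul (hφ.comp cTz)).continuousOn
      have w2 := fub (fun x => G z x * φ x) ((hz G hG z).mul hφ).continuousOn
      rw [w1, w2]
      simp only [Fin.cons_zero, Fin.tail_cons]
      set Θ : ℝ → ℝ := fun s => ∫ y in Set.Icc (0 : Fin n → ℝ) 1, G z (Fin.cons s y) * φ (Fin.cons s y) with hΘ
      have cΘ : Continuous Θ := by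
        have := (margc (fun z x => G z x * φ x) (hG.mul (hφ.comp continuous_snd)))
        exact this.comp (Continuous.prodMk_right z)
      have e : ∀ t ∈ Set.uIcc (0:ℝ) 1, (∫ y in Set.Icc (0 : Fin n → ℝ) 1, F z (Fin.cons t y) *
          φ (Fin.cons (T1 z t) (T' (z, t) y))) = (Θ ∘ (T1 z)) t * D1 z t := by
        intro t ht
        rw [Set.uIcc_of_le zero_le_one] at ht
        have b := intT' (z, t) (fun y => φ (Fin.cons (T1 z t) y))
          (hφ.comp (cons_continuous continuous_const continuous_id))
        have l : (∫ y in Set.Icc (0 : Fin n → ℝ) 1, F z (Fin.cons t y) *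
          φ (Fin.cons (T1 z t) (T' (z, t) y))) = F1 z t * ∫ y in Set.Icc (0 : Fin n → ℝ) 1, F z (Fin.cons t y) / F1 z t *
          φ (Fin.cons (T1 z t) (T' (z, t) y)) := by
          rw [← integral_const_mul]
          refine integral_congr_ae (Eventually.of_forall fun y => ?_)
          have := (pF1 z t).ne'
          field_simp
        have r : (∫ y in Set.Icc (0 : Fin n → ℝ) 1, G z (Fin.cons (T1 z t) y) / G1 z (T1 z t) *
          φ (Fin.cons (T1 z t) y)) = Θ (T1 z t) / G1 z (T1 z t) := by
          rw [hΘ, ← integral_div]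
          refine integral_congr_ae (Eventually.of_forall fun y => ?_)
          have := (pG1 z (T1 z t)).ne'
          field_simp
        rw [l, b, r, ← eqT1 z t ht]
        have := (pG1 z (T1 z t)).ne'
        simp only [Function.comp]
        field_simp
      rw [intervalIntegral.integral_congr e,
        intervalIntegral.integral_comp_mul_deriv (fun t _ => dT1 z t)
          (cD1.comp (Continuous.prodMk_right z)).continuousOn cΘ, T10, T11]

lemma cs_aux {P A X : ℝ} (hA : 0 ≤ A) (hX : 0 < X) (h : ∀ l > (0:ℝ), P ≤ l * A / 2 + X / (2 * l)) :
    P ≤ √A * √X := by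
  rcases hA.eq_or_lt with h0 | h0
  · subst h0
    simp only [Real.sqrt_zero, zero_mul]
    by_contra hP
    push Not at hP
    have := h (X / P) (by positivity)
    have e : X / (2 * (X / P)) = P / 2 := by field_simp
    rw [e] at this; simp at this; linarith
  · have sA := Real.sqrt_pos.2 h0
    have sX := Real.sqrt_pos.2 hX
    have := h (√X / √A) (by positivity)
    have e : √X / √A * A / 2 + X / (2 * (√X / √A)) = √A * √X := by
      have e1 : √X / √A * A = √A * √X := by
        rw [div_mul_eq_mul_div, div_eq_iff sA.ne']
        nth_rewrite 1 [← Real.mul_self_sqrt h0.le]; ring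
      have e2 : X / (2 * (√X / √A)) = √A * √X / 2 := by
        rw [div_eq_iff (by positivity)]
        field_simp
        rw [Real.sq_sqrt hX.le]
      rw [e1, e2]; ring
    linarith

lemma young_aux {q a s b : ℝ} (hq : 1 < q) (ha : 0 ≤ a) (hs : 0 ≤ s) (hb : 0 < b) :
    q * s ^ (q - 1) * a - (q - 1) * b * s ^ q ≤ a ^ q * b ^ (-(q - 1)) := by
  have q0 : 0 < q := by linarith
  have hc : q.HolderConjugate (q / (q - 1)) := Real.HolderConjugate.conjExponent hq
  have y := Real.young_inequality_of_nonneg (a := a * b ^ (-((q-1)/q)))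
    (b := s ^ (q-1) * b ^ ((q-1)/q)) (by positivity) (by positivity) hc
  have e1 : a * b ^ (-((q-1)/q)) * (s ^ (q-1) * b ^ ((q-1)/q)) = a * s ^ (q-1) := by
    rw [Real.rpow_neg hb.le]
    have : b ^ ((q-1)/q) ≠ 0 := (Real.rpow_pos_of_pos hb _).ne'
    field_simp
  have e2 : (a * b ^ (-((q-1)/q))) ^ q = a ^ q * b ^ (-(q-1)) := by
    rw [Real.mul_rpow ha (by positivity), ← Real.rpow_mul hb.le]
    congr 2; field_simp
  have q1 : q - 1 ≠ 0 := by linarith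
  have e3 : (s ^ (q-1) * b ^ ((q-1)/q)) ^ (q / (q-1)) = s ^ q * b := by
    rw [Real.mul_rpow (by positivity) (by positivity), ← Real.rpow_mul hb.le, ← Real.rpow_mul hs]
    have : (q-1)/q * (q/(q-1)) = 1 := by field_simp
    rw [this, Real.rpow_one]
    congr 2; field_simp
  rw [e1, e2, e3] at y
  have y2 := mul_le_mul_of_nonneg_left y q0.le
  have e4 : q * (a ^ q * b ^ (-(q-1)) / q + s ^ q * b / (q / (q-1))) =
      a ^ q * b ^ (-(q-1)) + (q-1) * b * s ^ q := by field_simp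
  rw [e4] at y2
  linarith

def bvec (d : ℕ) (R : ℝ) (k : Fin (d+1)) : ℝ := if k = 0 then 1 else -R/2

def om (d : ℕ) (R : ℝ) (y : Fin (d+1) → ℝ) : ℝ := ∑ k, (R * y k + bvec d R k) ^ 2

def JR (d : ℕ) (R : ℝ) : ℝ := R ^ (d+1) * ∫ y in Set.Icc (0 : Fin (d+1) → ℝ) 1, ((om d R y) ^ d)⁻¹

lemma om_cont (d : ℕ) (R : ℝ) : Continuous (om d R) := by unfold om; fun_prop

lemma insertNth_mem {n : ℕ} {k : Fin (n+1)} {t : ℝ} {y : Fin n → ℝ} (ht : t ∈ Set.Icc (0:ℝ) 1)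
    (hy : y ∈ Set.Icc (0 : Fin n → ℝ) 1) :
    (k.insertNth t y : Fin (n+1) → ℝ) ∈ Set.Icc (0 : Fin (n+1) → ℝ) 1 := by
  simp only [Set.mem_Icc, Fin.le_insertNth_iff, Fin.insertNth_le_iff]
  exact ⟨⟨ht.1, fun i => hy.1 i⟩, ⟨ht.2, fun i => hy.2 i⟩⟩

/-- integration by parts in the direction `k` -/
lemma ibp_cube {n : ℕ} (k : Fin (n+1)) (U V U' V' : (Fin (n+1) → ℝ) → ℝ)
    (cU : ContinuousOn U (Set.Icc 0 1)) (cV : ContinuousOn V (Set.Icc 0 1))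
    (cU' : ContinuousOn U' (Set.Icc 0 1)) (cV' : ContinuousOn V' (Set.Icc 0 1))
    (dU : ∀ x ∈ Set.Icc (0 : Fin (n+1) → ℝ) 1, x k ∈ Set.Ioo (0:ℝ) 1 →
      HasDerivAt (fun t => U (Function.update x k t)) (U' x) (x k))
    (dV : ∀ x ∈ Set.Icc (0 : Fin (n+1) → ℝ) 1, x k ∈ Set.Ioo (0:ℝ) 1 →
      HasDerivAt (fun t => V (Function.update x k t)) (V' x) (x k)) :
    ∫ x in Set.Icc (0 : Fin (n+1) → ℝ) 1, U x * V' x =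
      (∫ y in Set.Icc (0 : Fin n → ℝ) 1, (U (k.insertNth 1 y) * V (k.insertNth 1 y) -
        U (k.insertNth 0 y) * V (k.insertNth 0 y))) -
      ∫ x in Set.Icc (0 : Fin (n+1) → ℝ) 1, U' x * V x := by
  have line : ∀ y ∈ Set.Icc (0 : Fin n → ℝ) 1, ∀ W : (Fin (n+1) → ℝ) → ℝ,
      ContinuousOn W (Set.Icc 0 1) → ContinuousOn (fun t : ℝ => W (k.insertNth t y)) (Set.Icc 0 1) := by
    intro y hy W hW
    refine hW.comp (Continuous.continuousOn ?_) (fun t ht => insertNth_mem ht hy)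
    exact Continuous.finInsertNth k continuous_id continuous_const
  have par : ∀ W : (Fin (n+1) → ℝ) → ℝ, ContinuousOn W (Set.Icc 0 1) →
      IntegrableOn (fun y : Fin n → ℝ => ∫ t in (0:ℝ)..1, W (k.insertNth t y)) (Set.Icc 0 1) := by
    intro W hW
    have hc : ContinuousOn (fun p : (Fin n → ℝ) × ℝ => W (k.insertNth p.2 p.1))
        (Set.Icc (0 : Fin n → ℝ) 1 ×ˢ Set.Icc (0:ℝ) 1) := by
      refine hW.comp (Continuous.continuousOn ?_) ?_
      · exact Continuous.finInsertNth k continuous_snd continuous_fst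
      · rintro ⟨y, t⟩ ⟨hy, ht⟩
        exact insertNth_mem ht hy
    have hi : IntegrableOn (fun p : (Fin n → ℝ) × ℝ => W (k.insertNth p.2 p.1))
        (Set.Icc (0 : Fin n → ℝ) 1 ×ˢ Set.Icc (0:ℝ) 1) (Measure.prod volume volume) :=
      hc.integrableOn_compact (isCompact_Icc.prod isCompact_Icc)
    unfold IntegrableOn at hi
    rw [← Measure.prod_restrict] at hi
    have := hi.integral_prod_left
    unfold IntegrableOn
    refine this.congr (Eventually.of_forall fun y => ?_)
    simp only
    rw [intervalIntegral.integral_of_le zero_le_one, integral_Icc_eq_integral_Ioc]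
  have bdry : ∀ s ∈ Set.Icc (0:ℝ) 1, IntegrableOn (fun y : Fin n → ℝ => U (k.insertNth s y) * V (k.insertNth s y))
      (Set.Icc 0 1) := by
    intro s hs
    refine ContinuousOn.integrableOn_compact isCompact_Icc ?_
    refine (cU.mul cV).comp (Continuous.continuousOn ?_) (fun y hy => insertNth_mem hs hy)
    exact Continuous.finInsertNth k continuous_const continuous_id
  have w1 := cube_fubini k (fun x => U x * V' x) (cU.mul cV')
  have w2 := cube_fubini k (fun x => U' x * V x) (cU'.mul cV)
  rw [w1, w2, ← integral_sub]
  · refine setIntegral_congr_fun measurableSet_Icc fun y hy => ?_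
    have hder : ∀ W W' : (Fin (n+1) → ℝ) → ℝ, (∀ x ∈ Set.Icc (0 : Fin (n+1) → ℝ) 1, x k ∈ Set.Ioo (0:ℝ) 1 →
      HasDerivAt (fun t => W (Function.update x k t)) (W' x) (x k)) → ∀ t ∈ Set.Ioo (0:ℝ) 1,
      HasDerivAt (fun t : ℝ => W (k.insertNth t y)) (W' (k.insertNth t y)) t := by
      intro W W' hW t ht
      have := hW (k.insertNth t y) (insertNth_mem (Set.Ioo_subset_Icc_self ht) hy)
        (by simpa using ht)
      simpa [Fin.update_insertNth] using this
    rw [intervalIntegral.integral_mul_deriv_eq_deriv_mul_of_hasDerivAt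
      (u := fun t : ℝ => U (k.insertNth t y)) (v := fun t : ℝ => V (k.insertNth t y))
      (u' := fun t : ℝ => U' (k.insertNth t y)) (v' := fun t : ℝ => V' (k.insertNth t y))]
    · rw [Set.uIcc_of_le zero_le_one]; exact line y hy U cU
    · rw [Set.uIcc_of_le zero_le_one]; exact line y hy V cV
    · intro t ht; simp only [zero_le_one, min_eq_left, max_eq_right] at ht; exact hder U U' dU t ht
    · intro t ht; simp only [zero_le_one, min_eq_left, max_eq_right] at ht; exact hder V V' dV t ht
    · exact (line y hy U' cU').intervalIntegrable_of_Icc zero_le_one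
    · exact (line y hy V' cV').intervalIntegrable_of_Icc zero_le_one
  · exact (bdry 1 ⟨zero_le_one, le_rfl⟩).sub (bdry 0 ⟨le_rfl, zero_le_one⟩)
  · exact par _ (cU'.mul cV)

def clamp {n : ℕ} (x : Fin n → ℝ) : Fin n → ℝ := fun k => max 0 (min 1 (x k))

lemma clamp_cont {n : ℕ} : Continuous (clamp (n := n)) := by unfold clamp; fun_prop

lemma clamp_mem {n : ℕ} (x : Fin n → ℝ) : clamp x ∈ Set.Icc (0 : Fin n → ℝ) 1 :=
  ⟨fun _ => le_max_left _ _, fun _ => max_le zero_le_one (min_le_left _ _)⟩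

lemma clamp_eq {n : ℕ} {x : Fin n → ℝ} (h : x ∈ Set.Icc (0 : Fin n → ℝ) 1) : clamp x = x := by
  ext k
  have h1 := h.1 k
  have h2 := h.2 k
  simp only [Pi.zero_apply, Pi.one_apply] at h1 h2
  simp [clamp, h1, h2]

lemma one_le_om {d : ℕ} {R : ℝ} (hR : 0 < R) {y : Fin (d+1) → ℝ} (hy : y ∈ Set.Icc (0 : Fin (d+1) → ℝ) 1) :
    1 ≤ om d R y := by
  unfold om
  have : (R * y 0 + bvec d R 0) ^ 2 ≤ ∑ k, (R * y k + bvec d R k) ^ 2 :=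
    Finset.single_le_sum (f := fun k => (R * y k + bvec d R k) ^ 2) (fun i _ => sq_nonneg _) (Finset.mem_univ 0)
  refine le_trans ?_ this
  have h1 := hy.1 0
  simp only [Pi.zero_apply] at h1
  have : 0 ≤ R * y 0 := mul_nonneg hR.le h1
  simp only [bvec, if_true]
  nlinarith

lemma amgm_aux {N : ℕ} (hN : 0 < N) (D : Fin N → ℝ) (hD : ∀ k, 0 < D k) :
    (N:ℝ) * (∏ k, D k) ^ (1 / (N:ℝ)) ≤ ∑ k, D k := by
  have h := Real.geom_mean_le_arith_mean_weighted Finset.univ (fun _ => 1 / (N:ℝ)) D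
    (fun _ _ => by positivity) (by simp; field_simp) (fun k _ => (hD k).le)
  rw [Real.finsetProd_rpow _ _ (fun k _ => (hD k).le)] at h
  rw [← Finset.mul_sum] at h
  have n0 : (0:ℝ) < N := by exact_mod_cast hN
  calc _ ≤ (N:ℝ) * (1 / (N:ℝ) * ∑ k, D k) := by gcongr
    _ = _ := by field_simp

lemma S_abs {d : ℕ} {R : ℝ} (hR : 0 < R) {y : Fin (d+1) → ℝ} (hy : y ∈ Set.Icc (0 : Fin (d+1) → ℝ) 1) (k) :
    |R * y k + bvec d R k| ≤ 2 * R + 1 := by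
  have h1 := hy.1 k
  have h2 := hy.2 k
  simp only [Pi.zero_apply, Pi.one_apply] at h1 h2
  have a1 : R * y k ≤ R := by nlinarith
  have a2 : 0 ≤ R * y k := by positivity
  unfold bvec
  split_ifs
  · rw [abs_le]; constructor <;> linarith
  · rw [abs_le]; constructor <;> linarith

lemma JR_pos (d : ℕ) {R : ℝ} (hR : 0 < R) : 0 < JR d R := by
  unfold JR
  refine mul_pos (by positivity) ?_
  rw [setIntegral_pos_iff_support_of_nonneg_ae]
  · have hs : Set.Icc (0 : Fin (d+1) → ℝ) 1 ⊆ Function.support (fun y => ((om d R y) ^ d)⁻¹) := by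
      intro y hy
      have := one_le_om hR hy
      simp only [Function.mem_support]
      positivity
    rw [Set.inter_eq_self_of_subset_right hs]
    have := cube_vol_pos (d+1)
    rw [measureReal_def, ENNReal.toReal_pos_iff] at this
    exact this.1
  · filter_upwards [ae_restrict_mem measurableSet_Icc] with y hy
    have := one_le_om hR hy
    simp only [Pi.zero_apply]
    positivity
  · refine ContinuousOn.integrableOn_compact isCompact_Icc ?_
    refine ContinuousOn.inv₀ ((om_cont d R).continuousOn.pow d) ?_
    intro y hy
    have := one_le_om hR hy
    positivity

lemma setInt_pos {n : ℕ} {f : (Fin n → ℝ) → ℝ} (hf : ContinuousOn f (Set.Icc 0 1))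
    (hp : ∀ x ∈ Set.Icc (0 : Fin n → ℝ) 1, 0 < f x) : 0 < ∫ x in Set.Icc (0 : Fin n → ℝ) 1, f x := by
  rw [setIntegral_pos_iff_support_of_nonneg_ae]
  · have hs : Set.Icc (0 : Fin n → ℝ) 1 ⊆ Function.support f := fun y hy => (hp y hy).ne'
    rw [Set.inter_eq_self_of_subset_right hs]
    have := cube_vol_pos n
    rw [measureReal_def, ENNReal.toReal_pos_iff] at this
    exact this.1
  · filter_upwards [ae_restrict_mem measurableSet_Icc] with y hy
    exact (hp y hy).le
  · exact hf.integrableOn_compact isCompact_Icc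

/-- The transport step. -/
lemma box_transport (d : ℕ) (hd : 2 ≤ d) {R : ℝ} (hR : 0 < R) (f : (Fin (d+1) → ℝ) → ℝ)
    (hf : ContinuousOn f (Set.Icc 0 1)) (hp : ∀ x ∈ Set.Icc (0 : Fin (d+1) → ℝ) 1, 0 < f x) :
    ∃ (T D : (Fin (d+1) → ℝ) → (Fin (d+1) → ℝ)) (X : ℝ), 0 < X ∧ Continuous T ∧ Continuous D ∧
      (∀ x ∈ Set.Icc (0 : Fin (d+1) → ℝ) 1, T x ∈ Set.Icc (0 : Fin (d+1) → ℝ) 1) ∧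
      (∀ x k, HasDerivAt (fun t => T (Function.update x k t) k) (D x k) (x k)) ∧
      X = ∫ x in Set.Icc (0 : Fin (d+1) → ℝ) 1, f x ^ (2 * ((d:ℝ)+1) / (d-1)) * om d R (T x) ∧
      (d+1) * JR d R ^ (1 / ((d:ℝ)+1)) * X ^ ((d:ℝ) / (d+1)) ≤
        ∫ x in Set.Icc (0 : Fin (d+1) → ℝ) 1, ∑ k, f x ^ (2 * (d:ℝ) / (d-1)) * (R * D x k) := by
  have d1 : (0:ℝ) < (d:ℝ) - 1 := by
    have : (2:ℝ) ≤ d := by exact_mod_cast hd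
    linarith
  have d0 : (0:ℝ) < (d:ℝ) := by linarith
  set p : ℝ := 2 * ((d:ℝ)+1) / (d-1) with hpdef
  set q : ℝ := 2 * (d:ℝ) / (d-1) with hqdef
  have fc : Continuous (fun x => f (clamp x)) :=
    hf.comp_continuous clamp_cont clamp_mem
  have fpos : ∀ x, 0 < f (clamp x) := fun x => hp _ (clamp_mem x)
  have cfp : ∀ r : ℝ, ContinuousOn (fun x => f x ^ r) (Set.Icc 0 1) := fun r =>
    hf.rpow_const (fun x hx => Or.inl (hp x hx).ne')
  set M := ∫ x in Set.Icc (0 : Fin (d+1) → ℝ) 1, f x ^ p with hM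
  have Mpos : 0 < M := setInt_pos (cfp p) (fun x hx => Real.rpow_pos_of_pos (hp x hx) _)
  have omc : Continuous (fun y => om d R (clamp y)) := (om_cont d R).comp clamp_cont
  have ompos : ∀ y, 0 < om d R (clamp y) := fun y =>
    lt_of_lt_of_le one_pos (one_le_om hR (clamp_mem y))
  set Zc := ∫ y in Set.Icc (0 : Fin (d+1) → ℝ) 1, ((om d R (clamp y)) ^ (d+1))⁻¹ with hZ
  have cG : Continuous (fun y => ((om d R (clamp y)) ^ (d+1))⁻¹) :=
    (omc.pow _).inv₀ (fun y => (pow_pos (ompos y) _).ne')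
  have Zpos : 0 < Zc := setInt_pos cG.continuousOn (fun y _ => by have := ompos y; positivity)
  set J' := ∫ y in Set.Icc (0 : Fin (d+1) → ℝ) 1, ((om d R y) ^ d)⁻¹ with hJ'
  have Jeq : JR d R = R ^ (d+1) * J' := rfl
  have J'pos : 0 < J' := by
    have := JR_pos d hR
    rw [Jeq] at this
    exact pos_of_mul_pos_right this (by positivity)
  obtain ⟨T, D, cT, cD, hT, hD, hder, hMA, hIntg⟩ := knothe (d+1) Unit
    (fun _ x => f (clamp x) ^ p / M) (fun _ y => ((om d R (clamp y)) ^ (d+1))⁻¹ / Zc)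
    (by
      have : Continuous (fun x => f (clamp x) ^ p / M) :=
        (fc.rpow_const (fun x => Or.inl (fpos x).ne')).div_const _
      exact this.comp continuous_snd)
    (by exact (cG.div_const _).comp continuous_snd)
    (fun _ x => by have := fpos x; positivity)
    (fun _ y => by have := ompos y; positivity)
    (fun _ => by
      rw [integral_div, integral_div, ← hZ, div_self Zpos.ne']
      have : ∫ x in Set.Icc (0 : Fin (d+1) → ℝ) 1, f (clamp x) ^ p = M :=
        setIntegral_congr_fun measurableSet_Icc (fun x hx => by simp only [clamp_eq hx])
      rw [this, div_self Mpos.ne'])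
  have cT' : Continuous (T ()) := by
    have := cT.comp (Continuous.prodMk_right ())
    exact this
  have cD' : Continuous (D ()) := by
    have := cD.comp (Continuous.prodMk_right ())
    exact this
  set X := ∫ x in Set.Icc (0 : Fin (d+1) → ℝ) 1, f x ^ p * om d R (T () x) with hX
  have Xeq : X = M * J' / Zc := by
    have h1 := hIntg () (fun y => om d R (clamp y)) omc
    have h2 : ∫ x in Set.Icc (0 : Fin (d+1) → ℝ) 1, f (clamp x) ^ p / M * om d R (clamp (T () x)) = X / M := by
      rw [hX, ← integral_div]
      refine setIntegral_congr_fun measurableSet_Icc (fun x hx => ?_)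
      rw [clamp_eq hx, clamp_eq (hT () x hx)]; ring
    have h3 : ∫ y in Set.Icc (0 : Fin (d+1) → ℝ) 1, ((om d R (clamp y)) ^ (d+1))⁻¹ / Zc * om d R (clamp y) = J' / Zc := by
      rw [hJ', ← integral_div]
      refine setIntegral_congr_fun measurableSet_Icc (fun x hx => ?_)
      have := ompos x
      rw [clamp_eq hx] at this ⊢
      field_simp
      ring
    rw [h2, h3] at h1
    rw [div_eq_iff Mpos.ne'] at h1
    rw [h1]; ring
  have Xpos : 0 < X := by rw [Xeq]; positivity
  refine ⟨T (), D (), X, Xpos, cT', cD', hT (), hder (), rfl, ?_⟩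
  have key : ∀ x ∈ Set.Icc (0 : Fin (d+1) → ℝ) 1,
      (d+1) * R * (J' / X) ^ (1 / ((d:ℝ)+1)) * (f x ^ p * om d R (T () x)) ≤
        ∑ k, f x ^ q * (R * D () x k) := by
    intro x hx
    have h1 := amgm_aux (Nat.succ_pos d) (D () x) (hD () x)
    have fx := hp x hx
    have ox : 0 < om d R (T () x) := lt_of_lt_of_le one_pos (one_le_om hR (hT () x hx))
    have h2 : ∏ k, D () x k = f x ^ p * (J' / X) * om d R (T () x) ^ (d+1) := by
      have := hMA () x hx
      rw [clamp_eq hx, clamp_eq (hT () x hx)] at this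
      have e : J' / X = Zc / M := by rw [Xeq]; field_simp
      rw [e]
      field_simp at this ⊢
      linarith
    have h3 : (∏ k, D () x k) ^ (1 / ((d:ℝ)+1)) = f x ^ (p / (d+1)) * (J' / X) ^ (1 / ((d:ℝ)+1)) * om d R (T () x) := by
      rw [h2, Real.mul_rpow (by positivity) (by positivity), Real.mul_rpow (by positivity) (by positivity),
        ← Real.rpow_mul fx.le, ← Real.rpow_natCast, ← Real.rpow_mul ox.le]
      have : ((d+1 : ℕ):ℝ) * (1 / ((d:ℝ)+1)) = 1 := by push_cast; field_simp
      rw [this, Real.rpow_one]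
      congr 3; ring
    have h4 : f x ^ p = f x ^ q * f x ^ (p / (d+1)) := by
      rw [← Real.rpow_add fx]; congr 1; rw [hpdef, hqdef]; field_simp
    push_cast at h1
    rw [h3] at h1
    have h5 : ∑ k, f x ^ q * (R * D () x k) = f x ^ q * R * ∑ k, D () x k := by
      rw [Finset.mul_sum]; congr 1; ext k; ring
    rw [h5, h4]
    calc _ = f x ^ q * R * (((d:ℝ)+1) * (f x ^ (p / (d+1)) * (J' / X) ^ (1 / ((d:ℝ)+1)) * om d R (T () x))) := by ring
      _ ≤ _ := by gcongr
  have e1 : (d+1) * JR d R ^ (1 / ((d:ℝ)+1)) * X ^ ((d:ℝ) / (d+1)) =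
      (d+1) * R * (J' / X) ^ (1 / ((d:ℝ)+1)) * X := by
    rw [Jeq, Real.mul_rpow (by positivity) J'pos.le, ← Real.rpow_natCast, ← Real.rpow_mul hR.le]
    have : ((d+1 : ℕ):ℝ) * (1 / ((d:ℝ)+1)) = 1 := by push_cast; field_simp
    rw [this, Real.rpow_one, Real.div_rpow J'pos.le Xpos.le]
    have : X ^ ((d:ℝ) / (d+1)) = X / X ^ (1 / ((d:ℝ)+1)) := by
      rw [eq_div_iff (by positivity), ← Real.rpow_add Xpos]
      have : (d:ℝ) / (d+1) + 1 / ((d:ℝ)+1) = 1 := by field_simp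
      rw [this, Real.rpow_one]
    rw [this]; field_simp
  rw [e1]
  nth_rewrite 2 [hX]
  rw [← integral_const_mul]
  refine setIntegral_mono_on ?_ ?_ measurableSet_Icc key
  · refine ContinuousOn.integrableOn_compact isCompact_Icc ?_
    exact continuousOn_const.mul ((cfp p).mul ((om_cont d R).comp cT').continuousOn)
  · refine ContinuousOn.integrableOn_compact isCompact_Icc ?_
    refine continuousOn_finset_sum _ fun k _ => ?_
    refine (cfp q).mul (Continuous.continuousOn ?_)
    exact continuous_const.mul ((continuous_apply k).comp cD')

lemma box_pos (d : ℕ) (hd : 2 ≤ d) {R : ℝ} (hR : 0 < R) (f : (Fin (d+1) → ℝ) → ℝ)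
    (g : Fin (d+1) → (Fin (d+1) → ℝ) → ℝ)
    (hf : ContinuousOn f (Set.Icc 0 1)) (hp : ∀ x ∈ Set.Icc (0 : Fin (d+1) → ℝ) 1, 0 < f x)
    (hg : ∀ k, ContinuousOn (g k) (Set.Icc 0 1))
    (hder : ∀ k, ∀ x ∈ Set.Icc (0 : Fin (d+1) → ℝ) 1, x k ∈ Set.Ioo (0:ℝ) 1 →
      HasDerivAt (fun t => f (Function.update x k t)) (g k x) (x k))
    {τ : ℝ} (hτ : 0 < τ)
    (h1 : ∀ k, ∀ x ∈ Set.Icc (0 : Fin (d+1) → ℝ) 1, x k = 1 → f x ≤ τ)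
    (h0 : ∀ k ≠ 0, ∀ x ∈ Set.Icc (0 : Fin (d+1) → ℝ) 1, x k = 0 → f x ≤ τ) :
    ∫ y in Set.Icc (0 : Fin d → ℝ) 1, f ((0 : Fin (d+1)).insertNth 0 y) ^ (2 * (d:ℝ) / (d-1)) ≤
      √(∫ x in Set.Icc (0 : Fin (d+1) → ℝ) 1, ∑ k, g k x ^ 2) ^ (2 * (d:ℝ) / (d-1)) *
        (((d:ℝ) - 1) * JR d R ^ (1 / ((d:ℝ)+1))) ^ (-(2 * (d:ℝ) / (d-1) - 1)) +
      ((d+1) * (2 * (2 * R + 1)) * volume.real (Set.Icc (0 : Fin d → ℝ) 1)) * τ ^ (2 * (d:ℝ) / (d-1)) := by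
  have d1 : (0:ℝ) < (d:ℝ) - 1 := by
    have : (2:ℝ) ≤ d := by exact_mod_cast hd
    linarith
  have d0 : (0:ℝ) < (d:ℝ) := by linarith
  obtain ⟨T, D, X, Xpos, cT, cD, hT, hTD, hX, hlow⟩ := box_transport d hd hR f hf hp
  set p : ℝ := 2 * ((d:ℝ)+1) / (d-1) with hpdef
  set q : ℝ := 2 * (d:ℝ) / (d-1) with hqdef
  have hq2 : p = 2 * (q - 1) := by rw [hpdef, hqdef]; field_simp; ring
  have hq1 : 1 < q := by rw [hqdef, lt_div_iff₀ d1]; linarith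
  have cfp : ∀ r : ℝ, ContinuousOn (fun x => f x ^ r) (Set.Icc 0 1) := fun r =>
    hf.rpow_const (fun x hx => Or.inl (hp x hx).ne')
  let S : Fin (d+1) → (Fin (d+1) → ℝ) → ℝ := fun k x => R * T x k + bvec d R k
  have cS : ∀ k, Continuous (S k) := fun k =>
    (continuous_const.mul ((continuous_apply k).comp cT)).add continuous_const
  have cDk : ∀ k, Continuous (fun x => R * D x k) := fun k =>
    continuous_const.mul ((continuous_apply k).comp cD)
  have cU' : ∀ k, ContinuousOn (fun x => q * f x ^ (q-1) * g k x) (Set.Icc 0 1) := fun k =>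
    (continuousOn_const.mul (cfp (q-1))).mul (hg k)
  have ibp : ∀ k, _ := fun k => ibp_cube k (fun x => f x ^ q) (S k) (fun x => q * f x ^ (q-1) * g k x)
    (fun x => R * D x k) (cfp q) (cS k).continuousOn (cU' k)
    (cDk k).continuousOn
    (by
      intro x hx hxk
      have := (hder k x hx hxk).rpow_const (p := q) (Or.inl (by
        rw [Function.update_eq_self]; exact (hp x hx).ne'))
      rw [Function.update_eq_self] at this
      convert this using 1; ring)
    (by
      intro x hx hxk
      exact ((hTD x k).const_mul R).add_const _)
  -- boundary terms
  have face : ∀ k : Fin (d+1), ∀ s ∈ Set.Icc (0:ℝ) 1, ∀ H : (Fin (d+1) → ℝ) → ℝ, ContinuousOn H (Set.Icc 0 1) →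
      IntegrableOn (fun y : Fin d → ℝ => H (k.insertNth s y)) (Set.Icc 0 1) := by
    intro k s hs H hH
    refine ContinuousOn.integrableOn_compact isCompact_Icc ?_
    refine hH.comp (Continuous.continuousOn ?_) (fun y hy => insertNth_mem hs hy)
    exact Continuous.finInsertNth k continuous_const continuous_id
  have i0 : (0:ℝ) ∈ Set.Icc (0:ℝ) 1 := ⟨le_rfl, zero_le_one⟩
  have i1 : (1:ℝ) ∈ Set.Icc (0:ℝ) 1 := ⟨zero_le_one, le_rfl⟩
  set vd := volume.real (Set.Icc (0 : Fin d → ℝ) 1) with hvd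
  set B := ∫ y in Set.Icc (0 : Fin d → ℝ) 1, f ((0 : Fin (d+1)).insertNth 0 y) ^ q with hB
  have small : ∀ x ∈ Set.Icc (0 : Fin (d+1) → ℝ) 1, f x ≤ τ → ∀ k, |f x ^ q * S k x| ≤ τ ^ q * (2 * R + 1) := by
    intro x hx hfx k
    have := hp x hx
    rw [abs_mul, abs_of_pos (by positivity)]
    gcongr
    exact S_abs hR (hT x hx) k
  have bd : ∀ k : Fin (d+1), (∫ y in Set.Icc (0 : Fin d → ℝ) 1, (f (k.insertNth 1 y) ^ q * S k (k.insertNth 1 y) -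
        f (k.insertNth 0 y) ^ q * S k (k.insertNth 0 y))) ≤
      (2 * (2 * R + 1) * vd) * τ ^ q - (if k = 0 then B else 0) := by
    intro k
    have I1 := face k 1 i1 (fun x => f x ^ q * S k x) ((cfp q).mul (cS k).continuousOn)
    have I0 := face k 0 i0 (fun x => f x ^ q * S k x) ((cfp q).mul (cS k).continuousOn)
    split_ifs with hk
    · subst hk
      have IB := face 0 0 i0 (fun x => f x ^ q) (cfp q)
      calc _ ≤ ∫ y in Set.Icc (0 : Fin d → ℝ) 1, (2 * (τ ^ q * (2 * R + 1)) - f ((0:Fin (d+1)).insertNth 0 y) ^ q) := by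
            refine setIntegral_mono_on (I1.sub I0) ((integrableOn_const (by exact isCompact_Icc.measure_lt_top.ne)).sub IB) measurableSet_Icc ?_
            intro y hy
            have a1 := small _ (insertNth_mem (k := 0) i1 hy) (h1 0 _ (insertNth_mem i1 hy) (by simp)) 0
            have a2 := hp _ (insertNth_mem (k := 0) i0 hy)
            have a3 : 1 ≤ S 0 ((0:Fin (d+1)).insertNth 0 y) := by
              have := (hT _ (insertNth_mem (k := 0) i0 hy)).1 0
              simp only [Pi.zero_apply] at this
              simp only [S, bvec, if_true]
              nlinarith
            have a4 : 0 < f ((0:Fin (d+1)).insertNth 0 y) ^ q := by positivity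
            have a5 := abs_le.1 a1
            have a6 : 0 < τ ^ q * (2 * R + 1) := by positivity
            nlinarith
        _ = _ := by
          have IC : IntegrableOn (fun _ : Fin d → ℝ => 2 * (τ ^ q * (2 * R + 1))) (Set.Icc 0 1) :=
            integrableOn_const (by exact isCompact_Icc.measure_lt_top.ne)
          rw [integral_sub IC IB, setIntegral_const, ← hvd, ← hB]
          simp only [smul_eq_mul]; ring
    · calc _ ≤ ∫ y in Set.Icc (0 : Fin d → ℝ) 1, (2 * (τ ^ q * (2 * R + 1))) := by
            refine setIntegral_mono_on (I1.sub I0) (integrableOn_const (by exact isCompact_Icc.measure_lt_top.ne)) measurableSet_Icc ?_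
            intro y hy
            have a1 := abs_le.1 (small _ (insertNth_mem (k := k) i1 hy) (h1 k _ (insertNth_mem i1 hy) (by simp)) k)
            have a2 := abs_le.1 (small _ (insertNth_mem (k := k) i0 hy) (h0 k hk _ (insertNth_mem i0 hy) (by simp)) k)
            linarith
        _ = _ := by
          rw [setIntegral_const, ← hvd]
          simp only [smul_eq_mul]; ring
  set A := ∫ x in Set.Icc (0 : Fin (d+1) → ℝ) 1, ∑ k, g k x ^ 2 with hA
  have A0 : 0 ≤ A := integral_nonneg fun x => Finset.sum_nonneg fun k _ => sq_nonneg _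
  set P := ∫ x in Set.Icc (0 : Fin (d+1) → ℝ) 1, ∑ k, -(f x ^ (q-1) * g k x * S k x) with hP
  have cP : ContinuousOn (fun x => ∑ k, -(f x ^ (q-1) * g k x * S k x)) (Set.Icc 0 1) :=
    continuousOn_finset_sum _ fun k _ => (((cfp (q-1)).mul (hg k)).mul (cS k).continuousOn).neg
  have cA : ContinuousOn (fun x => ∑ k, g k x ^ 2) (Set.Icc 0 1) :=
    continuousOn_finset_sum _ fun k _ => (hg k).pow 2
  have cX : ContinuousOn (fun x => f x ^ p * om d R (T x)) (Set.Icc 0 1) :=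
    (cfp p).mul ((om_cont d R).comp cT).continuousOn
  have PS : P ≤ √A * √X := by
    refine cs_aux A0 Xpos fun l hl => ?_
    have e : l * A / 2 + X / (2 * l) = ∫ x in Set.Icc (0 : Fin (d+1) → ℝ) 1,
        (l / 2 * (∑ k, g k x ^ 2) + 1 / (2 * l) * (f x ^ p * om d R (T x))) := by
      rw [integral_add, integral_const_mul, integral_const_mul, ← hA, ← hX]
      · ring
      · exact (continuousOn_const.mul cA).integrableOn_compact isCompact_Icc
      · exact (continuousOn_const.mul cX).integrableOn_compact isCompact_Icc
    rw [e]
    refine setIntegral_mono_on (cP.integrableOn_compact isCompact_Icc) ?_ measurableSet_Icc ?_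
    · exact ((continuousOn_const.mul cA).add (continuousOn_const.mul cX)).integrableOn_compact isCompact_Icc
    intro x hx
    have fx := hp x hx
    have e2 : f x ^ p = f x ^ (q-1) * f x ^ (q-1) := by
      rw [← Real.rpow_add fx]; congr 1; rw [hq2]; ring
    rw [e2, om, Finset.mul_sum, Finset.mul_sum, Finset.mul_sum, ← Finset.sum_add_distrib]
    refine Finset.sum_le_sum fun k _ => ?_
    change -(f x ^ (q-1) * g k x * S k x) ≤ l / 2 * g k x ^ 2 + 1 / (2 * l) * (f x ^ (q-1) * f x ^ (q-1) * S k x ^ 2)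
    have : l / 2 * g k x ^ 2 + 1 / (2 * l) * (f x ^ (q-1) * f x ^ (q-1) * S k x ^ 2) + (f x ^ (q-1) * g k x * S k x)
      = 1 / (2 * l) * (l * g k x + f x ^ (q-1) * S k x) ^ 2 := by
      field_simp; ring
    have h3 : 0 ≤ 1 / (2 * l) * (l * g k x + f x ^ (q-1) * S k x) ^ 2 := by positivity
    linarith
  -- sum
  have tot : ∫ x in Set.Icc (0 : Fin (d+1) → ℝ) 1, ∑ k, f x ^ q * (R * D x k) ≤
      (d+1) * ((2 * (2 * R + 1) * vd) * τ ^ q) - B + q * P := by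
    rw [integral_finset_sum]
    swap
    · intro k _
      exact ((cfp q).mul (cDk k).continuousOn).integrableOn_compact isCompact_Icc
    have e3 : q * P = ∑ k, -∫ x in Set.Icc (0 : Fin (d+1) → ℝ) 1, (q * f x ^ (q-1) * g k x) * S k x := by
      rw [hP, integral_finset_sum, Finset.mul_sum]
      · refine Finset.sum_congr rfl fun k _ => ?_
        rw [← integral_const_mul, ← integral_neg]
        congr 1; ext x; ring
      · intro k _
        exact (((cfp (q-1)).mul (hg k)).mul (cS k).continuousOn).neg.integrableOn_compact isCompact_Icc
    have e4 : (d+1) * ((2 * (2 * R + 1) * vd) * τ ^ q) - B = ∑ k : Fin (d+1), ((2 * (2 * R + 1) * vd) * τ ^ q - (if k = 0 then B else 0)) := by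
      rw [Finset.sum_sub_distrib]; simp
    rw [e3, e4, ← Finset.sum_add_distrib]
    refine Finset.sum_le_sum fun k _ => ?_
    rw [ibp k, sub_eq_add_neg]
    gcongr
    exact bd k
  have fin1 : B ≤ q * (√A * √X) - (d+1) * JR d R ^ (1 / ((d:ℝ)+1)) * X ^ ((d:ℝ) / (d+1)) + (d+1) * ((2 * (2 * R + 1) * vd) * τ ^ q) := by
    have : q * P ≤ q * (√A * √X) := by gcongr
    linarith
  have JP := JR_pos d hR
  have y := young_aux (q := q) (a := √A) (s := X ^ (1/p)) (b := ((d:ℝ) - 1) * JR d R ^ (1 / ((d:ℝ)+1))) hq1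
    (Real.sqrt_nonneg _) (by positivity) (by positivity)
  have e5 : (X ^ (1/p)) ^ (q-1) = √X := by
    rw [← Real.rpow_mul Xpos.le, Real.sqrt_eq_rpow]; congr 1; rw [hq2]
    have : q - 1 ≠ 0 := by linarith
    field_simp
  have e6 : (X ^ (1/p)) ^ q = X ^ ((d:ℝ) / (d+1)) := by
    rw [← Real.rpow_mul Xpos.le]; congr 1; rw [hpdef, hqdef]; field_simp
  have e7 : (q - 1) * (((d:ℝ) - 1) * JR d R ^ (1 / ((d:ℝ)+1))) = (d+1) * JR d R ^ (1 / ((d:ℝ)+1)) := by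
    rw [← mul_assoc]; congr 1; rw [hqdef]; field_simp; ring
  rw [e5, e6, e7] at y
  linarith

lemma box_thm (d : ℕ) (hd : 2 ≤ d) {R : ℝ} (hR : 0 < R) (v : (Fin (d+1) → ℝ) → ℝ)
    (g : Fin (d+1) → (Fin (d+1) → ℝ) → ℝ)
    (hv : ContinuousOn v (Set.Icc 0 1))
    (hg : ∀ k, ContinuousOn (g k) (Set.Icc 0 1))
    (hder : ∀ k, ∀ x ∈ Set.Icc (0 : Fin (d+1) → ℝ) 1, x k ∈ Set.Ioo (0:ℝ) 1 →
      HasDerivAt (fun t => v (Function.update x k t)) (g k x) (x k))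
    (h1 : ∀ k, ∀ x ∈ Set.Icc (0 : Fin (d+1) → ℝ) 1, x k = 1 → v x = 0)
    (h0 : ∀ k ≠ 0, ∀ x ∈ Set.Icc (0 : Fin (d+1) → ℝ) 1, x k = 0 → v x = 0) :
    ∫ y in Set.Icc (0 : Fin d → ℝ) 1, |v ((0 : Fin (d+1)).insertNth 0 y)| ^ (2 * (d:ℝ) / (d-1)) ≤
      √(∫ x in Set.Icc (0 : Fin (d+1) → ℝ) 1, ∑ k, g k x ^ 2) ^ (2 * (d:ℝ) / (d-1)) *
        (((d:ℝ) - 1) * JR d R ^ (1 / ((d:ℝ)+1))) ^ (-(2 * (d:ℝ) / (d-1) - 1)) := by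
  have d1 : (0:ℝ) < (d:ℝ) - 1 := by
    have : (2:ℝ) ≤ d := by exact_mod_cast hd
    linarith
  have d0 : (0:ℝ) < (d:ℝ) := by linarith
  set q : ℝ := 2 * (d:ℝ) / (d-1) with hqdef
  have hq0 : 0 < q := by positivity
  have JP := JR_pos d hR
  have i0 : (0:ℝ) ∈ Set.Icc (0:ℝ) 1 := ⟨le_rfl, zero_le_one⟩
  have cv2 : ∀ τ : ℝ, ContinuousOn (fun x => √(v x ^ 2 + τ ^ 2)) (Set.Icc 0 1) := fun τ =>
    ((hv.pow 2).add continuousOn_const).sqrt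
  have main : ∀ τ > (0:ℝ), _ := fun τ hτ => box_pos d hd hR (fun x => √(v x ^ 2 + τ ^ 2))
    (fun k x => v x * g k x / √(v x ^ 2 + τ ^ 2)) (cv2 τ) (fun x _ => by positivity)
    (fun k => (hv.mul (hg k)).div (cv2 τ) (fun x _ => by positivity))
    (by
      intro k x hx hxk
      have h : HasDerivAt (fun t => v (Function.update x k t) ^ 2 + τ ^ 2) (2 * v x * g k x) (x k) := by
        have := ((hder k x hx hxk).fun_pow 2).add_const (τ^2)
        simpa using this
      have := h.sqrt (by rw [Function.update_eq_self]; positivity)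
      rw [Function.update_eq_self] at this
      convert this using 1
      have : (0:ℝ) < √(v x ^ 2 + τ ^ 2) := by positivity
      field_simp)
    hτ
    (by intro k x hx hxk; rw [h1 k x hx hxk]; simp [Real.sqrt_sq hτ.le])
    (by intro k hk x hx hxk; rw [h0 k hk x hx hxk]; simp [Real.sqrt_sq hτ.le])
  rw [← hqdef] at main
  set K := ((d:ℝ)+1) * (2 * (2 * R + 1)) * volume.real (Set.Icc (0 : Fin d → ℝ) 1)
  have step : ∀ τ > (0:ℝ), ∫ y in Set.Icc (0 : Fin d → ℝ) 1, |v ((0 : Fin (d+1)).insertNth 0 y)| ^ q ≤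
      √(∫ x in Set.Icc (0 : Fin (d+1) → ℝ) 1, ∑ k, g k x ^ 2) ^ q *
        (((d:ℝ) - 1) * JR d R ^ (1 / ((d:ℝ)+1))) ^ (-(q - 1)) + K * τ ^ q := by
    intro τ hτ
    have face : ∀ H : (Fin (d+1) → ℝ) → ℝ, ContinuousOn H (Set.Icc 0 1) →
        IntegrableOn (fun y : Fin d → ℝ => H ((0 : Fin (d+1)).insertNth 0 y)) (Set.Icc 0 1) := by
      intro H hH
      refine ContinuousOn.integrableOn_compact isCompact_Icc ?_
      refine hH.comp (Continuous.continuousOn ?_) (fun y hy => insertNth_mem i0 hy)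
      exact Continuous.finInsertNth 0 continuous_const continuous_id
    refine le_trans ?_ (le_trans (main τ hτ) ?_)
    · refine setIntegral_mono_on (face (fun x => |v x| ^ q) (hv.abs.rpow_const fun _ _ => Or.inr hq0.le))
        (face (fun x => √(v x ^ 2 + τ ^ 2) ^ q) ((cv2 τ).rpow_const fun _ _ => Or.inr hq0.le)) measurableSet_Icc ?_
      intro y hy
      refine Real.rpow_le_rpow (abs_nonneg _) ?_ hq0.le
      refine Real.abs_le_sqrt ?_
      nlinarith [sq_nonneg τ]
    · refine add_le_add_left (mul_le_mul_of_nonneg_right (Real.rpow_le_rpow (Real.sqrt_nonneg _) (Real.sqrt_le_sqrt ?_) hq0.le) ?_) _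
      swap
      · exact Real.rpow_nonneg (mul_nonneg d1.le (by positivity)) _
      · refine setIntegral_mono_on ?_ ?_ measurableSet_Icc ?_
        · refine ContinuousOn.integrableOn_compact isCompact_Icc ?_
          refine continuousOn_finset_sum _ fun k _ => ?_
          exact ((hv.mul (hg k)).div (cv2 τ) (fun x _ => by positivity)).pow 2
        · refine ContinuousOn.integrableOn_compact isCompact_Icc ?_
          exact continuousOn_finset_sum _ fun k _ => (hg k).pow 2
        · intro x hx
          refine Finset.sum_le_sum fun k _ => ?_
          rw [div_pow, Real.sq_sqrt (by positivity), div_le_iff₀ (by positivity)]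
          nlinarith [mul_nonneg (sq_nonneg (g k x)) (sq_nonneg τ)]
  refine le_of_forall_pos_le_add fun e he => ?_
  have K0 : 0 < K := by have := cube_vol_pos d; positivity
  have := step ((e / K) ^ (1/q)) (by positivity)
  rw [← Real.rpow_mul (by positivity), one_div_mul_cancel hq0.ne', Real.rpow_one, mul_div_cancel₀ _ K0.ne'] at this
  exact this

def kap (d : ℕ) : ℝ := Real.pi ^ ((d:ℝ)/2) * Real.Gamma ((d:ℝ)/2) / Real.Gamma d

lemma lint_gamma {a r : ℝ} (ha : 0 < a) (hr : 0 < r) :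
    ∫⁻ t in Set.Ioi (0:ℝ), ENNReal.ofReal (t ^ (a - 1) * Real.exp (-(r * t))) =
      ENNReal.ofReal ((1 / r) ^ a * Real.Gamma a) := by
  rw [← Real.integral_rpow_mul_exp_neg_mul_Ioi ha hr, ofReal_integral_eq_lintegral_ofReal]
  · by_contra h
    have e := Real.integral_rpow_mul_exp_neg_mul_Ioi ha hr
    rw [integral_undef h] at e
    have := Real.Gamma_pos_of_pos ha
    have : 0 < (1 / r) ^ a * Real.Gamma a := by positivity
    linarith
  · filter_upwards [ae_restrict_mem measurableSet_Ioi] with t ht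
    have : (0:ℝ) < t := ht
    simp only [Pi.zero_apply]
    positivity

lemma lint_gauss (d : ℕ) {t : ℝ} (ht : 0 < t) :
    ∫⁻ y : Fin d → ℝ, ENNReal.ofReal (Real.exp (-(t * ∑ k, y k ^ 2))) =
      ENNReal.ofReal ((Real.pi / t) ^ ((d:ℝ)/2)) := by
  have e : ∀ y : Fin d → ℝ, Real.exp (-(t * ∑ k, y k ^ 2)) = ∏ k, Real.exp (-t * y k ^ 2) := by
    intro y; rw [← Real.exp_sum, ← Finset.mul_sum]; congr 1; ring
  simp_rw [e]
  have hi : Integrable (fun y : Fin d → ℝ => ∏ k, Real.exp (-t * y k ^ 2)) := 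
    Integrable.fintype_prod (f := fun _ s => Real.exp (-t * s ^ 2)) (fun _ => integrable_exp_neg_mul_sq ht)
  rw [← ofReal_integral_eq_lintegral_ofReal hi (Eventually.of_forall fun y => by positivity)]
  rw [integral_fintype_prod_volume_eq_pow (fun s : ℝ => Real.exp (-t * s ^ 2)), integral_gaussian]
  congr 1
  rw [Fintype.card_fin, Real.sqrt_eq_rpow, ← Real.rpow_natCast, ← Real.rpow_mul (by positivity)]
  congr 1; ring

lemma lint_kap {d : ℕ} (hd : 2 ≤ d) {a : ℝ} (ha : 0 < a) :
    ∫⁻ y : Fin d → ℝ, ENNReal.ofReal (((a ^ 2 + ∑ k, y k ^ 2) ^ d)⁻¹) =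
      ENNReal.ofReal (kap d * a ^ (-(d:ℝ))) := by
  have d0 : (0:ℝ) < d := by have : 0 < d := by omega
                            exact_mod_cast this
  have G0 := Real.Gamma_pos_of_pos d0
  have G1 := Real.Gamma_pos_of_pos (half_pos d0)
  have e : ∀ y : Fin d → ℝ, ENNReal.ofReal (((a ^ 2 + ∑ k, y k ^ 2) ^ d)⁻¹) =
      ∫⁻ t in Set.Ioi (0:ℝ), ENNReal.ofReal (t ^ ((d:ℝ)-1) * Real.exp (-(a^2 * t)) / Real.Gamma d) *
        ENNReal.ofReal (Real.exp (-(t * ∑ k, y k ^ 2))) := by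
    intro y
    have s0 : 0 < a ^ 2 + ∑ k, y k ^ 2 := by
      have : 0 ≤ ∑ k, y k ^ 2 := Finset.sum_nonneg fun k _ => sq_nonneg _
      positivity
    have h := lint_gamma d0 s0
    have h2 : ((a ^ 2 + ∑ k, y k ^ 2) ^ d)⁻¹ = ((1 / (a ^ 2 + ∑ k, y k ^ 2)) ^ (d:ℝ) * Real.Gamma d) * (1 / Real.Gamma d) := by
      rw [Real.rpow_natCast, one_div, inv_pow]; field_simp
    rw [h2, ENNReal.ofReal_mul (by positivity), ← h, ← lintegral_mul_const' _ _ ENNReal.ofReal_ne_top]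
    refine setLIntegral_congr_fun measurableSet_Ioi fun t ht => ?_
    have : (0:ℝ) < t := ht
    rw [← ENNReal.ofReal_mul (by positivity), ← ENNReal.ofReal_mul (by positivity)]
    congr 1
    have : Real.exp (-((a ^ 2 + ∑ k, y k ^ 2) * t)) = Real.exp (-(a^2 * t)) * Real.exp (-(t * ∑ k, y k ^ 2)) := by
      rw [← Real.exp_add]; congr 1; ring
    rw [this]; ring
  simp_rw [e]
  rw [lintegral_lintegral_swap]
  swap
  · refine Measurable.aemeasurable ?_
    have m1 : Measurable (fun p : (Fin d → ℝ) × ℝ => ENNReal.ofReal (p.2 ^ ((d:ℝ)-1) * Real.exp (-(a^2 * p.2)) / Real.Gamma d)) :=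
      ENNReal.measurable_ofReal.comp (by fun_prop)
    have m2 : Measurable (fun p : (Fin d → ℝ) × ℝ => ENNReal.ofReal (Real.exp (-(p.2 * ∑ k, p.1 k ^ 2)))) :=
      ENNReal.measurable_ofReal.comp (by fun_prop)
    exact m1.mul m2
  have e2 : ∀ t ∈ Set.Ioi (0:ℝ), (∫⁻ y : Fin d → ℝ, ENNReal.ofReal (t ^ ((d:ℝ)-1) * Real.exp (-(a^2 * t)) / Real.Gamma d) *
        ENNReal.ofReal (Real.exp (-(t * ∑ k, y k ^ 2)))) =
      ENNReal.ofReal (Real.pi ^ ((d:ℝ)/2) / Real.Gamma d) * ENNReal.ofReal (t ^ ((d:ℝ)/2 - 1) * Real.exp (-(a^2 * t))) := by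
    intro t ht
    have t0 : (0:ℝ) < t := ht
    rw [lintegral_const_mul' _ _ ENNReal.ofReal_ne_top, lint_gauss d t0, ← ENNReal.ofReal_mul (by positivity),
      ← ENNReal.ofReal_mul (by positivity)]
    congr 1
    rw [Real.div_rpow Real.pi_pos.le t0.le]
    have : t ^ ((d:ℝ)-1) = t ^ ((d:ℝ)/2-1) * t ^ ((d:ℝ)/2) := by
      rw [← Real.rpow_add t0]; congr 1; ring
    rw [this]; field_simp
  rw [setLIntegral_congr_fun measurableSet_Ioi e2, lintegral_const_mul' _ _ ENNReal.ofReal_ne_top,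
    lint_gamma (half_pos d0) (by positivity), ← ENNReal.ofReal_mul (by positivity)]
  congr 1
  unfold kap
  have : (1 / a ^ 2) ^ ((d:ℝ)/2) = a ^ (-(d:ℝ)) := by
    rw [one_div, ← Real.rpow_natCast, ← Real.rpow_neg ha.le, ← Real.rpow_mul ha.le]; congr 1; push_cast; ring
  rw [this]; ring

lemma lint_half {d : ℕ} (hd : 2 ≤ d) :
    ∫⁻ z in {z : Fin (d+1) → ℝ | 1 ≤ z 0}, ENNReal.ofReal (((∑ k, z k ^ 2) ^ d)⁻¹) =
      ENNReal.ofReal (kap d / (d - 1)) := by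
  have hd' : (2:ℝ) ≤ d := by exact_mod_cast hd
  have mp := (volume_preserving_piFinSuccAbove (fun _ : Fin (d+1) => ℝ) 0)
  have hset : {z : Fin (d+1) → ℝ | 1 ≤ z 0} = (MeasurableEquiv.piFinSuccAbove (fun _ : Fin (d+1) => ℝ) 0) ⁻¹' (Set.Ici (1:ℝ) ×ˢ Set.univ) := by
    ext z; simp [MeasurableEquiv.piFinSuccAbove, Fin.insertNthEquiv]
  have hfun : ∀ z : Fin (d+1) → ℝ, ENNReal.ofReal (((∑ k, z k ^ 2) ^ d)⁻¹) =
      (fun p : ℝ × (Fin d → ℝ) => ENNReal.ofReal (((p.1 ^ 2 + ∑ k, p.2 k ^ 2) ^ d)⁻¹))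
        (MeasurableEquiv.piFinSuccAbove (fun _ : Fin (d+1) => ℝ) 0 z) := by
    intro z
    simp [MeasurableEquiv.piFinSuccAbove, Fin.insertNthEquiv, Fin.sum_univ_succ, Fin.removeNth, Fin.tail]
  have tr := mp.setLIntegral_comp_preimage_emb (MeasurableEquiv.measurableEmbedding _)
    (fun p : ℝ × (Fin d → ℝ) => ENNReal.ofReal (((p.1 ^ 2 + ∑ k, p.2 k ^ 2) ^ d)⁻¹)) (Set.Ici (1:ℝ) ×ˢ Set.univ)
  rw [lintegral_congr hfun, hset]
  refine tr.trans ?_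
  rw [Measure.volume_eq_prod, ← Measure.prod_restrict, lintegral_prod _ (by
    refine Measurable.aemeasurable ?_
    refine ENNReal.measurable_ofReal.comp ?_
    fun_prop)]
  rw [Measure.restrict_univ]
  have e : ∀ a ∈ Set.Ici (1:ℝ), (∫⁻ y : Fin d → ℝ, ENNReal.ofReal (((a ^ 2 + ∑ k, y k ^ 2) ^ d)⁻¹)) =
      ENNReal.ofReal (kap d) * ENNReal.ofReal (a ^ (-(d:ℝ))) := by
    intro a ha
    have a0 : (0:ℝ) < a := lt_of_lt_of_le one_pos ha
    rw [lint_kap hd a0, ENNReal.ofReal_mul' (by positivity)]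
  simp only
  rw [setLIntegral_congr_fun measurableSet_Ici e, lintegral_const_mul' _ _ ENNReal.ofReal_ne_top,
    setLIntegral_congr Ioi_ae_eq_Ici.symm, ← ofReal_integral_eq_lintegral_ofReal
      (integrableOn_Ioi_rpow_of_lt (by linarith) one_pos), integral_Ioi_rpow_of_lt (by linarith) one_pos,
      ← ENNReal.ofReal_mul']
  · congr 1
    rw [Real.one_rpow]
    have : -(d:ℝ) + 1 = -((d:ℝ) - 1) := by ring
    rw [this, neg_div_neg_eq]; ring
  · rw [Real.one_rpow]
    have : -(d:ℝ) + 1 = -((d:ℝ) - 1) := by ring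
    rw [this, neg_div_neg_eq]
    have : 0 < (d:ℝ) - 1 := by linarith
    positivity
  · filter_upwards [ae_restrict_mem measurableSet_Ioi] with t ht
    have : (0:ℝ) < t := lt_trans one_pos ht
    simp only [Pi.zero_apply]; positivity

lemma kap_pos {d : ℕ} (hd : 2 ≤ d) : 0 < kap d := by
  have d0 : (0:ℝ) < d := by have : 0 < d := by omega
                            exact_mod_cast this
  have G0 := Real.Gamma_pos_of_pos d0
  have G1 := Real.Gamma_pos_of_pos (half_pos d0)
  unfold kap; positivity

lemma SA_eq (d : ℕ) (hd : 2 ≤ d) : SA (d+1) = 2 ^ (d:ℝ) * kap d := by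
  have d0 : (0:ℝ) < d := by have : 0 < d := by omega
                            exact_mod_cast this
  have G0 := Real.Gamma_pos_of_pos d0
  have G1 := Real.Gamma_pos_of_pos (half_pos d0)
  have G2 := Real.Gamma_pos_of_pos (show 0 < (d:ℝ)/2 + 1/2 by positivity)
  unfold SA sphMeasure kap
  rw [Measure.map_apply measurable_subtype_coe MeasurableSet.univ, Set.preimage_univ,
    Measure.toSphere_apply_univ, EuclideanSpace.volume_ball]
  simp only [ENNReal.ofReal_one, one_pow, one_mul, finrank_euclideanSpace, Fintype.card_fin, ENNReal.toReal_mul, ENNReal.toReal_natCast]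
  rw [ENNReal.toReal_ofReal (by
    have := Real.Gamma_pos_of_pos (show 0 < ((d+1:ℕ):ℝ)/2 + 1 by positivity)
    positivity)]
  rw [Real.Gamma_add_one (by positivity)]
  have dup := Real.Gamma_mul_Gamma_add_half ((d:ℝ)/2)
  have e1 : ((d+1:ℕ):ℝ)/2 = (d:ℝ)/2 + 1/2 := by push_cast; ring
  have e2 : 2 * ((d:ℝ)/2) = d := by ring
  rw [e1]
  rw [e2] at dup
  have e3 : Real.Gamma ((d:ℝ)/2) = Real.Gamma d * 2 ^ (1 - (d:ℝ)) * √Real.pi / Real.Gamma ((d:ℝ)/2 + 1/2) := by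
    rw [← dup]; field_simp
  rw [e3]
  have e4 : (2:ℝ) ^ (1 - (d:ℝ)) = 2 / 2 ^ (d:ℝ) := by
    rw [Real.rpow_sub two_pos, Real.rpow_one]
  have e5 : √Real.pi ^ (d+1) = Real.pi ^ ((d:ℝ)/2) * √Real.pi := by
    rw [pow_succ]; congr 1
    rw [Real.sqrt_eq_rpow, ← Real.rpow_natCast, ← Real.rpow_mul Real.pi_pos.le]; congr 1; ring
  rw [e4, e5]
  push_cast
  have : (0:ℝ) < 2 ^ (d:ℝ) := by positivity
  field_simp

lemma JR_eq (d : ℕ) {R : ℝ} (hR : 0 < R) :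
    ENNReal.ofReal (JR d R) = ∫⁻ z in Set.Icc (bvec d R) (fun k => bvec d R k + R), ENNReal.ofReal (((∑ k, z k ^ 2) ^ d)⁻¹) := by
  have e : JR d R = ∫ z in Set.Icc (bvec d R) (fun k => bvec d R k + R), ((∑ k, z k ^ 2) ^ d)⁻¹ := by
    let H : (Fin (d+1) → ℝ) → ℝ := (Set.Icc (bvec d R) (fun k => bvec d R k + R)).indicator (fun z => ((∑ k, z k ^ 2) ^ d)⁻¹)
    have h1 : ∫ z in Set.Icc (bvec d R) (fun k => bvec d R k + R), ((∑ k, z k ^ 2) ^ d)⁻¹ = ∫ z, H z := 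
      (integral_indicator measurableSet_Icc).symm
    have h2 : ∫ z, H z = ∫ z, H (z + bvec d R) := (integral_add_right_eq_self H (bvec d R)).symm
    have h3 := Measure.integral_comp_smul volume (fun z => H (z + bvec d R)) R
    rw [h1, h2]
    have h4 : ∫ x, H (R • x + bvec d R) = ∫ y in Set.Icc (0 : Fin (d+1) → ℝ) 1, ((om d R y) ^ d)⁻¹ := by
      rw [← integral_indicator measurableSet_Icc]
      congr 1; ext x
      have hm : (R • x + bvec d R ∈ Set.Icc (bvec d R) (fun k => bvec d R k + R)) ↔ x ∈ Set.Icc (0 : Fin (d+1) → ℝ) 1 := by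
        simp only [Set.mem_Icc, Pi.le_def, Pi.add_apply, Pi.smul_apply, smul_eq_mul, Pi.zero_apply, Pi.one_apply]
        constructor
        · rintro ⟨a, b⟩
          refine ⟨fun i => ?_, fun i => ?_⟩
          · have := a i; by_contra hc; push Not at hc; nlinarith
          · have := b i; by_contra hc; push Not at hc; nlinarith
        · rintro ⟨a, b⟩
          refine ⟨fun i => ?_, fun i => ?_⟩
          · have := a i; nlinarith
          · have := b i; nlinarith
      by_cases hx : x ∈ Set.Icc (0 : Fin (d+1) → ℝ) 1
      · simp only [H]
        rw [Set.indicator_of_mem hx, Set.indicator_of_mem (hm.2 hx)]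
        rfl
      · simp only [H]
        rw [Set.indicator_of_notMem hx, Set.indicator_of_notMem (fun h => hx (hm.1 h))]
    rw [h4] at h3
    unfold JR
    rw [h3, abs_of_pos (by positivity)]
    simp only [Module.finrank_fintype_fun_eq_card, Fintype.card_fin, smul_eq_mul]
    field_simp
  have ge1 : ∀ z ∈ Set.Icc (bvec d R) (fun k => bvec d R k + R), 0 < ∑ k, z k ^ 2 := by
    intro z hz
    have h0 := hz.1 0
    simp only [bvec, if_true] at h0
    have : z 0 ^ 2 ≤ ∑ k, z k ^ 2 := Finset.single_le_sum (f := fun k => z k ^ 2) (fun i _ => sq_nonneg _) (Finset.mem_univ 0)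
    nlinarith
  rw [e, ofReal_integral_eq_lintegral_ofReal]
  · refine ContinuousOn.integrableOn_compact isCompact_Icc ?_
    refine ContinuousOn.inv₀ (by fun_prop) fun z hz => (pow_pos (ge1 z hz) _).ne'
  · filter_upwards [ae_restrict_mem measurableSet_Icc] with z hz
    have := ge1 z hz
    simp only [Pi.zero_apply]; positivity

lemma JR_large {d : ℕ} (hd : 2 ≤ d) {a : ℝ} (ha : a < kap d / (d-1)) : ∃ R > 0, a < JR d R := by
  have hd' : (2:ℝ) ≤ d := by exact_mod_cast hd
  have d1 : (0:ℝ) < (d:ℝ) - 1 := by linarith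
  have kp := kap_pos hd
  by_cases a0 : a < 0
  · exact ⟨1, one_pos, a0.trans (JR_pos d one_pos)⟩
  push Not at a0
  let s : ℕ → Set (Fin (d+1) → ℝ) := fun i => Set.Icc (bvec d ((i:ℝ)+1)) (fun k => bvec d ((i:ℝ)+1) k + ((i:ℝ)+1))
  have mono : Monotone s := by
    intro i j hij
    have hij' : (i:ℝ) ≤ j := by exact_mod_cast hij
    refine Set.Icc_subset_Icc ?_ ?_
    · intro k; simp only [bvec]; split_ifs
      · exact le_rfl
      · linarith
    · intro k; simp only [bvec]; split_ifs
      · linarith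
      · linarith
  have sub : {z : Fin (d+1) → ℝ | 1 ≤ z 0} ⊆ ⋃ i, s i := by
    intro z hz
    obtain ⟨i, hi⟩ := exists_nat_ge (∑ k, 2 * |z k|)
    rw [Set.mem_iUnion]
    refine ⟨i, ?_, ?_⟩
    all_goals
      intro k
      have : 2 * |z k| ≤ ∑ k, 2 * |z k| := Finset.single_le_sum (f := fun k => 2 * |z k|) (fun i _ => by positivity) (Finset.mem_univ k)
      have h2 := abs_le.1 (le_refl |z k|)
      simp only [bvec]
      split_ifs with hk
    · subst hk; exact hz
    · linarith
    · have := abs_nonneg (z k); linarith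
    · linarith
  have h1 : ENNReal.ofReal a < ∫⁻ z in ⋃ i, s i, ENNReal.ofReal (((∑ k, z k ^ 2) ^ d)⁻¹) := by
    refine lt_of_lt_of_le ?_ (lintegral_mono_set sub)
    rw [lint_half hd]
    exact (ENNReal.ofReal_lt_ofReal_iff (by positivity)).2 ha
  rw [setLIntegral_iUnion_of_directed _ (mono.directed_le), lt_iSup_iff] at h1
  obtain ⟨i, hi⟩ := h1
  refine ⟨(i:ℝ)+1, by positivity, ?_⟩
  have := JR_eq d (R := (i:ℝ)+1) (by positivity)
  rw [← this] at hi
  exact (ENNReal.ofReal_lt_ofReal_iff (JR_pos d (by positivity))).1 hi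

lemma const_lim (d : ℕ) (hd : 2 ≤ d) {ε : ℝ} (hε : 0 < ε) : ∃ R > 0,
    ((((d:ℝ) - 1) * JR d R ^ (1 / ((d:ℝ)+1))) ^ (-(2 * (d:ℝ) / (d-1) - 1))) ^ (((d:ℝ)-1)/d) ≤
      2 / ((d:ℝ) - 1) * SA (d+1) ^ (-(1/(d:ℝ))) + ε := by
  have hd' : (2:ℝ) ≤ d := by exact_mod_cast hd
  have d1 : (0:ℝ) < (d:ℝ) - 1 := by linarith
  have d0 : (0:ℝ) < (d:ℝ) := by linarith
  have kp := kap_pos hd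
  set J := kap d / (d-1) with hJ
  have Jp : 0 < J := by positivity
  have form : ∀ j : ℝ, 0 < j → ((((d:ℝ) - 1) * j ^ (1 / ((d:ℝ)+1))) ^ (-(2 * (d:ℝ) / (d-1) - 1))) ^ (((d:ℝ)-1)/d)
      = ((d:ℝ)-1) ^ (-(((d:ℝ)+1)/d)) * j ^ (-(1/(d:ℝ))) := by
    intro j hj
    have : -(2 * (d:ℝ) / (d-1) - 1) * (((d:ℝ)-1)/d) = -(((d:ℝ)+1)/d) := by field_simp; ring
    rw [← Real.rpow_mul (by positivity), this, Real.mul_rpow d1.le (by positivity), ← Real.rpow_mul hj.le]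
    congr 2; field_simp
  have val : ((d:ℝ)-1) ^ (-(((d:ℝ)+1)/d)) * J ^ (-(1/(d:ℝ))) = 2 / ((d:ℝ) - 1) * SA (d+1) ^ (-(1/(d:ℝ))) := by
    rw [SA_eq d hd, Real.mul_rpow (by positivity) kp.le, ← Real.rpow_mul (by norm_num), hJ,
      Real.div_rpow kp.le d1.le]
    have e1 : (d:ℝ) * -(1/(d:ℝ)) = -1 := by field_simp
    have e2 : -(((d:ℝ)+1)/d) = -1 + -(1/(d:ℝ)) := by field_simp; ring
    rw [e1, e2, Real.rpow_add d1, Real.rpow_neg_one, Real.rpow_neg_one]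
    have : (0:ℝ) < ((d:ℝ)-1) ^ (-(1/(d:ℝ))) := by positivity
    field_simp
  have cont : ContinuousAt (fun j : ℝ => ((d:ℝ)-1) ^ (-(((d:ℝ)+1)/d)) * j ^ (-(1/(d:ℝ)))) J :=
    continuousAt_const.mul (Real.continuousAt_rpow_const _ _ (Or.inl Jp.ne'))
  have ev : ∀ᶠ j in nhdsWithin J (Set.Iio J), ((d:ℝ)-1) ^ (-(((d:ℝ)+1)/d)) * j ^ (-(1/(d:ℝ))) < 
      2 / ((d:ℝ) - 1) * SA (d+1) ^ (-(1/(d:ℝ))) + ε := by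
    refine (cont.tendsto.mono_left nhdsWithin_le_nhds).eventually_lt_const ?_
    rw [val]; linarith
  have ev2 : ∀ᶠ j in nhdsWithin J (Set.Iio J), j ∈ Set.Ioo 0 J := Ioo_mem_nhdsLT Jp
  obtain ⟨j, hj1, hj2⟩ := (ev.and ev2).exists
  obtain ⟨R, hR, hjR⟩ := JR_large hd hj2.2
  refine ⟨R, hR, ?_⟩
  rw [form _ (JR_pos d hR)]
  refine le_trans ?_ hj1.le
  refine mul_le_mul_of_nonneg_left ?_ (by positivity)
  exact Real.rpow_le_rpow_of_nonpos hj2.1 hjR.le (by rw [neg_nonpos]; positivity)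

lemma sph_integral (n : ℕ) (w : E n → ℝ) :
    ∫ x, w x ∂(sphMeasure n) = ∫ ω : sphere (0 : E n) 1, w ω ∂((volume : Measure (E n)).toSphere) := by
  unfold sphMeasure
  exact (MeasurableEmbedding.subtype_coe isClosed_sphere.measurableSet).integral_map _

instance sph_fin (n : ℕ) : IsFiniteMeasure (sphMeasure n) := by unfold sphMeasure; infer_instance

lemma sph_ae (n : ℕ) : ∀ᵐ x ∂(sphMeasure n), x ∈ sphere (0 : E n) 1 := by
  unfold sphMeasure
  have hm : MeasurableSet {x : E n | x ∈ sphere (0 : E n) 1} := isClosed_sphere.measurableSet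
  exact (ae_map_iff measurable_subtype_coe.aemeasurable hm).2 (Eventually.of_forall fun ω => ω.2)

lemma sph_integrable {n : ℕ} {w : E n → ℝ} (hw : Continuous w) : Integrable w (sphMeasure n) := by
  obtain ⟨C, hC⟩ := (isCompact_sphere (0 : E n) 1).exists_bound_of_continuousOn hw.continuousOn
  refine Integrable.of_bound hw.aestronglyMeasurable C ?_
  filter_upwards [sph_ae n] with x hx using hC x hx

lemma polar {n : ℕ} (hn : 0 < n) (f : E n → ℝ) (hf : Integrable f) :
    Integrable (fun p : sphere (0 : E n) 1 × ℝ => p.2 ^ (n-1) * f (p.2 • (p.1 : E n)))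
      ((volume : Measure (E n)).toSphere.prod (volume.restrict (Set.Ioi 0))) ∧
    ∫ x, f x = ∫ p : sphere (0 : E n) 1 × ℝ, p.2 ^ (n-1) * f (p.2 • (p.1 : E n))
      ∂((volume : Measure (E n)).toSphere.prod (volume.restrict (Set.Ioi 0))) := by
  haveI : Nonempty (Fin n) := ⟨⟨0, hn⟩⟩
  haveI : Nontrivial (E n) := by unfold E; infer_instance
  let e := homeomorphUnitSphereProd (E n)
  have mp := (volume : Measure (E n)).measurePreserving_homeomorphUnitSphereProd
  have hfr : Module.finrank ℝ (E n) = n := by simp [E]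
  rw [hfr] at mp
  let F : sphere (0 : E n) 1 × Set.Ioi (0:ℝ) → ℝ := fun p => f ((p.2 : ℝ) • (p.1 : E n))
  have hF : ∀ x : ({(0)}ᶜ : Set (E n)), F (e x) = f x := by
    intro x
    have := congrArg Subtype.val (e.symm_apply_apply x)
    simp only [F]
    rw [← this]; rfl
  have h1 : ∫ x, f x = ∫ x : ({(0)}ᶜ : Set (E n)), f x ∂((volume : Measure (E n)).comap Subtype.val) := by
    rw [integral_subtype_comap (measurableSet_singleton _).compl f, restrict_compl_singleton]
  have h2 : ∫ x : ({(0)}ᶜ : Set (E n)), f x ∂((volume : Measure (E n)).comap Subtype.val) = ∫ p, F p ∂((volume : Measure (E n)).toSphere.prod (.volumeIoiPow (n-1))) := by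
    rw [← mp.integral_comp e.measurableEmbedding]
    congr 1; ext x; exact (hF x).symm
  have i2 : Integrable F ((volume : Measure (E n)).toSphere.prod (.volumeIoiPow (n-1))) := by
    rw [← mp.integrable_comp_emb e.measurableEmbedding]
    have : F ∘ e = fun x : ({(0)}ᶜ : Set (E n)) => f x := by ext x; exact hF x
    have i3 : Integrable (f ∘ (Subtype.val : ({(0)}ᶜ : Set (E n)) → E n)) ((volume : Measure (E n)).comap Subtype.val) := by
      rw [← integrableOn_iff_comap_subtypeVal (measurableSet_singleton _).compl]
      exact hf.integrableOn
    exact (this ▸ i3)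
  have sf : SigmaFinite ((volume : Measure ℝ).comap (Subtype.val : Set.Ioi (0:ℝ) → ℝ)) := by
    refine SigmaFinite.of_map _ measurable_subtype_coe.aemeasurable ?_
    rw [map_comap_subtype_coe measurableSet_Ioi]
    infer_instance
  have hm : Measurable (fun r : Set.Ioi (0:ℝ) => (r.1 ^ (n-1)).toNNReal) :=
    (measurable_subtype_coe.pow_const _).real_toNNReal
  have meq : (volume : Measure (E n)).toSphere.prod (.volumeIoiPow (n-1)) =
      ((volume : Measure (E n)).toSphere.prod ((volume : Measure ℝ).comap (Subtype.val : Set.Ioi (0:ℝ) → ℝ))).withDensity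
        (fun p => ((p.2.1 ^ (n-1)).toNNReal : ℝ≥0∞)) := by
    unfold Measure.volumeIoiPow
    rw [prod_withDensity_right]
    · rfl
    · exact (measurable_subtype_coe.pow_const _).ennreal_ofReal
  have hm2 : Measurable (fun p : sphere (0 : E n) 1 × Set.Ioi (0:ℝ) => (p.2.1 ^ (n-1)).toNNReal) := hm.comp measurable_snd
  let ι : sphere (0 : E n) 1 × Set.Ioi (0:ℝ) → sphere (0 : E n) 1 × ℝ := Prod.map id Subtype.val
  have hι : MeasurableEmbedding ι := MeasurableEmbedding.id.prodMap (MeasurableEmbedding.subtype_coe measurableSet_Ioi)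
  have mι : Measure.map ι ((volume : Measure (E n)).toSphere.prod ((volume : Measure ℝ).comap (Subtype.val : Set.Ioi (0:ℝ) → ℝ)))
      = (volume : Measure (E n)).toSphere.prod (volume.restrict (Set.Ioi 0)) := by
    simp only [ι]
    rw [← Measure.map_prod_map _ _ measurable_id measurable_subtype_coe, Measure.map_id,
      map_comap_subtype_coe measurableSet_Ioi]
  let H : sphere (0 : E n) 1 × ℝ → ℝ := fun p => p.2 ^ (n-1) * f (p.2 • (p.1 : E n))
  have hH : ∀ p, (p.2.1 ^ (n-1)).toNNReal • F p = H (ι p) := by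
    rintro ⟨ω, r⟩
    simp only [F, H, ι, Prod.map, id]
    rw [NNReal.smul_def, Real.coe_toNNReal _ (pow_nonneg (le_of_lt r.2) _), smul_eq_mul]
  constructor
  · rw [meq, integrable_withDensity_iff_integrable_smul hm2] at i2
    rw [← mι, hι.integrable_map_iff]
    refine i2.congr (Eventually.of_forall fun p => ?_)
    exact hH p
  · rw [h1, h2, meq, integral_withDensity_eq_integral_smul hm2, ← mι, hι.integral_map]
    congr 1; ext p; exact hH p

lemma cont_int_ball {n : ℕ} {g : E n → ℝ} (hg : Continuous g) {A : Set (E n)} (hA : A ⊆ closedBall 0 1) :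
    IntegrableOn g A := 
  (hg.continuousOn.integrableOn_compact (isCompact_closedBall 0 1)).mono_set hA

lemma ann_meas (n : ℕ) (a : ℝ) : MeasurableSet {x : E n | a < ‖x‖ ∧ ‖x‖ < 1} :=
  ((isOpen_lt continuous_const continuous_norm).inter (isOpen_lt continuous_norm continuous_const)).measurableSet

lemma polar_ann {n : ℕ} (hn : 0 < n) {g : E n → ℝ} (hg : Continuous g) {a : ℝ} (ha : 0 ≤ a) (ha1 : a < 1) :
    ∫ x in {x : E n | a < ‖x‖ ∧ ‖x‖ < 1}, g x =
      ∫ ω : sphere (0 : E n) 1, (∫ r in a..1, r ^ (n-1) * g (r • (ω : E n))) ∂((volume : Measure (E n)).toSphere) := by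
  have hi : Integrable ({x : E n | a < ‖x‖ ∧ ‖x‖ < 1}.indicator g) := by
    rw [integrable_indicator_iff (ann_meas n a)]
    refine cont_int_ball hg fun x hx => ?_
    rw [mem_closedBall_zero_iff]; exact hx.2.le
  obtain ⟨i1, e1⟩ := polar hn _ hi
  rw [← integral_indicator (ann_meas n a), e1, integral_prod _ i1]
  congr 1; ext ω
  have : ∀ r ∈ Set.Ioi (0:ℝ), r ^ (n-1) * ({x : E n | a < ‖x‖ ∧ ‖x‖ < 1}.indicator g) (r • (ω : E n)) =
      (Set.Ioo a 1).indicator (fun r => r ^ (n-1) * g (r • (ω : E n))) r := by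
    intro r hr
    have hr0 : (0:ℝ) < r := hr
    have hω : ‖(ω : E n)‖ = 1 := by simpa using ω.2
    have hnorm : ‖r • (ω : E n)‖ = r := by rw [norm_smul, hω, mul_one, Real.norm_of_nonneg hr0.le]
    by_cases h : r ∈ Set.Ioo a 1
    · rw [Set.indicator_of_mem h, Set.indicator_of_mem]
      show a < ‖r • (ω : E n)‖ ∧ ‖r • (ω : E n)‖ < 1
      rw [hnorm]; exact h
    · rw [Set.indicator_of_notMem h, Set.indicator_of_notMem, mul_zero]
      intro hc
      have hc : a < ‖r • (ω : E n)‖ ∧ ‖r • (ω : E n)‖ < 1 := hc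
      rw [hnorm] at hc; exact h hc
  simp only
  rw [setIntegral_congr_fun measurableSet_Ioi this, setIntegral_indicator measurableSet_Ioo,
    intervalIntegral.integral_of_le ha1.le, integral_Ioc_eq_integral_Ioo]
  have : Set.Ioi (0:ℝ) ∩ Set.Ioo a 1 = Set.Ioo a 1 :=
    Set.inter_eq_right.2 fun r hr => lt_of_le_of_lt ha hr.1
  rw [this]

lemma sphInt_cont {n : ℕ} {g : E n → ℝ} (hg : Continuous g) :
    Continuous (fun r : ℝ => ∫ x, g (r • x) ∂(sphMeasure n)) := by
  rw [continuous_iff_continuousAt]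
  intro r0
  obtain ⟨C, hC⟩ := (isCompact_closedBall (0 : E n) (|r0|+1)).exists_bound_of_continuousOn hg.continuousOn
  refine continuousAt_of_dominated (bound := fun _ => C) ?_ ?_ (integrable_const _) ?_
  · exact Eventually.of_forall fun r => (hg.comp (continuous_const_smul r)).aestronglyMeasurable
  · filter_upwards [Metric.ball_mem_nhds r0 one_pos] with r hr
    filter_upwards [sph_ae n] with x hx
    refine hC _ ?_
    rw [mem_closedBall_zero_iff, norm_smul]
    have : ‖x‖ = 1 := by simpa using hx
    rw [this, mul_one]
    have := abs_sub_abs_le_abs_sub r r0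
    rw [mem_ball, Real.dist_eq] at hr
    rw [Real.norm_eq_abs]; linarith
  · exact Eventually.of_forall fun x => (hg.comp (continuous_id.smul continuous_const)).continuousAt

lemma polar_ann' {n : ℕ} (hn : 0 < n) {g : E n → ℝ} (hg : Continuous g) {a : ℝ} (ha : 0 ≤ a) (ha1 : a < 1) :
    ∫ x in {x : E n | a < ‖x‖ ∧ ‖x‖ < 1}, g x =
      ∫ r in a..1, r ^ (n-1) * ∫ x, g (r • x) ∂(sphMeasure n) := by
  rw [polar_ann hn hg ha ha1]
  simp_rw [intervalIntegral.integral_of_le ha1.le]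
  rw [integral_integral_swap]
  · congr 1; ext r
    rw [integral_const_mul, sph_integral]
  · have hc : Continuous (fun p : sphere (0 : E n) 1 × ℝ => p.2 ^ (n-1) * g (p.2 • (p.1 : E n))) := by
      fun_prop
    obtain ⟨C, hC⟩ := (isCompact_univ.prod (isCompact_Icc (a := a) (b := 1))).exists_bound_of_continuousOn (hc.continuousOn (s := Set.univ ×ˢ Set.Icc a 1))
    refine Integrable.of_bound hc.aestronglyMeasurable C ?_
    have : ∀ᵐ p ∂((volume : Measure (E n)).toSphere.prod ((volume : Measure ℝ).restrict (Set.Ioc a 1))), p.2 ∈ Set.Ioc a 1 := by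
      have h := (Measure.quasiMeasurePreserving_snd (μ := (volume : Measure (E n)).toSphere) (ν := (volume : Measure ℝ).restrict (Set.Ioc a 1))).ae (ae_restrict_mem measurableSet_Ioc)
      exact h
    filter_upwards [this] with p hp
    exact hC p ⟨trivial, Set.Ioc_subset_Icc_self hp⟩

lemma shell_lim {n : ℕ} (hn : 0 < n) {g : E n → ℝ} (hg : Continuous g) :
    Tendsto (fun h : ℝ => h⁻¹ * ∫ x in {x : E n | 1 - h < ‖x‖ ∧ ‖x‖ < 1}, g x) (nhdsWithin 0 (Set.Ioi 0))
      (nhds (∫ x, g x ∂(sphMeasure n))) := by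
  let G : ℝ → ℝ := fun r => r ^ (n-1) * ∫ x, g (r • x) ∂(sphMeasure n)
  have cG : Continuous G := by
    have := sphInt_cont hg
    exact (continuous_pow _).mul this
  have G1 : G 1 = ∫ x, g x ∂(sphMeasure n) := by simp [G]
  have hd : HasDerivAt (fun h : ℝ => ∫ r in (1-h)..1, G r) (G 1) 0 := by
    have h1 : HasDerivAt (fun u : ℝ => ∫ r in u..1, G r) (-G 1) (1 - 0) := by
      simpa using intervalIntegral.integral_hasDerivAt_left (cG.intervalIntegrable _ _) (cG.stronglyMeasurableAtFilter _ _) (cG.continuousAt (x := 1))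
    have h2 : HasDerivAt (fun h : ℝ => 1 - h) (-1) 0 := by simpa using (hasDerivAt_id (0:ℝ)).const_sub 1
    have h3 : HasDerivAt (fun h : ℝ => ∫ r in (1-h)..1, G r) (-G 1 * -1) 0 := h1.comp (0:ℝ) h2
    exact h3.congr_deriv (by ring)
  have ht := hd.tendsto_slope_zero_right
  rw [← G1]
  refine ht.congr' ?_
  filter_upwards [Ioo_mem_nhdsGT (show (0:ℝ) < 1 from one_pos)] with h hh
  rw [polar_ann' hn hg (a := 1 - h) (by linarith [hh.2]) (by linarith [hh.1])]
  simp [G]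

lemma ball_ann {n : ℕ} (hn : 0 < n) (g : E n → ℝ) : ∫ x in ball (0 : E n) 1, g x = ∫ x in {x : E n | 0 < ‖x‖ ∧ ‖x‖ < 1}, g x := by
  haveI : Nonempty (Fin n) := ⟨⟨0, hn⟩⟩
  haveI : Nontrivial (E n) := by unfold E; infer_instance
  refine setIntegral_congr_set ?_
  have : {x : E n | 0 < ‖x‖ ∧ ‖x‖ < 1} = ball (0 : E n) 1 \ {0} := by
    ext x; simp [and_comm]
  rw [this]
  exact (diff_null_ae_eq_self (measure_singleton 0)).symm

lemma radial_id {n : ℕ} (hn : 0 < n) {w : E n → ℝ} (hw : ContDiff ℝ 1 w) :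
    ∫ x in ball (0 : E n) 1, (n * w x + fderiv ℝ w x x) = ∫ x, w x ∂(sphMeasure n) := by
  have cd : Continuous (fun x => fderiv ℝ w x x) := (hw.continuous_fderiv one_ne_zero).clm_apply continuous_id
  have cg : Continuous (fun x => n * w x + fderiv ℝ w x x) := (continuous_const.mul hw.continuous).add cd
  rw [ball_ann hn, polar_ann hn cg le_rfl one_pos, sph_integral]
  congr 1; ext ω
  have hder : ∀ r : ℝ, HasDerivAt (fun r : ℝ => r ^ n * w (r • (ω : E n))) 
      (r ^ (n-1) * (n * w (r • (ω : E n)) + fderiv ℝ w (r • (ω : E n)) (r • (ω : E n)))) r := by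
    intro r
    have h1 : HasDerivAt (fun r : ℝ => r • (ω : E n)) (ω : E n) r := by
      simpa using (hasDerivAt_id r).smul_const (ω : E n)
    have h2 := ((hw.differentiable one_ne_zero) (r • (ω : E n))).hasFDerivAt.comp_hasDerivAt r h1
    have := (hasDerivAt_pow n r).mul h2
    refine this.congr_deriv ?_
    rw [map_smul, smul_eq_mul]
    obtain ⟨k, rfl⟩ : ∃ k, n = k + 1 := ⟨n-1, by omega⟩
    simp only [Nat.add_sub_cancel, pow_succ, Function.comp]
    ring
  rw [intervalIntegral.integral_eq_sub_of_hasDerivAt (fun r _ => hder r)]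
  · simp [hn.ne']
  · refine Continuous.intervalIntegrable ?_ _ _
    have := cg.comp (continuous_id.smul (continuous_const (y := (ω : E n))) : Continuous fun r : ℝ => r • (ω : E n))
    exact (continuous_pow _).mul this

def gam {d : ℕ} (y : Fin d → ℝ) : ℝ := √(1 - ∑ k, y k ^ 2)

def yv {d : ℕ} (ρ : ℝ) (x : Fin (d+1) → ℝ) : Fin d → ℝ := fun k => ρ * x k.succ - ρ/2

def Phi (d : ℕ) (ρ : ℝ) (x : Fin (d+1) → ℝ) : E (d+1) :=
  WithLp.toLp 2 (Fin.cons (gam (yv ρ x) - ρ * x 0) (yv ρ x))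

lemma gam_cont {d : ℕ} : Continuous (gam (d := d)) := by unfold gam; fun_prop

lemma yv_cont {d : ℕ} (ρ : ℝ) : Continuous (yv (d := d) ρ) := by unfold yv; fun_prop

lemma Phi_cont (d : ℕ) (ρ : ℝ) : Continuous (Phi d ρ) := by
  unfold Phi
  refine (PiLp.continuous_toLp 2 _).comp (cons_continuous ?_ (yv_cont ρ))
  exact (gam_cont.comp (yv_cont ρ)).sub (by fun_prop)

lemma Phi_map (d : ℕ) {ρ : ℝ} (hρ : 0 < ρ) :
    (volume : Measure (E (d+1))) = ENNReal.ofReal (ρ ^ (d+1)) • Measure.map (Phi d ρ) volume := by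
  have b1 := (volume_preserving_piFinSuccAbove (fun _ : Fin (d+1) => ℝ) 0)
  have b5 := b1.symm
  have b2 : MeasurePreserving (Prod.swap : ℝ × (Fin d → ℝ) → _) volume volume := Measure.measurePreserving_swap
  have b4 : MeasurePreserving (Prod.swap : (Fin d → ℝ) × ℝ → _) volume volume := Measure.measurePreserving_swap
  have b3 : MeasurePreserving (fun p : (Fin d → ℝ) × ℝ => (p.1 - (fun _ => ρ/2), gam (p.1 - (fun _ => ρ/2)) - p.2)) volume volume := by
    refine MeasurePreserving.skew_product (measurePreserving_sub_right volume (fun _ => ρ/2)) (g := fun a b => gam (a - (fun _ => ρ/2)) - b) ?_ ?_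
    · have : Continuous (fun p : (Fin d → ℝ) × ℝ => gam (p.1 - (fun _ => ρ/2)) - p.2) :=
        (gam_cont.comp (by fun_prop)).sub continuous_snd
      exact this.measurable
    · exact Eventually.of_forall fun a => Measure.map_sub_left_eq_self _ _
  have b6 := PiLp.volume_preserving_toLp (Fin (d+1))
  have B := b6.comp (b5.comp (b4.comp (b3.comp (b2.comp b1))))
  have hA := Measure.map_addHaar_smul (volume : Measure (Fin (d+1) → ℝ)) hρ.ne'
  have hPhi : Phi d ρ = (WithLp.toLp 2 ∘ ⇑(MeasurableEquiv.piFinSuccAbove (fun x ↦ ℝ) 0).symm ∘ Prod.swap ∘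
    (fun p : (Fin d → ℝ) × ℝ => (p.1 - (fun _ => ρ/2), gam (p.1 - (fun _ => ρ/2)) - p.2)) ∘ Prod.swap ∘
    ⇑(MeasurableEquiv.piFinSuccAbove (fun x : Fin (d+1) ↦ ℝ) 0)) ∘ (fun x => ρ • x) := by
    funext x
    simp only [Phi, Function.comp]
    congr 1
    simp only [MeasurableEquiv.piFinSuccAbove_symm_apply, Fin.insertNthEquiv, Equiv.coe_fn_mk, Prod.swap, Fin.insertNth_zero']
    rfl
  have hm : Measurable (fun x : Fin (d+1) → ℝ => ρ • x) := by fun_prop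
  rw [hPhi, ← Measure.map_map B.measurable hm, hA, Measure.map_smul, B.map_eq, smul_smul]
  rw [← ENNReal.ofReal_mul (by positivity)]
  simp only [Module.finrank_fintype_fun_eq_card, Fintype.card_fin]
  rw [abs_of_pos (by positivity), mul_inv_cancel₀ (by positivity)]
  simp

lemma Phi_int (d : ℕ) {ρ : ℝ} (hρ : 0 < ρ) {G : E (d+1) → ℝ} (hG : Continuous G) {S : Set (E (d+1))} (hS : MeasurableSet S) :
    ∫ x in S, G x = ρ ^ (d+1) * ∫ x in Phi d ρ ⁻¹' S, G (Phi d ρ x) := by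
  rw [← setIntegral_map hS hG.aestronglyMeasurable (Phi_cont d ρ).aemeasurable]
  conv_lhs => rw [Phi_map d hρ]
  rw [Measure.restrict_smul, integral_smul_measure, ENNReal.toReal_ofReal (by positivity), smul_eq_mul]

lemma slab_fubini {d : ℕ} (g : (Fin (d+1) → ℝ) → ℝ) (hg : Continuous g) {t : ℝ} (ht : 0 ≤ t) :
    ∫ x in Set.Icc (0 : Fin (d+1) → ℝ) (Fin.insertNth 0 t 1), g x =
      ∫ s in (0:ℝ)..t, ∫ y in Set.Icc (0 : Fin d → ℝ) 1, g (Fin.insertNth (α := fun _ => ℝ) 0 s y) := by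
  have mp := (volume_preserving_piFinSuccAbove (fun _ : Fin (d+1) => ℝ) 0).symm
  have pre : (MeasurableEquiv.piFinSuccAbove (fun _ : Fin (d+1) => ℝ) 0).symm ⁻¹' (Set.Icc 0 (Fin.insertNth 0 t 1))
      = Set.Icc (0:ℝ) t ×ˢ Set.Icc (0 : Fin d → ℝ) 1 := by
    ext ⟨t, y⟩
    simp only [Set.mem_preimage, MeasurableEquiv.piFinSuccAbove_symm_apply, Set.mem_Icc, Set.mem_prod]
    simp only [Fin.insertNthEquiv, Equiv.coe_fn_mk, Fin.le_insertNth_iff, Fin.insertNth_le_iff]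
    simp only [Pi.le_def, Pi.zero_apply, Pi.one_apply, Fin.insertNth_apply_same, Fin.insertNth_apply_succAbove]
    tauto
  rw [← mp.setIntegral_preimage_emb (MeasurableEquiv.measurableEmbedding _) g, pre]
  rw [Measure.volume_eq_prod, setIntegral_prod]
  · rw [intervalIntegral.integral_of_le ht, ← integral_Icc_eq_integral_Ioc]
    rfl
  · refine ContinuousOn.integrableOn_compact (isCompact_Icc.prod isCompact_Icc) (Continuous.continuousOn ?_)
    have h2 : Continuous (fun p : ℝ × (Fin d → ℝ) => Fin.insertNth (α := fun _ => ℝ) 0 p.1 p.2) :=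
      Continuous.finInsertNth 0 continuous_fst continuous_snd
    exact hg.comp h2

lemma Phi_zero {d : ℕ} (ρ : ℝ) (x : Fin (d+1) → ℝ) : Phi d ρ x 0 = gam (yv ρ x) - ρ * x 0 := rfl
lemma Phi_succ {d : ℕ} (ρ : ℝ) (x : Fin (d+1) → ℝ) (k : Fin d) : Phi d ρ x k.succ = yv ρ x k := rfl

def e0 (d : ℕ) : E (d+1) := EuclideanSpace.single 0 1

lemma Phi_dist {d : ℕ} (ρ : ℝ) (x : Fin (d+1) → ℝ) :
    dist (Phi d ρ x) (e0 d) ^ 2 = (gam (yv ρ x) - ρ * x 0 - 1)^2 + ∑ k, yv ρ x k ^ 2 := by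
  rw [dist_eq_norm, EuclideanSpace.norm_sq_eq, Fin.sum_univ_succ]
  simp [e0, Phi_zero, Phi_succ]

lemma Phi_norm {d : ℕ} (ρ : ℝ) (x : Fin (d+1) → ℝ) :
    ‖Phi d ρ x‖ ^ 2 = (gam (yv ρ x) - ρ * x 0)^2 + ∑ k, yv ρ x k ^ 2 := by
  rw [EuclideanSpace.norm_sq_eq, Fin.sum_univ_succ]
  simp [Phi_zero, Phi_succ]

/-- points of the shell near `e0` lie in a thin slab in chart coordinates. -/
lemma Phi_slab {d : ℕ} {ρ : ℝ} (hρ : 0 < ρ) (hρ1 : ρ < 1) {h : ℝ} (hh : h < 1) (x : Fin (d+1) → ℝ)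
    (hx : dist (Phi d ρ x) (e0 d) < ρ/2) (h1 : 1 - h < ‖Phi d ρ x‖) (h2 : ‖Phi d ρ x‖ < 1) :
    x ∈ Set.Icc (0 : Fin (d+1) → ℝ) (Fin.insertNth 0 (h / (ρ * (1 - ρ/2))) 1) := by
  have hd := Phi_dist ρ x
  have hn := Phi_norm ρ x
  set S := ∑ k, yv ρ x k ^ 2 with hS
  have hS0 : 0 ≤ S := Finset.sum_nonneg fun _ _ => sq_nonneg _
  have hd2 : dist (Phi d ρ x) (e0 d) ^ 2 < (ρ/2)^2 := by
    gcongr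
  have hSr : S < (ρ/2)^2 := by nlinarith [sq_nonneg (gam (yv ρ x) - ρ * x 0 - 1)]
  have hk : ∀ k, |yv ρ x k| < ρ/2 := fun k => by
    refine abs_lt_of_sq_lt_sq (lt_of_le_of_lt ?_ hSr) (by positivity)
    exact Finset.single_le_sum (f := fun k => yv ρ x k ^ 2) (fun _ _ => sq_nonneg _) (Finset.mem_univ k)
  have hg2 : gam (yv ρ x) ^ 2 = 1 - S := by
    unfold gam; rw [Real.sq_sqrt]; nlinarith
  have hg0 : 0 ≤ gam (yv ρ x) := Real.sqrt_nonneg _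
  have hgr : 1 - ρ/2 ≤ gam (yv ρ x) := by
    refine Real.le_sqrt_of_sq_le ?_
    nlinarith
  have ha : |gam (yv ρ x) - ρ * x 0 - 1| < ρ/2 := by
    refine abs_lt_of_sq_lt_sq ?_ (by positivity)
    linarith
  rw [abs_lt] at ha
  have hN0 := norm_nonneg (Phi d ρ x)
  have hN1 : ‖Phi d ρ x‖^2 < 1 := by nlinarith
  have hN2 : (1-h)^2 < ‖Phi d ρ x‖^2 := by
    have : 0 < 1 - h := by linarith
    gcongr
  set a := ρ * x 0
  set g := gam (yv ρ x)
  have hsum : 2 - ρ < 2 * g - a := by linarith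
  have hprod : a * (2 * g - a) < 2 * h := by nlinarith [sq_nonneg h]
  have hprod0 : 0 < a * (2 * g - a) := by nlinarith
  have ha0 : 0 < a := by
    by_contra hc
    push Not at hc
    have := mul_nonpos_of_nonpos_of_nonneg hc (show 0 ≤ 2 * g - a by linarith)
    linarith
  have hx0 : 0 < x 0 := by
    by_contra hc
    push Not at hc
    have : ρ * x 0 ≤ 0 := mul_nonpos_of_nonneg_of_nonpos hρ.le hc
    exact absurd ha0 (not_lt.2 this)
  have hx0' : x 0 ≤ h / (ρ * (1 - ρ/2)) := by
    rw [le_div_iff₀ (by nlinarith)]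
    have : a * (2 - ρ) ≤ a * (2 * g - a) := by gcongr
    have e : a = ρ * x 0 := rfl
    nlinarith
  simp only [Set.mem_Icc, Fin.insertNth_zero', Pi.le_def, Fin.forall_fin_succ, Fin.cons_zero, Fin.cons_succ,
    Pi.zero_apply, Pi.one_apply]
  refine ⟨⟨hx0.le, fun k => ?_⟩, ⟨hx0', fun k => ?_⟩⟩
  · have := abs_lt.1 (hk k)
    simp only [yv] at this
    nlinarith
  · have := abs_lt.1 (hk k)
    simp only [yv] at this
    nlinarith

lemma surf_est {d : ℕ} {ρ : ℝ} (hρ : 0 < ρ) (hρ1 : ρ < 1) (L : E (d+1) ≃ₗᵢ[ℝ] E (d+1))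
    {w : E (d+1) → ℝ} (hw : Continuous w) (hw0 : ∀ x, 0 ≤ w x)
    (hs : ∀ x, ρ/2 ≤ dist x (L (e0 d)) → w x = 0) :
    ∫ x, w x ∂(sphMeasure (d+1)) ≤
      ρ ^ d / (1 - ρ/2) * ∫ y in Set.Icc (0 : Fin d → ℝ) 1, w (L (Phi d ρ (Fin.insertNth 0 0 y))) := by
  let f : (Fin (d+1) → ℝ) → ℝ := fun x => w (L (Phi d ρ x))
  have cf : Continuous f := hw.comp (L.continuous.comp (Phi_cont d ρ))
  let F : ℝ → ℝ := fun s => ∫ y in Set.Icc (0 : Fin d → ℝ) 1, f (Fin.insertNth (α := fun _ => ℝ) 0 s y)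
  have cF : Continuous F := by
    have : Continuous (fun p : ℝ × (Fin d → ℝ) => f (Fin.insertNth (α := fun _ => ℝ) 0 p.1 p.2)) :=
      cf.comp (Continuous.finInsertNth 0 continuous_fst continuous_snd)
    exact continuous_parametric_integral_of_continuous (f := fun s y => f (Fin.insertNth (α := fun _ => ℝ) 0 s y)) this isCompact_Icc
  have ha : 0 < ρ * (1 - ρ/2) := mul_pos hρ (by linarith)
  set a := ρ * (1 - ρ/2) with hadef
  have hd : HasDerivAt (fun h : ℝ => ∫ s in (0:ℝ)..(h/a), F s) (F 0 * (1/a)) 0 := by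
    have h1 : HasDerivAt (fun u : ℝ => ∫ r in (0:ℝ)..u, F r) (F 0) (0/a) := by
      rw [zero_div]
      exact intervalIntegral.integral_hasDerivAt_right (cF.intervalIntegrable _ _) (cF.stronglyMeasurableAtFilter _ _) (cF.continuousAt)
    have h2 : HasDerivAt (fun h : ℝ => h / a) (1/a) 0 := (hasDerivAt_id (0:ℝ)).div_const a
    exact h1.comp (0:ℝ) h2
  have ht := (hd.tendsto_slope_zero_right).const_mul (ρ^(d+1))
  have hlim := shell_lim (n := d+1) (Nat.succ_pos _) hw
  have key := le_of_tendsto_of_tendsto hlim ht ?_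
  · refine key.trans (le_of_eq ?_)
    change ρ ^ (d+1) * (F 0 * (1/a)) = _
    have : ρ ^ (d+1) * (F 0 * (1/a)) = ρ ^ d / (1 - ρ/2) * F 0 := by
      have : (1 - ρ/2) ≠ 0 := by linarith
      rw [hadef, pow_succ]; field_simp
    rw [this]
  · filter_upwards [Ioo_mem_nhdsGT (show (0:ℝ) < 1 from one_pos)] with h hh
    have hsh : MeasurableSet {x : E (d+1) | 1 - h < ‖x‖ ∧ ‖x‖ < 1} := ann_meas _ _
    have e1 : ∫ x in {x : E (d+1) | 1 - h < ‖x‖ ∧ ‖x‖ < 1}, w x = ∫ x in {x : E (d+1) | 1 - h < ‖x‖ ∧ ‖x‖ < 1}, w (L x) := by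
      have := L.measurePreserving.setIntegral_preimage_emb L.toHomeomorph.measurableEmbedding w {x : E (d+1) | 1 - h < ‖x‖ ∧ ‖x‖ < 1}
      rw [← this]
      congr 2
      ext x; simp
    have e2 := Phi_int d hρ (hw.comp L.continuous) hsh
    have e3 := slab_fubini f cf (t := h / a) (div_nonneg hh.1.le ha.le)
    simp only [Function.comp] at e2
    rw [e1, e2]
    simp only [zero_add, zero_div, intervalIntegral.integral_same, sub_zero, smul_eq_mul]
    have e4 : ∫ x in Phi d ρ ⁻¹' {x : E (d+1) | 1 - h < ‖x‖ ∧ ‖x‖ < 1}, w (L (Phi d ρ x)) ≤ ∫ s in (0:ℝ)..(h/a), F s := by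
      refine le_trans ?_ (e3.le)
      have hA : MeasurableSet (Phi d ρ ⁻¹' {x : E (d+1) | 1 - h < ‖x‖ ∧ ‖x‖ < 1}) := (Phi_cont d ρ).measurable hsh
      rw [setIntegral_eq_of_subset_of_forall_diff_eq_zero (f := fun x => w (L (Phi d ρ x))) hA (Set.inter_subset_left (t := Set.Icc (0 : Fin (d+1) → ℝ) (Fin.insertNth 0 (h / a) 1)))]
      · refine setIntegral_mono_set (cf.continuousOn.integrableOn_compact isCompact_Icc) (Eventually.of_forall fun x => hw0 _) ?_
        exact (Set.inter_subset_right).eventuallyLE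
      · rintro x ⟨hx1, hx2⟩
        refine hs _ ?_
        rw [L.dist_map]
        by_contra hc
        push Not at hc
        exact hx2 ⟨hx1, Phi_slab hρ hρ1 hh.2 x hc hx1.1 hx1.2⟩
    calc h⁻¹ * (ρ ^ (d+1) * ∫ x in Phi d ρ ⁻¹' {x : E (d+1) | 1 - h < ‖x‖ ∧ ‖x‖ < 1}, w (L (Phi d ρ x)))
        ≤ h⁻¹ * (ρ ^ (d+1) * ∫ s in (0:ℝ)..(h/a), F s) := by
          have := hh.1
          gcongr
      _ = _ := by ring

lemma dual_sum {n : ℕ} (ℓ : E n →L[ℝ] ℝ) (L : E n ≃ₗᵢ[ℝ] E n) :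
    ∑ i, (ℓ (L (EuclideanSpace.single i 1))) ^ 2 = ‖ℓ‖ ^ 2 := by
  let b := (EuclideanSpace.basisFun (Fin n) ℝ).map L
  have := b.sum_sq_norm_inner_left ((InnerProductSpace.toDual ℝ (E n)).symm ℓ)
  simpa [b, InnerProductSpace.toDual_symm_apply] using this

def Dv (d : ℕ) (ρ : ℝ) (k : Fin (d+1)) (x : Fin (d+1) → ℝ) : E (d+1) :=
  Fin.cases (-ρ • EuclideanSpace.single 0 1)
    (fun j => ρ • EuclideanSpace.single j.succ 1 - (ρ * (yv ρ x j / gam (yv ρ x))) • EuclideanSpace.single 0 1) k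

lemma toLp_deriv {n : ℕ} {c : ℝ → Fin n → ℝ} {c' : Fin n → ℝ} {t : ℝ} (h : ∀ i, HasDerivAt (fun s => c s i) (c' i) t) :
    HasDerivAt (fun s => (WithLp.toLp 2 (c s) : E n)) (WithLp.toLp 2 c') t := by
  have h1 : HasDerivAt c c' t := hasDerivAt_pi.2 h
  exact ((PiLp.continuousLinearEquiv 2 ℝ (fun _ : Fin n => ℝ)).symm.hasFDerivAt (x := c t)).comp_hasDerivAt t h1

lemma Phi_deriv {d : ℕ} (ρ : ℝ) (k : Fin (d+1)) (x : Fin (d+1) → ℝ) (hx : ∑ j, yv ρ x j ^ 2 < 1) :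
    HasDerivAt (fun t => Phi d ρ (Function.update x k t)) (Dv d ρ k x) (x k) := by
  have hDv : Dv d ρ k x = WithLp.toLp 2 (Dv d ρ k x).ofLp := rfl
  rw [hDv]
  refine toLp_deriv ?_
  have hup : Function.update x k (x k) = x := Function.update_eq_self k x
  have hy : ∀ j : Fin d, HasDerivAt (fun t => yv ρ (Function.update x k t) j) (if j.succ = k then ρ else 0) (x k) := by
    intro j
    simp only [yv, Function.update_apply]
    split_ifs with h
    · simpa using ((hasDerivAt_id (x k)).const_mul ρ).sub_const (ρ/2)
    · exact hasDerivAt_const _ _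
  have hS : HasDerivAt (fun t => 1 - ∑ j, yv ρ (Function.update x k t) j ^ 2) (-∑ j, 2 * yv ρ x j * (if j.succ = k then ρ else 0)) (x k) := by
    have := (HasDerivAt.fun_sum (u := Finset.univ) (fun j _ => (hy j).fun_pow 2)).const_sub 1
    refine this.congr_deriv ?_
    simp [hup]
  have hg : HasDerivAt (fun t => gam (yv ρ (Function.update x k t))) ((-∑ j, 2 * yv ρ x j * (if j.succ = k then ρ else 0)) / (2 * gam (yv ρ x))) (x k) := by
    have := hS.sqrt (by rw [hup]; linarith)
    simp only [hup] at this
    exact this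
  have h0 : HasDerivAt (fun t => ρ * Function.update x k t 0) (if (0 : Fin (d+1)) = k then ρ else 0) (x k) := by
    simp only [Function.update_apply]
    split_ifs with h
    · simpa using ((hasDerivAt_id (x k)).const_mul ρ)
    · exact hasDerivAt_const _ _
  intro i
  refine Fin.cases ?_ (fun j => ?_) i
  · refine (hg.sub h0).congr_deriv ?_
    refine Fin.cases ?_ (fun j => ?_) k
    · simp [Dv, Fin.succ_ne_zero]
    · simp [Dv, Fin.succ_ne_zero, (Fin.succ_ne_zero _).symm]
      ring
  · refine (hy j).congr_deriv ?_
    refine Fin.cases ?_ (fun l => ?_) k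
    · simp [Dv, Fin.succ_ne_zero]
    · simp [Dv, Fin.succ_ne_zero, eq_comm, Pi.single_apply]

lemma grad_sum_le {d : ℕ} {ρ δ : ℝ} (hδ : 0 < δ) (hδ1 : δ ≤ 1) (ℓ : E (d+1) →L[ℝ] ℝ) (L : E (d+1) ≃ₗᵢ[ℝ] E (d+1))
    (x : Fin (d+1) → ℝ) (hb : ∑ j, (yv ρ x j / gam (yv ρ x)) ^ 2 ≤ δ ^ 2) :
    ∑ k, (ℓ (L (Dv d ρ k x))) ^ 2 ≤ ρ ^ 2 * (1 + 2 * δ) * ‖ℓ‖ ^ 2 := by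
  rw [← dual_sum ℓ L, Fin.sum_univ_succ, Fin.sum_univ_succ]
  set a := fun i => ℓ (L (EuclideanSpace.single i 1)) with ha
  set b := fun j => yv ρ x j / gam (yv ρ x) with hbd
  have e0 : ℓ (L (Dv d ρ 0 x)) = -ρ * a 0 := by simp [Dv, ha]
  have ek : ∀ j : Fin d, ℓ (L (Dv d ρ j.succ x)) = ρ * (a j.succ - b j * a 0) := by
    intro j; simp [Dv, ha, hbd]; ring
  simp_rw [ek, e0]
  have key : ∀ j : Fin d, (ρ * (a j.succ - b j * a 0))^2 ≤ ρ^2 * ((1 + δ) * a j.succ ^ 2 + (1 + 1/δ) * (b j ^ 2 * a 0 ^ 2)) := by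
    intro j
    rw [mul_pow]
    gcongr
    have h1 : 0 ≤ (δ * a j.succ + b j * a 0)^2 / δ := by positivity
    have h2 : (δ * a j.succ + b j * a 0)^2 / δ = δ * a j.succ ^ 2 + 2 * (a j.succ * b j * a 0) + 1/δ * (b j ^2 * a 0 ^ 2) := by
      field_simp; ring
    nlinarith
  have hsum := Finset.sum_le_sum (fun j (_ : j ∈ Finset.univ) => key j)
  rw [← Finset.mul_sum, Finset.sum_add_distrib, ← Finset.mul_sum, ← Finset.mul_sum, ← Finset.sum_mul] at hsum
  have h3 : (1 + 1/δ) * ((∑ j, b j ^ 2) * a 0 ^ 2) ≤ (1 + 1/δ) * (δ ^ 2 * a 0 ^ 2) := by gcongr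
  have h4 : (1 + 1/δ) * (δ ^ 2 * a 0 ^ 2) ≤ 2 * δ * a 0 ^ 2 := by
    have : (1 + 1/δ) * (δ ^ 2 * a 0 ^ 2) = (δ^2 + δ) * a 0 ^ 2 := by field_simp
    rw [this]
    gcongr
    nlinarith
  have h5 : 0 ≤ ∑ j : Fin d, a j.succ ^ 2 := Finset.sum_nonneg fun _ _ => sq_nonneg _
  have h6 : (∑ j : Fin d, (ρ * (a j.succ - b j * a 0))^2) ≤ ρ^2 * ((1 + 2*δ) * (∑ j : Fin d, a j.succ ^ 2) + 2 * δ * a 0 ^ 2) := by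
    refine hsum.trans (mul_le_mul_of_nonneg_left ?_ (sq_nonneg ρ))
    have : δ * (∑ j : Fin d, a j.succ ^ 2) ≥ 0 := by positivity
    linarith
  calc _ ≤ (-ρ * a 0)^2 + ρ^2 * ((1 + 2*δ) * (∑ j : Fin d, a j.succ ^ 2) + 2 * δ * a 0 ^ 2) := by gcongr
    _ = _ := by ring

lemma Phi_integrable (d : ℕ) {ρ : ℝ} (hρ : 0 < ρ) {G : E (d+1) → ℝ} (hG : Continuous G) :
    IntegrableOn (fun x => G (Phi d ρ x)) (Phi d ρ ⁻¹' closedBall 0 1) := by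
  have h1 : IntegrableOn G (closedBall 0 1) := cont_int_ball hG le_rfl
  have hm : Integrable G ((Measure.map (Phi d ρ) volume).restrict (closedBall 0 1)) := by
    unfold IntegrableOn at h1
    rw [Phi_map d hρ, Measure.restrict_smul] at h1
    exact (integrable_smul_measure (by simpa using pow_pos hρ _) (by simp)).1 h1
  rw [Measure.restrict_map (Phi_cont d ρ).measurable measurableSet_closedBall] at hm
  exact (integrable_map_measure hG.aestronglyMeasurable (Phi_cont d ρ).aemeasurable).1 hm

lemma cube_le_ball (d : ℕ) {ρ : ℝ} (hρ : 0 < ρ) {G : E (d+1) → ℝ} (hG : Continuous G) (hG0 : ∀ x, 0 ≤ G x)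
    (L : E (d+1) ≃ₗᵢ[ℝ] E (d+1)) (hsub : Set.Icc (0 : Fin (d+1) → ℝ) 1 ⊆ Phi d ρ ⁻¹' closedBall 0 1) :
    ρ ^ (d+1) * ∫ x in Set.Icc (0 : Fin (d+1) → ℝ) 1, G (L (Phi d ρ x)) ≤ ∫ x in ball (0 : E (d+1)) 1, G x := by
  have hGL := hG.comp L.continuous
  have e1 : ∫ x in ball (0 : E (d+1)) 1, G x = ∫ x in closedBall (0 : E (d+1)) 1, G (L x) := by
    have := L.measurePreserving.setIntegral_preimage_emb L.toHomeomorph.measurableEmbedding G (closedBall 0 1)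
    have h2 : L ⁻¹' (closedBall 0 1) = closedBall (0 : E (d+1)) 1 := by ext x; simp
    rw [h2] at this
    rw [this]
    refine setIntegral_congr_set ?_
    rw [← ball_union_sphere]
    exact (union_ae_eq_left_of_ae_eq_empty (by rw [ae_eq_empty]; exact Measure.addHaar_sphere _ _ _)).symm
  rw [e1]
  have e2 := Phi_int d hρ hGL (S := closedBall 0 1) measurableSet_closedBall
  simp only [Function.comp] at e2
  rw [e2]
  have := setIntegral_mono_set (Phi_integrable d hρ hGL) (Eventually.of_forall fun x => hG0 _) hsub.eventuallyLE
  simp only [Function.comp] at this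
  gcongr

lemma cube_S {d : ℕ} {ρ δ : ℝ} (hρδ : 2 * d * (ρ/2)^2 ≤ δ^2) {x : Fin (d+1) → ℝ}
    (hx : x ∈ Set.Icc (0 : Fin (d+1) → ℝ) 1) : ∑ j, yv ρ x j ^ 2 ≤ δ^2 / 2 := by
  have h : ∀ j ∈ Finset.univ, yv ρ x j ^ 2 ≤ (ρ/2)^2 := by
    intro j _
    have h1 := hx.1 j.succ
    have h2 := hx.2 j.succ
    simp only [Pi.zero_apply, Pi.one_apply] at h1 h2
    have : yv ρ x j = (ρ/2) * (2 * x j.succ - 1) := by simp only [yv]; ring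
    rw [this, mul_pow]
    have : (2 * x j.succ - 1)^2 ≤ 1 := by nlinarith
    nlinarith [sq_nonneg (ρ/2)]
  have := Finset.sum_le_sum h
  simp only [Finset.sum_const, Finset.card_univ, Fintype.card_fin, nsmul_eq_mul] at this
  linarith

set_option maxHeartbeats 1000000 in
lemma local_est (d : ℕ) (hd : 2 ≤ d) {ρ δ R : ℝ} (hρ : 0 < ρ) (hρ1 : ρ < 1) (hδ : 0 < δ) (hδ1 : δ ≤ 1)
    (hρδ : 2 * d * (ρ/2)^2 ≤ δ^2) (hR : 0 < R) (L : E (d+1) ≃ₗᵢ[ℝ] E (d+1)) {v : E (d+1) → ℝ}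
    (hv : ContDiff ℝ 1 v) (hs : ∀ x, ρ/2 ≤ dist x (L (e0 d)) → v x = 0) :
    (∫ x, |v x| ^ (2*(d:ℝ)/(d-1)) ∂(sphMeasure (d+1))) ^ (((d:ℝ)-1)/d) ≤
      (1 + 2 * δ) / (1 - ρ/2) * ((((d:ℝ)-1) * JR d R ^ (1/((d:ℝ)+1))) ^ (-(2*(d:ℝ)/(d-1) - 1))) ^ (((d:ℝ)-1)/d)
        * ∫ x in ball (0 : E (d+1)) 1, ‖fderiv ℝ v x‖ ^ 2 := by
  have hdr : (2:ℝ) ≤ d := by exact_mod_cast hd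
  set q := 2*(d:ℝ)/(d-1) with hq
  set θ := ((d:ℝ)-1)/d with hθ
  have hθ0 : 0 < θ := by rw [hθ]; apply div_pos <;> linarith
  have hθ1 : θ ≤ 1 := by rw [hθ, div_le_one (by linarith)]; linarith
  have hqθ : q * θ = 2 := by
    have : (d:ℝ) - 1 ≠ 0 := by linarith
    rw [hq, hθ]; field_simp
  have hq0 : 0 < q := by
    rw [hq]; apply div_pos <;> linarith
  set K := (((d:ℝ)-1) * JR d R ^ (1/((d:ℝ)+1))) ^ (-(q - 1)) with hK
  have hK0 : 0 ≤ K := by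
    refine Real.rpow_nonneg (mul_nonneg (by linarith) (Real.rpow_nonneg ?_ _)) _
    exact (JR_pos d hR).le
  set H : E (d+1) → ℝ := fun x => ‖fderiv ℝ v x‖ ^ 2 with hH
  have cD : Continuous (fderiv ℝ v) := hv.continuous_fderiv one_ne_zero
  have cH : Continuous H := cD.norm.pow 2
  set f : (Fin (d+1) → ℝ) → ℝ := fun x => v (L (Phi d ρ x)) with hf
  set g : Fin (d+1) → (Fin (d+1) → ℝ) → ℝ := fun k x => fderiv ℝ v (L (Phi d ρ x)) (L (Dv d ρ k x)) with hg
  have hSx : ∀ x ∈ Set.Icc (0 : Fin (d+1) → ℝ) 1, ∑ j, yv ρ x j ^ 2 ≤ δ^2/2 := fun x hx => cube_S hρδ hx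
  have hδ2 : δ^2 ≤ 1 := by nlinarith
  have hgam : ∀ x ∈ Set.Icc (0 : Fin (d+1) → ℝ) 1, 1/2 ≤ gam (yv ρ x) ^ 2 ∧ gam (yv ρ x) ^ 2 = 1 - ∑ j, yv ρ x j ^ 2 := by
    intro x hx
    have h1 : gam (yv ρ x) ^ 2 = 1 - ∑ j, yv ρ x j ^ 2 := by
      unfold gam; rw [Real.sq_sqrt]; linarith [hSx x hx]
    exact ⟨by linarith [hSx x hx], h1⟩
  have hgam1 : ∀ x ∈ Set.Icc (0 : Fin (d+1) → ℝ) 1, 1/2 ≤ gam (yv ρ x) := by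
    intro x hx
    have h1 := (hgam x hx).1
    have h0 : 0 ≤ gam (yv ρ x) := Real.sqrt_nonneg _
    nlinarith
  have cf : Continuous f := hv.continuous.comp (L.continuous.comp (Phi_cont d ρ))
  have cDv : ∀ k, ContinuousOn (Dv d ρ k) (Set.Icc 0 1) := by
    intro k
    refine Fin.cases ?_ (fun j => ?_) k
    · exact continuousOn_const
    · have hb : ContinuousOn (fun x => yv ρ x j / gam (yv ρ x)) (Set.Icc 0 1) := ?_
      · change ContinuousOn (fun x => ρ • EuclideanSpace.single j.succ 1 - (ρ * (yv ρ x j / gam (yv ρ x))) • EuclideanSpace.single 0 1) _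
        fun_prop
      refine ContinuousOn.div (Continuous.continuousOn ((continuous_apply j).comp (yv_cont ρ))) (gam_cont.comp (yv_cont ρ)).continuousOn ?_
      intro x hx
      have := hgam1 x hx
      change gam (yv ρ x) ≠ 0
      linarith
  have cg : ∀ k, ContinuousOn (g k) (Set.Icc 0 1) := fun k =>
    ContinuousOn.clm_apply (cD.comp (L.continuous.comp (Phi_cont d ρ))).continuousOn (L.continuous.comp_continuousOn (cDv k))
  have hder : ∀ k, ∀ x ∈ Set.Icc (0 : Fin (d+1) → ℝ) 1, x k ∈ Set.Ioo (0:ℝ) 1 →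
      HasDerivAt (fun t => f (Function.update x k t)) (g k x) (x k) := by
    intro k x hx _
    have h1 := Phi_deriv ρ k x (by linarith [hSx x hx])
    have h2 : HasDerivAt (fun t => L (Phi d ρ (Function.update x k t))) (L (Dv d ρ k x)) (x k) :=
      (L.toContinuousLinearEquiv.hasFDerivAt).comp_hasDerivAt (x k) h1
    have h3 : HasFDerivAt v (fderiv ℝ v (L (Phi d ρ (Function.update x k (x k))))) (L (Phi d ρ (Function.update x k (x k)))) :=
      (hv.differentiable one_ne_zero _).hasFDerivAt
    have h4 := h3.comp_hasDerivAt (x k) h2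
    rw [Function.update_eq_self] at h4
    exact h4
  have hvan : ∀ x ∈ Set.Icc (0 : Fin (d+1) → ℝ) 1, (ρ/2)^2 ≤ dist (Phi d ρ x) (e0 d) ^ 2 → f x = 0 := by
    intro x _ h
    refine hs _ ?_
    rw [L.dist_map]
    exact (pow_le_pow_iff_left₀ (by positivity) dist_nonneg two_ne_zero).1 h
  have hface : ∀ (j : Fin d) (x : Fin (d+1) → ℝ), (x j.succ = 0 ∨ x j.succ = 1) → x ∈ Set.Icc (0 : Fin (d+1) → ℝ) 1 → f x = 0 := by
    intro j x h hx
    refine hvan x hx ?_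
    rw [Phi_dist]
    have h1 : (ρ/2)^2 = yv ρ x j ^ 2 := by
      simp only [yv]
      rcases h with h | h <;> rw [h] <;> ring
    have h2 := Finset.single_le_sum (f := fun k => yv ρ x k ^ 2) (fun _ _ => sq_nonneg _) (Finset.mem_univ j)
    nlinarith [sq_nonneg (gam (yv ρ x) - ρ * x 0 - 1)]
  have h1 : ∀ k, ∀ x ∈ Set.Icc (0 : Fin (d+1) → ℝ) 1, x k = 1 → f x = 0 := by
    intro k
    refine Fin.cases ?_ (fun j => ?_) k
    · intro x hx h
      refine hvan x hx ?_
      rw [Phi_dist, h]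
      have h0 : gam (yv ρ x) ^ 2 ≤ 1 := by
        rw [(hgam x hx).2]
        have : 0 ≤ ∑ j, yv ρ x j ^ 2 := Finset.sum_nonneg fun _ _ => sq_nonneg _
        linarith
      have h0' : gam (yv ρ x) ≤ 1 := by nlinarith [hgam1 x hx]
      have : 0 ≤ ∑ j, yv ρ x j ^ 2 := Finset.sum_nonneg fun _ _ => sq_nonneg _
      nlinarith
    · exact fun x hx h => hface j x (Or.inr h) hx
  have h0 : ∀ k ≠ 0, ∀ x ∈ Set.Icc (0 : Fin (d+1) → ℝ) 1, x k = 0 → f x = 0 := by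
    intro k
    refine Fin.cases (fun h => absurd rfl h) (fun j => ?_) k
    exact fun _ x hx h => hface j x (Or.inl h) hx
  have box := box_thm d hd hR f g cf.continuousOn cg hder h1 h0
  rw [← hq, ← hK] at box
  -- gradient term
  have hsub : Set.Icc (0 : Fin (d+1) → ℝ) 1 ⊆ Phi d ρ ⁻¹' closedBall 0 1 := by
    intro x hx
    simp only [Set.mem_preimage, mem_closedBall_zero_iff]
    have hn := Phi_norm ρ x
    have hx1 := hx.1 0
    have hx2 := hx.2 0
    simp only [Pi.zero_apply, Pi.one_apply] at hx1 hx2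
    have hg1 := hgam1 x hx
    have hg2 := (hgam x hx).2
    have h5 : 0 ≤ ρ * x 0 := by positivity
    have h6 : ρ * x 0 ≤ 1 := by nlinarith
    have h7 : 0 ≤ (ρ * x 0) * (2 * gam (yv ρ x) - ρ * x 0) := mul_nonneg h5 (by linarith)
    have : ‖Phi d ρ x‖ ^ 2 ≤ 1 := by rw [hn]; nlinarith
    nlinarith [norm_nonneg (Phi d ρ x)]
  have hG : ∫ x in Set.Icc (0 : Fin (d+1) → ℝ) 1, ∑ k, g k x ^ 2 ≤
      ρ^2 * (1 + 2*δ) * ∫ x in Set.Icc (0 : Fin (d+1) → ℝ) 1, H (L (Phi d ρ x)) := by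
    rw [← integral_const_mul]
    refine setIntegral_mono_on ?_ ?_ measurableSet_Icc ?_
    · exact (continuousOn_finset_sum _ fun k _ => (cg k).pow 2).integrableOn_compact isCompact_Icc
    · exact (continuous_const.mul (cH.comp (L.continuous.comp (Phi_cont d ρ)))).continuousOn.integrableOn_compact isCompact_Icc
    · intro x hx
      refine grad_sum_le hδ hδ1 _ L x ?_
      simp_rw [div_pow]
      rw [← Finset.sum_div, div_le_iff₀ (by linarith [(hgam x hx).1])]
      have := hSx x hx
      have h8 := mul_le_mul_of_nonneg_left (hgam x hx).1 (sq_nonneg δ)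
      linarith
  have hcb := cube_le_ball d hρ cH (fun x => sq_nonneg _) L hsub
  set D := ∫ x in ball (0 : E (d+1)) 1, H x with hD
  have hD0 : 0 ≤ D := integral_nonneg fun x => sq_nonneg _
  set Gi := ∫ x in Set.Icc (0 : Fin (d+1) → ℝ) 1, ∑ k, g k x ^ 2 with hGi
  have hGi0 : 0 ≤ Gi := integral_nonneg fun x => Finset.sum_nonneg fun _ _ => sq_nonneg _
  have hGD : ρ ^ ((d:ℝ)-1) * Gi ≤ (1 + 2*δ) * D := by
    have e : ρ ^ ((d:ℝ)-1) * ρ^2 = ρ ^ (d+1) := by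
      rw [← Real.rpow_natCast ρ 2, ← Real.rpow_add hρ, ← Real.rpow_natCast]
      congr 1; push_cast; ring
    calc ρ ^ ((d:ℝ)-1) * Gi ≤ ρ ^ ((d:ℝ)-1) * (ρ^2 * (1 + 2*δ) * ∫ x in Set.Icc (0 : Fin (d+1) → ℝ) 1, H (L (Phi d ρ x))) := by gcongr
      _ = (1 + 2*δ) * (ρ ^ (d+1) * ∫ x in Set.Icc (0 : Fin (d+1) → ℝ) 1, H (L (Phi d ρ x))) := by rw [← e]; ring
      _ ≤ _ := by gcongr
  have surf := surf_est hρ hρ1 L (w := fun x => |v x| ^ q) (hv.continuous.abs.rpow_const fun x => Or.inr hq0.le)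
    (fun x => Real.rpow_nonneg (abs_nonneg _) _) (fun x hx => by simp [hs x hx, Real.zero_rpow hq0.ne'])
  have hr : 0 < 1 - ρ/2 := by linarith
  have surf2 : ∫ x, |v x| ^ q ∂(sphMeasure (d+1)) ≤ (1 / (1 - ρ/2)) * (ρ^d * (√Gi ^ q * K)) := by
    refine surf.trans ?_
    calc _ ≤ ρ ^ d / (1 - ρ/2) * (√Gi ^ q * K) := by
          refine mul_le_mul_of_nonneg_left box (by positivity)
      _ = _ := by ring
  have hI0 : 0 ≤ ∫ x, |v x| ^ q ∂(sphMeasure (d+1)) := integral_nonneg fun x => Real.rpow_nonneg (abs_nonneg _) _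
  have hpow := Real.rpow_le_rpow hI0 surf2 hθ0.le
  have hsq0 : 0 ≤ √Gi ^ q := Real.rpow_nonneg (Real.sqrt_nonneg _) _
  rw [Real.mul_rpow (by positivity) (by positivity), Real.mul_rpow (by positivity) (by positivity),
    Real.mul_rpow hsq0 hK0, ← Real.rpow_mul (Real.sqrt_nonneg _), hqθ] at hpow
  have e2 : √Gi ^ (2:ℝ) = Gi := by
    rw [Real.rpow_two, Real.sq_sqrt hGi0]
  have e3 : (ρ ^ d) ^ θ = ρ ^ ((d:ℝ)-1) := by
    rw [← Real.rpow_natCast, ← Real.rpow_mul hρ.le]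
    congr 1; rw [hθ]; field_simp
  have e4 : (1 / (1 - ρ/2)) ^ θ ≤ 1 / (1 - ρ/2) := by
    refine (Real.rpow_le_rpow_of_exponent_le ?_ hθ1).trans (by rw [Real.rpow_one])
    rw [le_div_iff₀ hr]; linarith
  rw [e2, e3] at hpow
  refine hpow.trans ?_
  have hKθ : 0 ≤ K ^ θ := Real.rpow_nonneg hK0 _
  calc (1 / (1 - ρ/2)) ^ θ * (ρ ^ ((d:ℝ)-1) * (Gi * K ^ θ))
      ≤ (1 / (1 - ρ/2)) * (ρ ^ ((d:ℝ)-1) * (Gi * K ^ θ)) := by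
        gcongr
    _ = (1 / (1 - ρ/2)) * K ^ θ * (ρ ^ ((d:ℝ)-1) * Gi) := by ring
    _ ≤ (1 / (1 - ρ/2)) * K ^ θ * ((1 + 2*δ) * D) := by gcongr
    _ = _ := by ring

lemma exists_iso {d : ℕ} {ξ : E (d+1)} (hξ : ξ ∈ sphere (0 : E (d+1)) 1) :
    ∃ L : E (d+1) ≃ₗᵢ[ℝ] E (d+1), L (e0 d) = ξ := by
  refine ⟨_, Submodule.reflection_sub (v := e0 d) (w := ξ) ?_⟩
  simp [e0, mem_sphere_zero_iff_norm.1 hξ]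

theorem local_thm (d : ℕ) (hd : 2 ≤ d) {ε : ℝ} (hε : 0 < ε) :
    ∃ r > 0, ∀ ξ ∈ sphere (0 : E (d+1)) 1, ∀ v : E (d+1) → ℝ, ContDiff ℝ 1 v →
      (∀ x, r ≤ dist x ξ → v x = 0) →
      (∫ x, |v x| ^ (2*(d:ℝ)/(d-1)) ∂(sphMeasure (d+1))) ^ (((d:ℝ)-1)/d) ≤
      (2/((d:ℝ)-1) * SA (d+1) ^ (-(1/(d:ℝ))) + ε) * ∫ x in ball (0 : E (d+1)) 1, ‖fderiv ℝ v x‖ ^ 2 := by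
  obtain ⟨R, hR, hRb⟩ := const_lim d hd (half_pos hε)
  have hdr : (2:ℝ) ≤ d := by exact_mod_cast hd
  set c := 2/((d:ℝ)-1) * SA (d+1) ^ (-(1/(d:ℝ))) with hc
  have hSA : 0 ≤ SA (d+1) := ENNReal.toReal_nonneg
  have hc0 : 0 ≤ c := mul_nonneg (div_nonneg (by norm_num) (by linarith)) (Real.rpow_nonneg hSA _)
  have hlim : Tendsto (fun δ : ℝ => (1 + 2*δ) / (1 - δ/(2*d)) * (c + ε/2)) (nhdsWithin 0 (Set.Ioi 0)) (nhds ((1 + 2*0) / (1 - 0/(2*d)) * (c + ε/2))) := by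
    have : ContinuousAt (fun δ : ℝ => (1 + 2*δ) / (1 - δ/(2*d)) * (c + ε/2)) 0 := by
      refine ContinuousAt.mul (ContinuousAt.div (by fun_prop) (by fun_prop) (by simp)) continuousAt_const
    exact this.tendsto.mono_left nhdsWithin_le_nhds
  have hev := hlim.eventually_lt_const (u := c + ε) (by simp; linarith)
  obtain ⟨δ, hδ1, hδ2⟩ := (hev.and (Ioo_mem_nhdsGT (show (0:ℝ) < 1 from one_pos))).exists
  have hδ0 := hδ2.1
  have hδl := hδ2.2
  refine ⟨δ/d/2, by positivity, fun ξ hξ v hv hvs => ?_⟩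
  obtain ⟨L, hL⟩ := exists_iso hξ
  have hρ1 : δ/d < 1 := by rw [div_lt_one (by linarith)]; linarith
  have := local_est d hd (ρ := δ/d) (δ := δ) (by positivity) hρ1 hδ0 hδl.le ?_ hR L hv (by rw [hL]; exact hvs)
  · refine this.trans ?_
    have hD0 : 0 ≤ ∫ x in ball (0 : E (d+1)) 1, ‖fderiv ℝ v x‖ ^ 2 := integral_nonneg fun x => sq_nonneg _
    refine mul_le_mul_of_nonneg_right ?_ hD0
    refine le_trans ?_ hδ1.le
    have e : δ/d/2 = δ/(2*d) := by rw [div_div, mul_comm]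
    rw [e]
    have : 0 < 1 - δ/(2*d) := by rw [← e]; linarith
    gcongr
  · have : 2 * (d:ℝ) * (δ/d/2)^2 = δ^2 / (2*d) := by field_simp
    rw [this, div_le_iff₀ (by linarith)]
    nlinarith [sq_nonneg δ]

def sp (n : ℕ) (κ : ℝ) (x : E n) : ℝ := κ * Real.log (1 + Real.exp ((1 - ‖x‖^2)/κ))

def sg (n : ℕ) (κ : ℝ) (x : E n) : ℝ := Real.exp ((1 - ‖x‖^2)/κ) / (1 + Real.exp ((1 - ‖x‖^2)/κ))

lemma sp_pos {n : ℕ} {κ : ℝ} (hκ : 0 < κ) (x : E n) : 0 < sp n κ x :=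
  mul_pos hκ (Real.log_pos (by linarith [Real.exp_pos ((1 - ‖x‖^2)/κ)]))

lemma sp_smooth {n : ℕ} (κ : ℝ) : ContDiff ℝ 1 (sp n κ) := by
  unfold sp
  refine contDiff_const.mul (ContDiff.log ?_ ?_)
  · refine contDiff_const.add (ContDiff.exp ((contDiff_const.sub (contDiff_norm_sq ℝ)).div_const κ))
  · intro x; positivity

lemma sp_deriv {n : ℕ} {κ : ℝ} (hκ : 0 < κ) (x : E n) :
    HasFDerivAt (sp n κ) ((-2 * sg n κ x) • innerSL ℝ x) x := by
  have h1 : HasFDerivAt (fun x : E n => ‖x‖^2) (2 • innerSL ℝ x) x := (hasStrictFDerivAt_norm_sq x).hasFDerivAt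
  have h2 : HasDerivAt (fun t : ℝ => κ * Real.log (1 + Real.exp ((1 - t)/κ)))
      (κ * ((Real.exp ((1 - ‖x‖^2)/κ) * ((-1)/κ)) / (1 + Real.exp ((1 - ‖x‖^2)/κ)))) (‖x‖^2) := by
    have a1 : HasDerivAt (fun t : ℝ => (1 - t)/κ) ((-1)/κ) (‖x‖^2) := by
      simpa using ((hasDerivAt_id (‖x‖^2)).const_sub 1).div_const κ
    exact ((a1.exp.const_add 1).log (by positivity)).const_mul κ
  have h3 := h2.comp_hasFDerivAt x h1
  refine h3.congr_fderiv ?_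
  ext y
  simp only [sg, FunLike.coe_smul, Pi.smul_apply, smul_eq_mul, nsmul_eq_mul]
  field_simp
  simp
  try ring

lemma sg_bd {n : ℕ} {κ : ℝ} (hκ : 0 < κ) {x : E n} (hx : ‖x‖ ≤ 1) : 1/2 ≤ sg n κ x ∧ sg n κ x ≤ 1 := by
  unfold sg
  have h : 1 ≤ Real.exp ((1 - ‖x‖^2)/κ) := by
    refine Real.one_le_exp (div_nonneg ?_ hκ.le)
    nlinarith [norm_nonneg x]
  constructor
  · rw [div_le_div_iff₀ (by norm_num) (by linarith)]; linarith
  · rw [div_le_one (by linarith)]; linarith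

lemma sp_sphere {n : ℕ} {κ : ℝ} {x : E n} (hx : ‖x‖ = 1) : sp n κ x = κ * Real.log 2 := by
  simp [sp, hx]; norm_num

lemma hardy {n : ℕ} (hn : 0 < n) {κ : ℝ} (hκ : 0 < κ) {u : E n → ℝ} (hu : ContDiff ℝ 1 u) :
    ∫ x in ball (0 : E n) 1, (n * (u x^2 / sp n κ x) + 1/2 * (‖x‖^2 / sp n κ x ^2 * u x^2)) ≤
      2 * (∫ x in ball (0 : E n) 1, ‖fderiv ℝ u x‖^2) + 1/(κ * Real.log 2) * ∫ x, u x^2 ∂(sphMeasure n) := by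
  have cs : Continuous (sp n κ) := (sp_smooth κ).continuous
  have cu := hu.continuous
  have cDu : Continuous (fderiv ℝ u) := hu.continuous_fderiv one_ne_zero
  have hs0 : ∀ x, sp n κ x ≠ 0 := fun x => (sp_pos hκ x).ne'
  have hw : ContDiff ℝ 1 (fun x => u x^2 / sp n κ x) := (hu.pow 2).div (sp_smooth κ) hs0
  have hr := radial_id hn hw
  have hS : ∫ x, u x^2 / sp n κ x ∂(sphMeasure n) = 1/(κ * Real.log 2) * ∫ x, u x^2 ∂(sphMeasure n) := by
    rw [← integral_const_mul]
    refine integral_congr_ae ?_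
    filter_upwards [sph_ae n] with x hx
    rw [sp_sphere (mem_sphere_zero_iff_norm.1 hx)]; ring
  rw [hS] at hr
  rw [← hr, ← integral_const_mul, ← integral_add]
  rotate_left
  · exact cont_int_ball (by fun_prop) ball_subset_closedBall
  · refine cont_int_ball ?_ ball_subset_closedBall
    have := hw.continuous_fderiv one_ne_zero
    have h2 := hw.continuous
    fun_prop
  refine setIntegral_mono_on ?_ ?_ measurableSet_ball ?_
  · refine cont_int_ball ?_ ball_subset_closedBall
    have h2 := hw.continuous
    have h3 : Continuous (fun x : E n => ‖x‖^2 / sp n κ x ^2) := (continuous_norm.pow 2).div (cs.pow 2) (fun x => pow_ne_zero _ (hs0 x))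
    fun_prop
  · refine cont_int_ball ?_ ball_subset_closedBall
    have := hw.continuous_fderiv one_ne_zero
    have h2 := hw.continuous
    fun_prop
  · intro x hx
    have hx1 : ‖x‖ ≤ 1 := (mem_ball_zero_iff.1 hx).le
    have hsx := sp_pos hκ x
    have d1 : HasFDerivAt u (fderiv ℝ u x) x := (hu.differentiable one_ne_zero x).hasFDerivAt
    have hfd : fderiv ℝ (fun x => u x^2 / sp n κ x) x x = 2 * u x * fderiv ℝ u x x / sp n κ x + 2 * sg n κ x * ‖x‖^2 * u x^2 / sp n κ x^2 := by
      have d0 : HasFDerivAt (fun x => u x ^ 2) _ x := d1.pow 2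
      have di : HasFDerivAt (fun y => (sp n κ y)⁻¹) _ x := (hasDerivAt_inv (hs0 x)).comp_hasFDerivAt x (sp_deriv hκ x)
      have d2 : HasFDerivAt (fun x => u x^2 * (sp n κ x)⁻¹) _ x := d0.mul di
      simp_rw [div_eq_mul_inv (u _ ^ 2)]
      rw [d2.fderiv]
      simp
      field_simp
      ring
    rw [hfd]
    have h4 : |fderiv ℝ u x x| ≤ ‖fderiv ℝ u x‖ * ‖x‖ := (fderiv ℝ u x).le_opNorm x
    set D := ‖fderiv ℝ u x‖
    set s := sp n κ x
    set a := ‖x‖ / s * |u x| with ha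
    have ha2 : a^2 = ‖x‖^2 / s^2 * u x^2 := by rw [ha, mul_pow, div_pow, sq_abs]
    have h5 : -(2 * (D * a)) ≤ 2 * u x * fderiv ℝ u x x / s := by
      have : |2 * u x * fderiv ℝ u x x / s| ≤ 2 * (D * a) := by
        rw [abs_div, abs_mul, abs_mul, abs_of_pos hsx, abs_two]
        calc 2 * |u x| * |fderiv ℝ u x x| / s ≤ 2 * |u x| * (D * ‖x‖) / s := by gcongr
          _ = _ := by rw [ha]; ring
      exact (abs_le.1 this).1
    have h6 : 2 * sg n κ x * ‖x‖^2 * u x^2 / s^2 = 2 * sg n κ x * a^2 := by rw [ha2]; ring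
    rw [h6, ← ha2]
    have h7 := (sg_bd hκ hx1).1
    have h8 : a^2 ≤ 2 * sg n κ x * a^2 := by nlinarith [sq_nonneg a]
    nlinarith [sq_nonneg (2 * D - a)]

lemma st_deriv_bd : ∃ M > (0:ℝ), ∀ t, |deriv Real.smoothTransition t| ≤ M := by
  have hc : Continuous (deriv Real.smoothTransition) := (Real.smoothTransition.contDiff (n := 1)).continuous_deriv le_rfl
  obtain ⟨C, hC⟩ := isCompact_Icc.exists_bound_of_continuousOn (hc.continuousOn (s := Set.Icc (0:ℝ) 1))
  refine ⟨max C 1, by positivity, fun t => ?_⟩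
  by_cases h0 : t < 0
  · have : Real.smoothTransition =ᶠ[nhds t] fun _ => 0 := by
      filter_upwards [Iio_mem_nhds h0] with s hs
      exact Real.smoothTransition.zero_of_nonpos (le_of_lt hs)
    rw [this.deriv_eq]; simp
  by_cases h1 : 1 < t
  · have : Real.smoothTransition =ᶠ[nhds t] fun _ => 1 := by
      filter_upwards [Ioi_mem_nhds h1] with s hs
      exact Real.smoothTransition.one_of_one_le (le_of_lt hs)
    rw [this.deriv_eq]; simp
  · exact (hC t ⟨not_lt.1 h0, not_lt.1 h1⟩).trans (le_max_left _ _)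

theorem cutoff {n : ℕ} (hn : 0 < n) {L η : ℝ} (hL : 0 < L) (hη : 0 < η) :
    ∃ χ : E n → ℝ, ∃ C > (0:ℝ), ContDiff ℝ 1 χ ∧ (∀ x, 0 ≤ χ x) ∧ (∀ x, χ x ≤ 1) ∧
      (∀ x ∈ sphere (0 : E n) 1, χ x = 1) ∧ ∀ u : E n → ℝ, ContDiff ℝ 1 u →
      ∫ x in ball (0 : E n) 1, (‖fderiv ℝ χ x‖^2 + L * χ x^2) * u x^2 ≤
        η * (∫ x in ball (0 : E n) 1, ‖fderiv ℝ u x‖^2) + C * ∫ x, u x^2 ∂(sphMeasure n) := by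
  obtain ⟨M, hM, hMb⟩ := st_deriv_bd
  have hnr : (0:ℝ) < n := by exact_mod_cast hn
  -- parameters
  obtain ⟨Λ, hΛ, hΛb⟩ : ∃ Λ > (0:ℝ), 4 * M^2 / Λ^2 ≤ η/4 := by
    refine ⟨1 + 16 * M^2/η, by positivity, ?_⟩
    rw [div_le_div_iff₀ (by positivity) (by positivity)]
    have : η * (1 + 16 * M^2/η) = η + 16 * M^2 := by field_simp
    have h1 : 0 < 16 * M^2/η := by positivity
    nlinarith
  set s1 := η * n / (2 * L) with hs1
  have hs1p : 0 < s1 := by positivity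
  set κ := s1 * Real.exp (-Λ) / Real.log 2 with hκd
  have hlog2 : 0 < Real.log 2 := Real.log_pos (by norm_num)
  have hκ : 0 < κ := by positivity
  have hs0 : κ * Real.log 2 = s1 * Real.exp (-Λ) := by rw [hκd]; field_simp
  have hs0p : 0 < κ * Real.log 2 := by positivity
  set f : E n → ℝ := fun x => 1 - (Real.log (sp n κ x) - Real.log (κ * Real.log 2)) / Λ with hf
  have hspne : ∀ x, sp n κ x ≠ 0 := fun x => (sp_pos hκ x).ne'
  have hfs : ContDiff ℝ 1 f := contDiff_const.sub ((((sp_smooth κ).log hspne).sub contDiff_const).div_const Λ)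
  set χ : E n → ℝ := fun x => Real.smoothTransition (f x) with hχ
  have hχs : ContDiff ℝ 1 χ := (Real.smoothTransition.contDiff (n := 1)).comp hfs
  refine ⟨χ, η/2 * (1/(κ * Real.log 2)), by positivity, hχs, fun x => Real.smoothTransition.nonneg _, fun x => Real.smoothTransition.le_one _, ?_, ?_⟩
  · intro x hx
    simp only [hχ, hf]
    rw [sp_sphere (mem_sphere_zero_iff_norm.1 hx)]
    simp [Real.smoothTransition.one]
  intro u hu
  have cu := hu.continuous
  have cs : Continuous (sp n κ) := (sp_smooth κ).continuous
  have H := hardy hn hκ hu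
  have hpt : ∫ x in ball (0 : E n) 1, (‖fderiv ℝ χ x‖^2 + L * χ x^2) * u x^2 ≤ ∫ x in ball (0 : E n) 1, η/2 * (n * (u x^2 / sp n κ x) + 1/2 * (‖x‖^2 / sp n κ x ^2 * u x^2)) := by
    refine setIntegral_mono_on ?_ ?_ measurableSet_ball ?_
    · refine cont_int_ball ?_ ball_subset_closedBall
      have := hχs.continuous_fderiv one_ne_zero
      have := hχs.continuous
      fun_prop
    · refine cont_int_ball ?_ ball_subset_closedBall
      have h2 : Continuous (fun x : E n => u x^2 / sp n κ x) := (cu.pow 2).div cs hspne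
      have h3 : Continuous (fun x : E n => ‖x‖^2 / sp n κ x ^2) := (continuous_norm.pow 2).div (cs.pow 2) (fun x => pow_ne_zero _ (hspne x))
      fun_prop
    · intro x hx
      have hx1 : ‖x‖ ≤ 1 := (mem_ball_zero_iff.1 hx).le
      have hsx := sp_pos hκ x
      have hd : ‖fderiv ℝ χ x‖^2 ≤ η/4 * (‖x‖^2 / sp n κ x^2) := by
        have d1 := ((((sp_deriv hκ x).log (hspne x)).sub_const (Real.log (κ * Real.log 2))).mul_const Λ⁻¹).const_sub 1
        have d2 : HasFDerivAt f _ x := d1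
        have d3 := ((Real.smoothTransition.contDiff (n := 1)).differentiable one_ne_zero (f x)).hasDerivAt.comp_hasFDerivAt x d2
        have d4 : HasFDerivAt χ _ x := d3
        rw [d4.fderiv]
        rw [norm_smul, norm_neg, norm_smul, norm_smul, norm_smul, innerSL_apply_norm]
        simp only [norm_inv, Real.norm_eq_abs, abs_of_pos hsx, abs_of_pos hΛ, abs_mul, abs_neg, abs_two]
        have hg := sg_bd hκ hx1
        rw [abs_of_nonneg (by linarith : 0 ≤ sg n κ x)]
        have hgp : 0 ≤ sg n κ x := by linarith
        calc _ ≤ (M * (Λ⁻¹ * ((sp n κ x)⁻¹ * (2 * 1 * ‖x‖))))^2 := by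
              gcongr
              · exact hMb _
              · exact hg.2
          _ = 4 * M^2/Λ^2 * (‖x‖^2 / sp n κ x^2) := by field_simp; ring
          _ ≤ _ := by gcongr
      have hc : L * χ x^2 ≤ η/2 * (n / sp n κ x) := by
        by_cases hz : f x ≤ 0
        · have : χ x = 0 := Real.smoothTransition.zero_of_nonpos hz
          rw [this]; simp; positivity
        · have h1 : χ x ^2 ≤ 1 := pow_le_one₀ (Real.smoothTransition.nonneg _) (Real.smoothTransition.le_one _)
          have h2 : Real.log (sp n κ x) < Real.log s1 := by
            push Not at hz
            simp only [hf] at hz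
            have : (Real.log (sp n κ x) - Real.log (κ * Real.log 2)) / Λ < 1 := by linarith
            rw [div_lt_one hΛ, hs0, Real.log_mul hs1p.ne' (Real.exp_pos _).ne', Real.log_exp] at this
            linarith
          have h3 : sp n κ x < s1 := (Real.log_lt_log_iff hsx hs1p).1 h2
          calc L * χ x^2 ≤ L * 1 := by gcongr
            _ = η/2 * (n / s1) := by rw [hs1]; field_simp
            _ ≤ _ := by gcongr
      calc (‖fderiv ℝ χ x‖^2 + L * χ x^2) * u x^2 ≤ (η/4 * (‖x‖^2 / sp n κ x^2) + η/2 * (n / sp n κ x)) * u x^2 := by gcongr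
        _ = _ := by ring
  refine hpt.trans ?_
  rw [integral_const_mul]
  have := mul_le_mul_of_nonneg_left H (show 0 ≤ η/2 by positivity)
  refine this.trans (le_of_eq ?_)
  ring

lemma poly_cont {n : ℕ} (p : MvPolynomial (Fin n) ℝ) : Continuous (fun x : E n => MvPolynomial.eval (fun i => x i) p) := by
  have h1 : Continuous (fun x : E n => (fun i => x i : Fin n → ℝ)) := by fun_prop
  exact (MvPolynomial.continuous_eval p).comp h1

/-- `P0` as a submodule. -/
def P0s (n m : ℕ) : Submodule ℝ (MvPolynomial (Fin n) ℝ) where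
  carrier := P0 n m
  add_mem' := by
    rintro p q ⟨hp, hp'⟩ ⟨hq, hq'⟩
    refine ⟨(MvPolynomial.totalDegree_add p q).trans (max_le hp hq), ?_⟩
    simp only [map_add]
    rw [integral_add (sph_integrable (poly_cont p)) (sph_integrable (poly_cont q)), hp', hq', add_zero]
  zero_mem' := by simp [P0]
  smul_mem' := by
    rintro c p ⟨hp, hp'⟩
    refine ⟨(MvPolynomial.totalDegree_smul_le c p).trans hp, ?_⟩
    simp only [MvPolynomial.smul_eval]
    rw [integral_const_mul, hp', mul_zero]

lemma P0s_fin (n m : ℕ) : Module.Finite ℝ (P0s n m) := by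
  have hle : P0s n m ≤ MvPolynomial.restrictTotalDegree (Fin n) ℝ m := fun p hp =>
    (MvPolynomial.mem_restrictTotalDegree _ _ _).2 hp.1
  exact Submodule.finiteDimensional_of_le hle

/-- restriction to the sphere -/
def resS (n : ℕ) : MvPolynomial (Fin n) ℝ →ₗ[ℝ] (sphere (0 : E n) 1 → ℝ) where
  toFun p := fun x => MvPolynomial.eval (fun i => (x : E n) i) p
  map_add' p q := by ext x; simp
  map_smul' c p := by ext x; simp

lemma mean_zero_nonpos {n : ℕ} {p : MvPolynomial (Fin n) ℝ} {m : ℕ} (hp : p ∈ P0 n m)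
    (h : ∀ x : sphere (0 : E n) 1, resS n p x ≤ 0) : resS n p = 0 := by
  have h0 := hp.2
  rw [sph_integral] at h0
  have hc : Continuous (resS n p) := (poly_cont p).comp continuous_subtype_val
  have h1 : ∫ x : sphere (0 : E n) 1, -(resS n p x) ∂((volume : Measure (E n)).toSphere) = 0 := by
    rw [integral_neg, neg_eq_zero]; exact h0
  rw [integral_eq_zero_iff_of_nonneg (fun x => by simpa using h x)] at h1
  · have h2 := (Continuous.ae_eq_iff_eq _ hc.neg continuous_zero).1 h1
    simpa using h2
  · exact hc.neg.integrable_of_hasCompactSupport (HasCompactSupport.of_compactSpace _)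

lemma sphere_ne (d : ℕ) : Nonempty (sphere (0 : E (d+1)) 1) := ⟨⟨e0 d, by simp [e0]⟩⟩

/-- a finite family of mean zero polynomials spanning, with the interior property. -/
lemma exists_basis (d m : ℕ) : ∃ (r : ℕ) (p : Fin r → MvPolynomial (Fin (d+1)) ℝ),
    (∀ i, p i ∈ P0 (d+1) m) ∧
    (∀ q ∈ P0 (d+1) m, ∃ c : Fin r → ℝ, ∀ x : sphere (0 : E (d+1)) 1, resS (d+1) q x = ∑ i, c i * resS (d+1) (p i) x) ∧
    convexHull ℝ (Set.range (fun x : sphere (0 : E (d+1)) 1 => fun i => resS (d+1) (p i) x)) ∈ nhds (0 : Fin r → ℝ) := by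
  haveI := P0s_fin (d+1) m
  haveI := sphere_ne d
  let W := (P0s (d+1) m).map (resS (d+1))
  haveI : Module.Finite ℝ W := inferInstance
  let b := Module.finBasis ℝ W
  have hb : ∀ i, ∃ p ∈ P0 (d+1) m, resS (d+1) p = b i := fun i => (b i).2
  choose p hp hpb using hb
  have hind : ∀ c : Fin (Module.finrank ℝ W) → ℝ, (∀ x, ∑ i, c i * resS (d+1) (p i) x = 0) → c = 0 := by
    intro c hc
    have h1 : ∑ i, c i • b i = 0 := by
      ext x
      simp only [Submodule.coe_sum, Submodule.coe_smul, Finset.sum_apply, Pi.smul_apply, smul_eq_mul, ← hpb]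
      exact hc x
    have := Fintype.linearIndependent_iff.1 b.linearIndependent c h1
    exact funext this
  have hcomb : ∀ c : Fin (Module.finrank ℝ W) → ℝ, ∑ i, c i • p i ∈ P0 (d+1) m := fun c =>
    (P0s (d+1) m).sum_mem fun i _ => (P0s (d+1) m).smul_mem _ (hp i)
  have hcombr : ∀ (c : Fin (Module.finrank ℝ W) → ℝ) x, resS (d+1) (∑ i, c i • p i) x = ∑ i, c i * resS (d+1) (p i) x := by
    intro c x
    simp [map_sum, Finset.sum_apply]
  have hnonpos : ∀ c : Fin (Module.finrank ℝ W) → ℝ, (∀ x, ∑ i, c i * resS (d+1) (p i) x ≤ 0) → c = 0 := by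
    intro c hc
    refine hind c fun x => ?_
    rw [← hcombr, mean_zero_nonpos (hcomb c) (fun x => by rw [hcombr]; exact hc x)]; rfl
  refine ⟨_, p, hp, ?_, ?_⟩
  · intro q hq
    let qw : W := ⟨resS (d+1) q, q, hq, rfl⟩
    refine ⟨b.repr qw, fun x => ?_⟩
    have h1 := congrArg (fun w : W => (w : sphere (0 : E (d+1)) 1 → ℝ) x) (b.sum_repr qw)
    simp only [Submodule.coe_sum, Submodule.coe_smul, Finset.sum_apply, Pi.smul_apply, smul_eq_mul, ← hpb] at h1
    exact h1.symm
  · set ev : sphere (0 : E (d+1)) 1 → Fin (Module.finrank ℝ W) → ℝ := fun x => fun i => resS (d+1) (p i) x with hev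
    have hlin : ∀ f : (Fin (Module.finrank ℝ W) → ℝ) →ₗ[ℝ] ℝ, ∀ z, f z = ∑ i, f (Pi.single i 1) * z i := by
      intro f z
      conv_lhs => rw [← Finset.univ_sum_single z, map_sum]
      refine Finset.sum_congr rfl fun i _ => ?_
      have : (Pi.single i (z i) : Fin (Module.finrank ℝ W) → ℝ) = z i • Pi.single i 1 := by
        rw [← Pi.single_smul]; simp
      rw [this, map_smul, smul_eq_mul, mul_comm]
    have hf0 : ∀ f : (Fin (Module.finrank ℝ W) → ℝ) →ₗ[ℝ] ℝ, (∀ x, f (ev x) ≤ 0) → f = 0 := by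
      intro f hf
      have h1 := hnonpos (fun i => f (Pi.single i 1)) (fun x => by rw [← hlin f (ev x)]; exact hf x)
      ext i
      simpa using congrFun h1 i
    have hIntg : (interior (convexHull ℝ (Set.range ev))).Nonempty := by
      rw [interior_convexHull_nonempty_iff_affineSpan_eq_top,
        AffineSubspace.affineSpan_eq_top_iff_vectorSpan_eq_top_of_nonempty _ _ _ (Set.range_nonempty ev)]
      by_contra hne
      obtain ⟨f, hf, hk⟩ := Submodule.exists_le_ker_of_lt_top _ (lt_top_iff_ne_top.2 hne)
      obtain ⟨x0⟩ := sphere_ne d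
      have hconst : ∀ x, f (ev x) = f (ev x0) := by
        intro x
        have := hk (vsub_mem_vectorSpan ℝ (Set.mem_range_self x) (Set.mem_range_self x0))
        rw [LinearMap.mem_ker, vsub_eq_sub, map_sub, sub_eq_zero] at this
        exact this
      rcases le_total (f (ev x0)) 0 with h | h
      · exact hf (hf0 f fun x => by rw [hconst]; exact h)
      · have := hf0 (-f) fun x => by simp only [LinearMap.neg_apply]; rw [hconst]; linarith
        exact hf (neg_eq_zero.1 this)
    rw [mem_interior_iff_mem_nhds.symm]
    by_contra h0
    obtain ⟨f, hf⟩ := geometric_hahn_banach_open_point ((convex_convexHull ℝ _).interior) isOpen_interior h0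
    rw [map_zero] at hf
    have hle : ∀ x, f (ev x) ≤ 0 := by
      intro x
      have hx : ev x ∈ closure (interior (convexHull ℝ (Set.range ev))) := by
        rw [(convex_convexHull ℝ _).closure_interior_eq_closure_of_nonempty_interior hIntg]
        exact subset_closure (subset_convexHull ℝ _ (Set.mem_range_self x))
      have hcl : IsClosed {z | f z ≤ 0} := isClosed_le f.continuous continuous_const
      exact closure_minimal (fun z hz => (hf z hz).le) hcl hx
    have hz := hf0 f.toLinearMap hle
    obtain ⟨z, hz'⟩ := hIntg
    have h1 := hf z hz'
    have h2 : f z = 0 := by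
      have := congrArg (fun g : (Fin (Module.finrank ℝ W) → ℝ) →ₗ[ℝ] ℝ => g z) hz
      simpa using this
    linarith

lemma Theta_le_fin {d m : ℕ} {θ : ℝ} (hθ : 0 < θ) {ι : Type} [Fintype ι] (ξ : ι → sphere (0 : E (d+1)) 1) (w : ι → ℝ)
    (hw : ∀ i, 0 ≤ w i) (hw1 : ∑ i, w i = 1) (hm : ∀ p ∈ P0 (d+1) m, ∑ i, w i * resS (d+1) p (ξ i) = 0) :
    (∑ i, w i ^ θ) ∈ {t : ℝ | ∃ (ξ : ℕ → E (d+1)) (w : ℕ → ℝ),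
    (∀ i, ξ i ∈ Metric.sphere (0 : E (d+1)) 1) ∧ (∀ i, 0 ≤ w i) ∧ Summable w ∧
    (∑' i, w i) = 1 ∧
    (∀ p ∈ P0 (d+1) m, (∑' i, w i * MvPolynomial.eval (fun j => ξ i j) p) = 0) ∧
    Summable (fun i => w i ^ θ) ∧ t = ∑' i, w i ^ θ} := by
  obtain ⟨x0⟩ := sphere_ne d
  let e := (Fintype.equivFin ι).symm
  let N := Fintype.card ι
  let ξ' : ℕ → sphere (0 : E (d+1)) 1 := fun i => if h : i < N then ξ (e ⟨i, h⟩) else x0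
  let w' : ℕ → ℝ := fun i => if h : i < N then w (e ⟨i, h⟩) else 0
  have hw0 : ∀ i ∉ Finset.range N, w' i = 0 := fun i hi => by
    have : ¬ i < N := by simpa using hi
    simp [w', this]
  have gen : ∀ F : sphere (0 : E (d+1)) 1 → ℝ → ℝ, (∀ x, F x 0 = 0) → Summable (fun i => F (ξ' i) (w' i)) ∧ ∑' i, F (ξ' i) (w' i) = ∑ i, F (ξ i) (w i) := by
    intro F hF
    have h0 : ∀ i ∉ Finset.range N, F (ξ' i) (w' i) = 0 := fun i hi => by rw [hw0 i hi, hF]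
    refine ⟨summable_of_ne_finset_zero h0, ?_⟩
    rw [tsum_eq_sum h0, Finset.sum_range, ← e.sum_comp]
    refine Finset.sum_congr rfl fun i _ => ?_
    simp [ξ', w']
  refine ⟨fun i => (ξ' i : E (d+1)), w', fun i => (ξ' i).2, ?_, (gen (fun _ a => a) (fun _ => rfl)).1, ?_, ?_, ?_, ?_⟩
  · intro i
    simp only [w']; split_ifs
    · exact hw _
    · exact le_rfl
  · rw [(gen (fun _ a => a) (fun _ => rfl)).2, hw1]
  · intro p hp
    have := (gen (fun x a => a * resS (d+1) p x) (fun _ => zero_mul _)).2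
    rw [hm p hp] at this
    exact this
  · exact (gen (fun _ a => a ^ θ) (fun _ => Real.zero_rpow hθ.ne')).1
  · exact (gen (fun _ a => a ^ θ) (fun _ => Real.zero_rpow hθ.ne')).2.symm

lemma Theta_approx (d m : ℕ) {θ : ℝ} (hθ : 0 < θ) (hθ1 : θ ≤ 1) :
    1 ≤ Theta (d+1) m θ ∧ ∀ ε > (0:ℝ), ∃ (r : ℕ) (p : Fin r → MvPolynomial (Fin (d+1)) ℝ) (κ : ℝ), 0 < κ ∧
    (∀ i, p i ∈ P0 (d+1) m) ∧ ∀ (ι : Type) [Fintype ι] (ξ : ι → sphere (0 : E (d+1)) 1) (w : ι → ℝ),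
      (∀ i, 0 ≤ w i) → ∑ i, w i = 1 → (∀ k, |∑ i, w i * resS (d+1) (p k) (ξ i)| ≤ κ) →
      Theta (d+1) m θ ≤ ∑ i, w i ^ θ + ε := by
  obtain ⟨r, p, hp, hspan, hnhd⟩ := exists_basis d m
  set ev : sphere (0 : E (d+1)) 1 → Fin r → ℝ := fun x => fun i => resS (d+1) (p i) x with hev
  have hbdd : ∀ t ∈ {t : ℝ | ∃ (ξ : ℕ → E (d+1)) (w : ℕ → ℝ),
    (∀ i, ξ i ∈ Metric.sphere (0 : E (d+1)) 1) ∧ (∀ i, 0 ≤ w i) ∧ Summable w ∧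
    (∑' i, w i) = 1 ∧
    (∀ p ∈ P0 (d+1) m, (∑' i, w i * MvPolynomial.eval (fun j => ξ i j) p) = 0) ∧
    Summable (fun i => w i ^ θ) ∧ t = ∑' i, w i ^ θ}, 1 ≤ t := by
    rintro t ⟨ξ, w, _, hw, hws, hw1, _, hwt, rfl⟩
    rw [← hw1]
    refine hws.tsum_le_tsum (fun i => ?_) hwt
    have h1 : w i ≤ 1 := by rw [← hw1]; exact hws.le_tsum i fun j _ => hw j
    rcases (hw i).eq_or_lt with h | h
    · rw [← h, Real.zero_rpow hθ.ne']
    · calc w i = w i ^ (1:ℝ) := (Real.rpow_one _).symm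
        _ ≤ _ := Real.rpow_le_rpow_of_exponent_ge h h1 hθ1
  -- moments vanish on the basis imply on all
  have hall : ∀ (ι : Type) [Fintype ι] (ξ : ι → sphere (0 : E (d+1)) 1) (w : ι → ℝ), (∑ i, w i • ev (ξ i) = 0) →
      ∀ q ∈ P0 (d+1) m, ∑ i, w i * resS (d+1) q (ξ i) = 0 := by
    intro ι _ ξ w h q hq
    obtain ⟨c, hc⟩ := hspan q hq
    simp_rw [hc, Finset.mul_sum]
    rw [Finset.sum_comm]
    refine Finset.sum_eq_zero fun k _ => ?_
    have := congrFun h k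
    simp only [Finset.sum_apply, Pi.smul_apply, smul_eq_mul, Pi.zero_apply, hev] at this
    calc ∑ i, w i * (c k * resS (d+1) (p k) (ξ i)) = c k * ∑ i, w i * resS (d+1) (p k) (ξ i) := by
          rw [Finset.mul_sum]; exact Finset.sum_congr rfl fun i _ => by ring
      _ = 0 := by rw [this, mul_zero]
  -- representation of points near 0
  have hrep : ∀ z ∈ convexHull ℝ (Set.range ev), ∃ (ι : Type) (_ : Fintype ι) (ξ : ι → sphere (0 : E (d+1)) 1) (w : ι → ℝ),
      (∀ i, 0 ≤ w i) ∧ ∑ i, w i = 1 ∧ ∑ i, w i • ev (ξ i) = z ∧ Fintype.card ι ≤ r + 1 := by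
    intro z hz
    obtain ⟨ι, hι, y, w, hy, hai, hw, hw1, hwz⟩ := eq_pos_convex_span_of_mem_convexHull hz
    have hy' : ∀ i, ∃ x, ev x = y i := fun i => hy (Set.mem_range_self i)
    choose ξ hξ using hy'
    refine ⟨ι, hι, ξ, w, fun i => (hw i).le, hw1, by simp_rw [hξ]; exact hwz, ?_⟩
    refine hai.card_le_finrank_succ.trans ?_
    have := Submodule.finrank_le (vectorSpan ℝ (Set.range y))
    simp only [Module.finrank_fintype_fun_eq_card, Fintype.card_fin] at this
    omega
  constructor
  · refine le_csInf ?_ hbdd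
    obtain ⟨ι, hι, ξ, w, h1, h2, h3, _⟩ := hrep 0 (mem_of_mem_nhds hnhd)
    exact ⟨_, Theta_le_fin hθ ξ w h1 h2 (hall ι ξ w h3)⟩
  · intro ε hε
    obtain ⟨r0, hr0, hball⟩ := Metric.mem_nhds_iff.1 hnhd
    -- choose s
    obtain ⟨s, hs0, hs1, hsε⟩ : ∃ s : ℝ, 0 < s ∧ s < 1 ∧ ((r:ℝ) + 1) * s ^ θ ≤ ε := by
      have hlim : Tendsto (fun s : ℝ => ((r:ℝ) + 1) * s ^ θ) (nhdsWithin 0 (Set.Ioi 0)) (nhds (((r:ℝ) + 1) * 0 ^ θ)) := by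
        have : ContinuousAt (fun s : ℝ => ((r:ℝ) + 1) * s ^ θ) 0 :=
          continuousAt_const.mul (Real.continuousAt_rpow_const 0 θ (Or.inr hθ.le))
        exact this.tendsto.mono_left nhdsWithin_le_nhds
      have hev := hlim.eventually_lt_const (u := ε) (by rw [Real.zero_rpow hθ.ne']; simpa using hε)
      obtain ⟨s, h1, h2⟩ := (hev.and (Ioo_mem_nhdsGT (show (0:ℝ) < 1 from one_pos))).exists
      exact ⟨s, h2.1, h2.2, h1.le⟩
    refine ⟨r, p, s * r0 / 2, by positivity, hp, ?_⟩
    intro ι _ ξ w hw hw1 hmom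
    set z := ∑ i, w i • ev (ξ i) with hz
    have hzn : ‖z‖ ≤ s * r0 / 2 := by
      rw [pi_norm_le_iff_of_nonneg (by positivity)]
      intro k
      have := hmom k
      simpa [hz, hev, Finset.sum_apply] using this
    have hzz : (-((1-s)/s)) • z ∈ convexHull ℝ (Set.range ev) := by
      refine hball ?_
      rw [mem_ball_zero_iff, norm_smul, norm_neg, Real.norm_eq_abs, abs_of_nonneg (div_nonneg (by linarith) hs0.le)]
      calc (1-s)/s * ‖z‖ ≤ (1-s)/s * (s * r0/2) := by
            have : 0 ≤ (1-s)/s := div_nonneg (by linarith) hs0.le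
            gcongr
        _ = (1-s) * (r0/2) := by field_simp
        _ < r0 := by nlinarith
    obtain ⟨ι', hι', ξ', w', h1, h2, h3, h4⟩ := hrep _ hzz
    let Ξ : ι ⊕ ι' → sphere (0 : E (d+1)) 1 := Sum.elim ξ ξ'
    let ω : ι ⊕ ι' → ℝ := Sum.elim (fun i => (1-s) * w i) (fun i => s * w' i)
    have hT := Theta_le_fin (m := m) hθ Ξ ω ?_ ?_ (hall _ Ξ ω ?_)
    · have hle : Theta (d+1) m θ ≤ ∑ i, ω i ^ θ := csInf_le ⟨1, hbdd⟩ hT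
      refine hle.trans ?_
      rw [Fintype.sum_sum_type]
      simp only [ω, Sum.elim_inl, Sum.elim_inr]
      refine add_le_add ?_ ?_
      · refine Finset.sum_le_sum fun i _ => ?_
        refine Real.rpow_le_rpow (mul_nonneg (by linarith) (hw i)) ?_ hθ.le
        nlinarith [hw i]
      · have hb : ∀ i ∈ Finset.univ, (s * w' i) ^ θ ≤ s ^ θ := by
          intro i _
          refine Real.rpow_le_rpow (mul_nonneg hs0.le (h1 i)) ?_ hθ.le
          have : w' i ≤ 1 := by rw [← h2]; exact Finset.single_le_sum (fun j _ => h1 j) (Finset.mem_univ i)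
          nlinarith
        refine (Finset.sum_le_sum hb).trans ?_
        rw [Finset.sum_const, nsmul_eq_mul, Finset.card_univ]
        refine le_trans ?_ hsε
        have h4' : (Fintype.card ι' : ℝ) ≤ r + 1 := by exact_mod_cast h4
        have : 0 ≤ s ^ θ := Real.rpow_nonneg hs0.le _
        gcongr
    · rintro (i | i)
      · exact mul_nonneg (by linarith) (hw i)
      · exact mul_nonneg hs0.le (h1 i)
    · rw [Fintype.sum_sum_type]
      simp only [ω, Sum.elim_inl, Sum.elim_inr]
      rw [← Finset.mul_sum, ← Finset.mul_sum, hw1, h2]; ring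
    · rw [Fintype.sum_sum_type]
      simp only [ω, Ξ, Sum.elim_inl, Sum.elim_inr, mul_smul]
      rw [← Finset.smul_sum, ← Finset.smul_sum, h3, ← hz, smul_smul, ← add_smul]
      have : (1 - s) + s * -((1-s)/s) = 0 := by field_simp; ring
      rw [this, zero_smul]

/-- one dimensional bump of the unit cell -/
def bmp (K : ℕ) (t : ℝ) : ℝ :=
  Real.smoothTransition (2 * K * t) * Real.smoothTransition (2 * K * (1 - t))

lemma bmp_cd (K : ℕ) : ContDiff ℝ 1 (bmp K) := by
  unfold bmp
  have h1 : ContDiff ℝ 1 Real.smoothTransition := Real.smoothTransition.contDiff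
  exact (h1.comp (contDiff_const.mul contDiff_id)).mul
    (h1.comp (contDiff_const.mul (contDiff_const.sub contDiff_id)))

lemma bmp_nn (K : ℕ) (t : ℝ) : 0 ≤ bmp K t :=
  mul_nonneg (Real.smoothTransition.nonneg _) (Real.smoothTransition.nonneg _)

lemma bmp_le (K : ℕ) (t : ℝ) : bmp K t ≤ 1 :=
  mul_le_one₀ (Real.smoothTransition.le_one _) (Real.smoothTransition.nonneg _)
    (Real.smoothTransition.le_one _)

lemma bmp_supp {K : ℕ} {t : ℝ} (h : bmp K t ≠ 0) : 0 < t ∧ t < 1 := by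
  have h1 := left_ne_zero_of_mul h
  have h2 := right_ne_zero_of_mul h
  have hK : (0:ℝ) ≤ 2 * K := by positivity
  constructor
  · by_contra hc
    push Not at hc
    exact h1 (Real.smoothTransition.zero_of_nonpos (mul_nonpos_of_nonneg_of_nonpos hK hc))
  · by_contra hc
    push Not at hc
    exact h2 (Real.smoothTransition.zero_of_nonpos
      (mul_nonpos_of_nonneg_of_nonpos hK (by linarith)))

lemma bmp_one {K : ℕ} {t : ℝ} (h1 : 1 ≤ 2 * K * t) (h2 : 1 ≤ 2 * K * (1 - t)) : bmp K t = 1 := by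
  unfold bmp
  rw [Real.smoothTransition.one_of_one_le h1, Real.smoothTransition.one_of_one_le h2, one_mul]

lemma bad_one {K : ℕ} (hK : 0 < K) (s : ℝ) {l l' : ℕ} (hl : l < K) (hl' : l' < K)
    (h : bmp K (Int.fract (s - l / K)) ≠ 1) (h' : bmp K (Int.fract (s - l' / K)) ≠ 1) : l = l' := by
  have hK0 : (0:ℝ) < K := by exact_mod_cast hK
  have key : ∀ l : ℕ, bmp K (Int.fract (s - l / K)) ≠ 1 →
      ∃ z : ℤ, |2 * (K * s - l - K * z)| < 1 := by
    intro l hb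
    by_cases h1 : 1 ≤ 2 * K * (Int.fract (s - l / K))
    · have h2 : ¬ 1 ≤ 2 * K * (1 - Int.fract (s - l / K)) := fun h2 => hb (bmp_one h1 h2)
      push Not at h2
      refine ⟨⌊s - l / K⌋ + 1, ?_⟩
      have h3 := Int.fract_lt_one (s - l / K)
      have h4 : 0 < 2 * (K:ℝ) * (1 - Int.fract (s - l / K)) := by
        have : 0 < 1 - Int.fract (s - l / K) := by linarith
        positivity
      have e : 2 * (K * s - l - K * ((⌊s - (l:ℝ) / K⌋ + 1 : ℤ) : ℝ))
          = - (2 * (K:ℝ) * (1 - Int.fract (s - l / K))) := by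
        unfold Int.fract; push_cast; field_simp; ring
      rw [e, abs_neg, abs_of_pos h4]; exact h2
    · push Not at h1
      refine ⟨⌊s - l / K⌋, ?_⟩
      have h3 := Int.fract_nonneg (s - l / K)
      have h4 : 0 ≤ 2 * (K:ℝ) * (Int.fract (s - l / K)) := by positivity
      have e : 2 * (K * s - l - K * ((⌊s - (l:ℝ) / K⌋ : ℤ) : ℝ))
          = (2 * (K:ℝ) * (Int.fract (s - l / K))) := by
        unfold Int.fract; field_simp
      rw [e, abs_of_nonneg h4]; exact h1
  obtain ⟨z, hz⟩ := key l h
  obtain ⟨z', hz'⟩ := key l' h'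
  rw [abs_lt] at hz hz'
  have h5 : ((((l:ℤ) - l' + K * (z - z') : ℤ)) : ℝ) < 1 := by push_cast; linarith
  have h6 : (-1 : ℝ) < ((((l:ℤ) - l' + K * (z - z') : ℤ)) : ℝ) := by push_cast; linarith
  have h7 : ((l:ℤ) - l' + K * (z - z') : ℤ) < 1 := by exact_mod_cast h5
  have h8 : -1 < ((l:ℤ) - l' + K * (z - z') : ℤ) := by exact_mod_cast h6
  have h9 : (l:ℤ) - l' = K * (z' - z) := by linarith
  have h10 : (K:ℤ) ∣ (l:ℤ) - l' := ⟨_, h9⟩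
  have h11 := Int.eq_zero_of_abs_lt_dvd h10 (by rw [abs_lt]; omega)
  omega

/-- grid cutoff -/
def gphi {n : ℕ} (a : ℝ) (K : ℕ) (l : ℕ) (j : Fin n → ℤ) (x : E n) : ℝ :=
  ∏ k, bmp K (x k / a - l / K - j k)

lemma gphi_cd {n : ℕ} (a : ℝ) (K : ℕ) (l : ℕ) (j : Fin n → ℤ) :
    ContDiff ℝ 1 (gphi (n := n) a K l j) := by
  unfold gphi
  refine contDiff_prod fun k _ => (bmp_cd K).comp ?_
  have : ContDiff ℝ 1 (fun x : E n => x k) := contDiff_euclidean.1 contDiff_id k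
  exact ((this.div_const a).sub contDiff_const).sub contDiff_const

lemma gphi_supp {n : ℕ} {a : ℝ} {K : ℕ} {l : ℕ} {j : Fin n → ℤ} {x : E n}
    (h : gphi a K l j x ≠ 0) (k : Fin n) :
    0 < x k / a - l / K - j k ∧ x k / a - l / K - j k < 1 :=
  bmp_supp (Finset.prod_ne_zero_iff.1 h k (Finset.mem_univ k))

theorem grid (n : ℕ) {r δ : ℝ} (hr : 0 < r) (hδ : 0 < δ) :
    ∃ (K : ℕ) (J : Type) (_ : Fintype J) (_ : DecidableEq J) (φ : Fin K → J → E n → ℝ) (Lc : ℝ),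
      0 < K ∧ 0 < Lc ∧ (∀ l j, ContDiff ℝ 1 (φ l j)) ∧ (∀ l j x, 0 ≤ φ l j x) ∧
      (∀ l j x, φ l j x ≤ 1) ∧ (∀ l j, ∀ x ∈ closedBall (0 : E n) 1, ‖fderiv ℝ (φ l j) x‖ ≤ Lc) ∧
      (∀ l j x y, φ l j x ≠ 0 → φ l j y ≠ 0 → dist x y < r) ∧
      (∀ l j j' x, φ l j x ≠ 0 → φ l j' x ≠ 0 → j = j') ∧
      ∀ x ∈ closedBall (0 : E n) 1, ∃ B : Finset (Fin K), (B.card : ℝ) ≤ δ * K ∧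
        ∀ l ∉ B, ∃ j, φ l j x = 1 := by
  classical
  set a : ℝ := r / (n + 1) with ha
  have ha0 : 0 < a := by positivity
  obtain ⟨K', hK'⟩ := exists_nat_gt (n / δ)
  set K := K' + 1 with hKd
  have hK : 0 < K := by omega
  have hK0 : (0:ℝ) < K := by exact_mod_cast hK
  obtain ⟨R, hR⟩ := exists_nat_gt (1 / a + 2)
  let J := Fin n → (Finset.Icc (-(R:ℤ)) R)
  let φ : Fin K → J → E n → ℝ := fun l j => gphi a K l (fun k => ((j k : ℤ)))
  have hcd : ∀ l j, ContDiff ℝ 1 (φ l j) := fun l j => gphi_cd _ _ _ _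
  have hb : ∃ Lc : ℝ, 0 < Lc ∧ ∀ l j, ∀ x ∈ closedBall (0 : E n) 1, ‖fderiv ℝ (φ l j) x‖ ≤ Lc := by
    have h1 : ∀ l j, ∃ C, ∀ x ∈ closedBall (0 : E n) 1, ‖fderiv ℝ (φ l j) x‖ ≤ C := fun l j =>
      (isCompact_closedBall _ _).exists_bound_of_continuousOn
        ((hcd l j).continuous_fderiv one_ne_zero).continuousOn
    choose C hC using h1
    refine ⟨1 + ∑ l, ∑ j, |C l j|, by positivity, fun l j x hx => (hC l j x hx).trans ?_⟩
    have h2 : |C l j| ≤ ∑ j, |C l j| :=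
      Finset.single_le_sum (f := fun j => |C l j|) (fun _ _ => abs_nonneg _) (Finset.mem_univ j)
    have h3 : ∑ j, |C l j| ≤ ∑ l, ∑ j, |C l j| :=
      Finset.single_le_sum (f := fun l => ∑ j, |C l j|)
        (fun _ _ => Finset.sum_nonneg fun _ _ => abs_nonneg _) (Finset.mem_univ l)
    have := le_abs_self (C l j)
    linarith
  obtain ⟨Lc, hLc, hL⟩ := hb
  refine ⟨K, J, inferInstance, inferInstance, φ, Lc, hK, hLc, hcd, ?_, ?_, hL, ?_, ?_, ?_⟩
  · exact fun l j x => Finset.prod_nonneg fun k _ => bmp_nn _ _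
  · exact fun l j x => Finset.prod_le_one (fun k _ => bmp_nn _ _) fun k _ => bmp_le _ _
  · intro l j x y hx hy
    have h1 : ∀ k, dist (x k) (y k) ^ 2 ≤ a ^ 2 := by
      intro k
      have hx1 := gphi_supp hx k
      have hy1 := gphi_supp hy k
      have : |x k / a - y k / a| < 1 := by rw [abs_lt]; constructor <;> linarith
      rw [← sub_div, abs_div, abs_of_pos ha0, div_lt_one ha0] at this
      rw [Real.dist_eq]
      exact pow_le_pow_left₀ (abs_nonneg _) this.le 2
    rw [EuclideanSpace.dist_eq]
    have h2 : ∑ k, dist (x k) (y k) ^ 2 ≤ n * a ^ 2 := by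
      calc _ ≤ ∑ k : Fin n, a ^ 2 := Finset.sum_le_sum fun k _ => h1 k
        _ = n * a ^ 2 := by simp
    rw [Real.sqrt_lt' hr]
    have h3 : r = (n + 1) * a := by rw [ha]; field_simp
    have h4 : r ^ 2 = (n:ℝ) * a ^ 2 + ((n:ℝ)^2 * a^2 + n * a^2 + a ^ 2) := by rw [h3]; ring
    have h5 : 0 < (n:ℝ)^2 * a^2 + n * a^2 + a ^ 2 := by positivity
    linarith
  · intro l j j' x hx hx'
    funext k
    have h1 := gphi_supp hx k
    have h2 := gphi_supp hx' k
    apply Subtype.ext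
    have h3 : (((j k : ℤ) - (j' k : ℤ) : ℤ) : ℝ) < 1 := by push_cast; linarith
    have h4 : (-1:ℝ) < (((j k : ℤ) - (j' k : ℤ) : ℤ) : ℝ) := by push_cast; linarith
    have h5 : ((j k : ℤ) - (j' k : ℤ) : ℤ) < 1 := by exact_mod_cast h3
    have h6 : -1 < ((j k : ℤ) - (j' k : ℤ) : ℤ) := by exact_mod_cast h4
    omega
  · intro x hx
    let Bk : Fin n → Finset (Fin K) := fun k =>
      Finset.univ.filter fun l : Fin K => bmp K (Int.fract (x k / a - (l:ℕ) / K)) ≠ 1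
    refine ⟨Finset.univ.biUnion Bk, ?_, ?_⟩
    · have h1 : (Finset.univ.biUnion Bk).card ≤ (Finset.univ : Finset (Fin n)).card * 1 := by
        refine Finset.card_biUnion_le_card_mul _ _ _ fun k _ => ?_
        rw [Finset.card_le_one]
        intro l hl l' hl'
        simp only [Bk, Finset.mem_filter, Finset.mem_univ, true_and] at hl hl'
        exact Fin.ext (bad_one hK _ l.2 l'.2 hl hl')
      simp only [Finset.card_univ, Fintype.card_fin, mul_one] at h1
      have h2 : ((Finset.univ.biUnion Bk).card : ℝ) ≤ n := by exact_mod_cast h1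
      rw [div_lt_iff₀ hδ] at hK'
      have h3 : (K:ℝ) = K' + 1 := by rw [hKd]; push_cast; ring
      rw [h3]; nlinarith
    · intro l hl
      have hl2 : ∀ k, bmp K (Int.fract (x k / a - (l:ℕ) / K)) = 1 := by
        intro k
        by_contra hc
        exact hl (Finset.mem_biUnion.2 ⟨k, Finset.mem_univ _, by simp [Bk, hc]⟩)
      have hx1 : ‖x‖ ≤ 1 := by simpa using hx
      have hmem : ∀ k, ⌊x k / a - (l:ℕ) / K⌋ ∈ Finset.Icc (-(R:ℤ)) R := by
        intro k
        have h1 : |x k| ≤ 1 := by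
          have := PiLp.norm_apply_le x k
          rw [Real.norm_eq_abs] at this
          linarith
        have h2 : |x k / a| ≤ 1 / a := by
          rw [abs_div, abs_of_pos ha0]; gcongr
        have h3 : (0:ℝ) ≤ (l:ℕ) / K := by positivity
        have h4 : ((l:ℕ):ℝ) / K ≤ 1 := by
          rw [div_le_one hK0]; exact_mod_cast l.2.le
        rw [abs_le] at h2
        rw [Finset.mem_Icc]
        constructor
        · rw [Int.le_floor]; push_cast; linarith
        · have : (⌊x k / a - (l:ℕ) / K⌋ : ℝ) ≤ R := (Int.floor_le _).trans (by linarith)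
          exact_mod_cast this
      refine ⟨fun k => ⟨_, hmem k⟩, ?_⟩
      exact Finset.prod_eq_one fun k _ => hl2 k

lemma pigeon {n K : ℕ} (hK : 0 < K) {J : Type} [Fintype J] {ψ : Fin K → J → E n → ℝ} {δ : ℝ}
    (hc : ∀ l j, Continuous (ψ l j)) (h0 : ∀ l j x, 0 ≤ ψ l j x)
    (hB : ∀ x ∈ closedBall (0 : E n) 1, ∃ B : Finset (Fin K), (B.card : ℝ) ≤ δ * K ∧
        ∀ l ∉ B, ∃ j, ψ l j x = 1) {f : E n → ℝ} (hf : Continuous f) (hf0 : ∀ x, 0 ≤ f x) :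
    ∃ l, ∫ x, (1 - ∑ j, ψ l j x) * f x ∂(sphMeasure n) ≤ δ * ∫ x, f x ∂(sphMeasure n) := by
  have hcont : ∀ l, Continuous (fun x => (1 - ∑ j, ψ l j x) * f x) := fun l =>
    (continuous_const.sub (continuous_finsetSum _ fun j _ => hc l j)).mul hf
  have hsum : ∑ l, ∫ x, (1 - ∑ j, ψ l j x) * f x ∂(sphMeasure n)
      ≤ ∑ _l : Fin K, δ * ∫ x, f x ∂(sphMeasure n) := by
    rw [← integral_finsetSum _ fun l _ => sph_integrable (hcont l)]
    have e : ∑ _l : Fin K, δ * ∫ x, f x ∂(sphMeasure n) = ∫ x, (δ * K) * f x ∂(sphMeasure n) := by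
      rw [integral_const_mul]; simp; ring
    rw [e]
    refine integral_mono_ae (sph_integrable (continuous_finsetSum _ fun l _ => hcont l))
      (sph_integrable (continuous_const.mul hf)) ?_
    filter_upwards [sph_ae n] with x hx
    obtain ⟨B, hB1, hB2⟩ := hB x (sphere_subset_closedBall hx)
    change ∑ l, (1 - ∑ j, ψ l j x) * f x ≤ δ * K * f x
    rw [← Finset.sum_mul]
    refine mul_le_mul_of_nonneg_right ?_ (hf0 x)
    refine le_trans ?_ hB1
    have h1 : ∀ l, (1 - ∑ j, ψ l j x) ≤ if l ∈ B then (1:ℝ) else 0 := by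
      intro l
      split_ifs with hl
      · have := Finset.sum_nonneg (s := Finset.univ) fun j _ => h0 l j x
        linarith
      · obtain ⟨j, hj⟩ := hB2 l hl
        have := Finset.single_le_sum (f := fun j => ψ l j x) (fun j _ => h0 l j x)
          (Finset.mem_univ j)
        simp only [hj] at this
        linarith
    calc _ ≤ ∑ l, (if l ∈ B then (1:ℝ) else 0) := Finset.sum_le_sum fun l _ => h1 l
      _ = B.card := by simp
  haveI : Nonempty (Fin K) := ⟨⟨0, hK⟩⟩
  obtain ⟨l, -, hl⟩ := Finset.exists_le_of_sum_le Finset.univ_nonempty hsum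
  exact ⟨l, hl⟩

lemma res_bd {d r : ℕ} (p : Fin r → MvPolynomial (Fin (d+1)) ℝ) :
    ∃ M > 0, ∀ k, ∀ x : sphere (0 : E (d+1)) 1, |resS (d+1) (p k) x| ≤ M := by
  have h1 : ∀ k, ∃ C, ∀ x : sphere (0 : E (d+1)) 1, |resS (d+1) (p k) x| ≤ C := by
    intro k
    have hc : Continuous (resS (d+1) (p k)) := (poly_cont (p k)).comp continuous_subtype_val
    obtain ⟨C, hC⟩ := isCompact_univ.exists_bound_of_continuousOn hc.continuousOn
    exact ⟨C, fun x => hC x trivial⟩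
  choose C hC using h1
  refine ⟨1 + ∑ k, |C k|, by positivity, fun k x => (hC k x).trans ?_⟩
  have h2 : |C k| ≤ ∑ k, |C k| :=
    Finset.single_le_sum (f := fun k => |C k|) (fun _ _ => abs_nonneg _) (Finset.mem_univ k)
  have := le_abs_self (C k)
  linarith

lemma res_osc {d r : ℕ} (p : Fin r → MvPolynomial (Fin (d+1)) ℝ) {κ : ℝ} (hκ : 0 < κ) :
    ∃ s > 0, ∀ k, ∀ x y : sphere (0 : E (d+1)) 1, dist (x : E (d+1)) y < s →
      |resS (d+1) (p k) x - resS (d+1) (p k) y| ≤ κ := by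
  have hc : Continuous (fun x k => resS (d+1) (p k) x : sphere (0 : E (d+1)) 1 → (Fin r → ℝ)) :=
    continuous_pi fun k => (poly_cont (p k)).comp continuous_subtype_val
  have hu := CompactSpace.uniformContinuous_of_continuous hc
  obtain ⟨s, hs, h⟩ := Metric.uniformContinuous_iff.1 hu κ hκ
  refine ⟨s, hs, fun k x y hxy => ?_⟩
  have h1 := h (a := x) (b := y) hxy
  have h2 := dist_le_pi_dist (fun k => resS (d+1) (p k) x) (fun k => resS (d+1) (p k) y) k
  rw [Real.dist_eq] at h2
  exact h2.trans h1.le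

lemma theta_loc (d m : ℕ) {θ : ℝ} (hθ : 0 < θ) (hθ1 : θ ≤ 1) {ε : ℝ} (hε : 0 < ε) :
    ∃ s > 0, ∃ δ > 0, ∀ (J : Type) [Fintype J] (ψ : J → E (d+1) → ℝ),
      (∀ j, Continuous (ψ j)) → (∀ j x, 0 ≤ ψ j x) → (∀ x, ∑ j, ψ j x ≤ 1) →
      (∀ j x y, ψ j x ≠ 0 → ψ j y ≠ 0 → dist x y < s) →
      ∀ f : E (d+1) → ℝ, Continuous f → (∀ x, 0 ≤ f x) →
      (∀ p ∈ P0 (d+1) m, ∫ x, MvPolynomial.eval (fun i => x i) p * f x ∂(sphMeasure (d+1)) = 0) →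
      ∫ x, (1 - ∑ j, ψ j x) * f x ∂(sphMeasure (d+1)) ≤ δ * ∫ x, f x ∂(sphMeasure (d+1)) →
      (Theta (d+1) m θ - ε) * (∫ x, f x ∂(sphMeasure (d+1))) ^ θ
        ≤ ∑ j, (∫ x, ψ j x * f x ∂(sphMeasure (d+1))) ^ θ := by
  obtain ⟨-, hT⟩ := Theta_approx d m hθ hθ1
  obtain ⟨r, p, κ, hκ, hp, hT⟩ := hT (ε/2) (by positivity)
  obtain ⟨M, hM, hMb⟩ := res_bd p
  obtain ⟨s, hs, hosc⟩ := res_osc p (κ := κ/2) (by positivity)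
  have hδ : ∃ δ > 0, 2 * M * δ ≤ κ / 2 ∧ δ ^ θ ≤ ε / 2 := by
    refine ⟨min (κ / (4 * M)) ((ε/2) ^ (1/θ)), by positivity, ?_, ?_⟩
    · calc 2 * M * min (κ / (4 * M)) ((ε/2) ^ (1/θ)) ≤ 2 * M * (κ / (4 * M)) := by
            gcongr; exact min_le_left _ _
        _ = κ / 2 := by field_simp; ring
    · calc (min (κ / (4 * M)) ((ε/2) ^ (1/θ))) ^ θ ≤ ((ε/2) ^ (1/θ)) ^ θ := by
            gcongr; exact min_le_right _ _
        _ = ε / 2 := by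
            rw [← Real.rpow_mul (by positivity), one_div, inv_mul_cancel₀ hθ.ne', Real.rpow_one]
  obtain ⟨δ, hδ0, hδ1, hδ2⟩ := hδ
  refine ⟨s, hs, δ, hδ0, ?_⟩
  intro J _ ψ hc h0 h1 hd f hf hf0 hmom hdef
  classical
  set σ := sphMeasure (d+1) with hσ
  set I := ∫ x, f x ∂σ with hI
  have hI0 : 0 ≤ I := integral_nonneg hf0
  have hW0 : ∀ j, 0 ≤ ∫ x, ψ j x * f x ∂σ := fun j =>
    integral_nonneg fun x => mul_nonneg (h0 j x) (hf0 x)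
  rcases hI0.eq_or_lt with hz | hI0
  · rw [← hz, Real.zero_rpow hθ.ne', mul_zero]
    exact Finset.sum_nonneg fun j _ => Real.rpow_nonneg (hW0 j) _
  have hgc : Continuous fun x => (1 - ∑ j, ψ j x) :=
    continuous_const.sub (continuous_finsetSum _ fun j _ => hc j)
  set W := fun j => ∫ x, ψ j x * f x ∂σ with hW
  set W0 := ∫ x, (1 - ∑ j, ψ j x) * f x ∂σ with hW00
  have hW0' : 0 ≤ W0 := integral_nonneg fun x => mul_nonneg (by linarith [h1 x]) (hf0 x)
  have hij : ∀ j, Integrable (fun x => ψ j x * f x) σ := fun j => sph_integrable ((hc j).mul hf)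
  have hi0 : Integrable (fun x => (1 - ∑ j, ψ j x) * f x) σ := sph_integrable (hgc.mul hf)
  have htot : W0 + ∑ j, W j = I := by
    rw [hW00, hW, hI]
    simp only
    rw [← integral_finsetSum _ fun j _ => hij j,
      ← integral_add hi0 (integrable_finsetSum _ fun j _ => hij j)]
    congr 1; ext x
    rw [← Finset.sum_mul]; ring
  -- points
  obtain ⟨y0⟩ := sphere_ne d
  have hpt : ∀ j, ∃ y : sphere (0 : E (d+1)) 1, (∃ x : sphere (0 : E (d+1)) 1, ψ j x ≠ 0) →
      ψ j y ≠ 0 := by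
    intro j
    by_cases h : ∃ x : sphere (0 : E (d+1)) 1, ψ j x ≠ 0
    · obtain ⟨x, hx⟩ := h; exact ⟨x, fun _ => hx⟩
    · exact ⟨y0, fun h' => absurd h' h⟩
  choose y hy using hpt
  have key := hT (Option J) (fun o => o.elim y0 y) (fun o => o.elim (W0 / I) (fun j => W j / I))
    ?_ ?_ ?_
  · rw [Fintype.sum_option] at key
    simp only [Option.elim] at key
    have h2 : (W0 / I) ^ θ ≤ ε / 2 := by
      refine le_trans ?_ hδ2
      have : W0 / I ≤ δ := by rw [div_le_iff₀ hI0]; exact hdef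
      gcongr
    have h3 : Theta (d+1) m θ - ε ≤ ∑ j, (W j / I) ^ θ := by linarith
    have h4 : ∑ j, (W j / I) ^ θ = (∑ j, W j ^ θ) / I ^ θ := by
      rw [Finset.sum_div]
      exact Finset.sum_congr rfl fun j _ => Real.div_rpow (hW0 j) hI0.le _
    rw [h4, le_div_iff₀ (by positivity)] at h3
    exact h3
  · rintro (_ | j)
    · exact div_nonneg hW0' hI0.le
    · exact div_nonneg (hW0 j) hI0.le
  · rw [Fintype.sum_option]
    simp only [Option.elim]
    rw [← Finset.sum_div, ← add_div, htot, div_self hI0.ne']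
  · intro k
    rw [Fintype.sum_option]
    simp only [Option.elim]
    set P : E (d+1) → ℝ := fun x => MvPolynomial.eval (fun i => x i) (p k) with hP
    have hPc : Continuous P := poly_cont (p k)
    have hPr : ∀ x : sphere (0 : E (d+1)) 1, resS (d+1) (p k) x = P x := fun x => rfl
    have hm := hmom (p k) (hp k)
    have hG : W0 * P y0 + ∑ j, W j * P (y j)
        = ∫ x, ((1 - ∑ j, ψ j x) * (P y0 - P x) + ∑ j, ψ j x * (P (y j) - P x)) * f x ∂σ := by
      have hm' : ∫ x, P x * f x ∂σ = 0 := hm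
      have e1 : W0 * P y0 + ∑ j, W j * P (y j)
          = (∫ x, (1 - ∑ j, ψ j x) * f x * P y0 ∂σ) + (∑ j, ∫ x, ψ j x * f x * P (y j) ∂σ)
            - ∫ x, P x * f x ∂σ := by
        rw [hm', sub_zero, integral_mul_const]
        congr 1
        exact Finset.sum_congr rfl fun j _ => (integral_mul_const _ _).symm
      have hA1 : Integrable (fun x => (1 - ∑ j, ψ j x) * f x * P y0
          + ∑ j, ψ j x * f x * P (y j)) σ :=
        (hi0.mul_const _).add (integrable_finsetSum _ fun j _ => (hij j).mul_const _)
      have hA2 : Integrable (fun x => P x * f x) σ := sph_integrable (hPc.mul hf)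
      rw [e1, ← integral_finsetSum _ fun j _ => (hij j).mul_const _,
        ← integral_add (hi0.mul_const _) (integrable_finsetSum _ fun j _ => (hij j).mul_const _),
        ← integral_sub hA1 hA2]
      congr 1; ext x
      have e2 : ∑ j, ψ j x * (P (y j) - P x) = (∑ j, ψ j x * P (y j)) - (∑ j, ψ j x) * P x := by
        rw [Finset.sum_mul, ← Finset.sum_sub_distrib]
        exact Finset.sum_congr rfl fun j _ => by ring
      have e3 : ∑ j, ψ j x * f x * P (y j) = (∑ j, ψ j x * P (y j)) * f x := by
        rw [Finset.sum_mul]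
        exact Finset.sum_congr rfl fun j _ => by ring
      rw [e2, e3]; ring
    have hbd : |W0 * P y0 + ∑ j, W j * P (y j)| ≤ 2 * M * W0 + κ / 2 * ∑ j, W j := by
      rw [hG]
      have e4 : 2 * M * W0 + κ / 2 * ∑ j, W j
          = ∫ x, (2 * M * (1 - ∑ j, ψ j x) + κ / 2 * ∑ j, ψ j x) * f x ∂σ := by
        rw [hW00, hW]
        simp only
        rw [← integral_finsetSum _ fun j _ => hij j, ← integral_const_mul, ← integral_const_mul,
          ← integral_add (hi0.const_mul _)
            ((integrable_finsetSum _ fun j _ => hij j).const_mul _)]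
        congr 1; ext x
        rw [← Finset.sum_mul]; ring
      rw [e4]
      refine (abs_integral_le_integral_abs).trans ?_
      have hsc : Continuous fun x => ∑ j, ψ j x := continuous_finsetSum _ fun j _ => hc j
      refine integral_mono_ae (sph_integrable ?_) (sph_integrable ?_) ?_
      · refine Continuous.abs (Continuous.mul ?_ hf)
        exact (hgc.mul (continuous_const.sub hPc)).add
          (continuous_finsetSum _ fun j _ => (hc j).mul (continuous_const.sub hPc))
      · exact ((continuous_const.mul hgc).add (continuous_const.mul hsc)).mul hf
      · filter_upwards [sph_ae (d+1)] with x hx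
        change |_ * f x| ≤ _ * f x
        rw [abs_mul, abs_of_nonneg (hf0 x)]
        refine mul_le_mul_of_nonneg_right ?_ (hf0 x)
        refine (abs_add_le _ _).trans (add_le_add ?_ ?_)
        · have hg0 : 0 ≤ 1 - ∑ j, ψ j x := by linarith [h1 x]
          rw [abs_mul, abs_of_nonneg hg0, mul_comm]
          refine mul_le_mul_of_nonneg_right ?_ hg0
          have a1 := hMb k y0
          have a2 := hMb k ⟨x, hx⟩
          have a3 : |P y0 - P x| ≤ |P y0| + |P x| := abs_sub _ _
          have a1' : |P y0| ≤ M := a1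
          have a2' : |P x| ≤ M := a2
          linarith
        · refine (Finset.abs_sum_le_sum_abs _ _).trans ?_
          rw [Finset.mul_sum]
          refine Finset.sum_le_sum fun j _ => ?_
          rw [abs_mul, abs_of_nonneg (h0 j x), mul_comm]
          by_cases hj : ψ j x = 0
          · rw [hj]; simp
          · refine mul_le_mul_of_nonneg_right ?_ (h0 j x)
            have b1 := hy j ⟨⟨x, hx⟩, hj⟩
            exact hosc k (y j) ⟨x, hx⟩ (hd j _ _ b1 hj)
    have e5 : W0 / I * resS (d+1) (p k) y0 + ∑ j, W j / I * resS (d+1) (p k) (y j)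
        = (W0 * P y0 + ∑ j, W j * P (y j)) / I := by
      rw [add_div, Finset.sum_div]
      congr 1
      · rw [hPr]; ring
      · exact Finset.sum_congr rfl fun j _ => by rw [hPr]; ring
    rw [e5, abs_div, abs_of_pos hI0, div_le_iff₀ hI0]
    refine hbd.trans ?_
    have c1 : 2 * M * W0 ≤ 2 * M * (δ * I) := by gcongr
    have c2 : 2 * M * δ * I ≤ κ / 2 * I := by gcongr
    have c3 : κ / 2 * ∑ j, W j ≤ κ / 2 * I := by gcongr; linarith
    linarith

lemma sq_add_eta {η a b c : ℝ} (hη : 0 < η) (hc0 : 0 ≤ c) (hc : c ≤ a + b) :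
    c ^ 2 ≤ (1 + η) * a ^ 2 + (1 + 1/η) * b ^ 2 := by
  have h1 : c ^ 2 ≤ (a + b) ^ 2 := pow_le_pow_left₀ hc0 hc 2
  have h2 : (1 + η) * a ^ 2 + (1 + 1/η) * b ^ 2 - (a + b) ^ 2 = (η * a - b) ^ 2 / η := by
    field_simp; ring
  have h3 : 0 ≤ (η * a - b) ^ 2 / η := by positivity
  linarith

lemma grad_pt {n : ℕ} {J : Type} [Fintype J] {φ : J → E n → ℝ} {χ u : E n → ℝ} {Lc η : ℝ}
    (hη : 0 < η)
    (hφ : ∀ j, ContDiff ℝ 1 (φ j)) (hχ : ContDiff ℝ 1 χ) (hu : ContDiff ℝ 1 u)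
    (hχ0 : ∀ x, 0 ≤ χ x) (hχ1 : ∀ x, χ x ≤ 1) (hφ0 : ∀ j x, 0 ≤ φ j x)
    (hs : ∀ x, ∑ j, φ j x ^ 2 ≤ 1) (x : E n) (hL : ∀ j, ‖fderiv ℝ (φ j) x‖ ≤ Lc) :
    ∑ j, ‖fderiv ℝ (fun y => χ y * φ j y * u y) x‖ ^ 2 ≤ (1 + η) * ‖fderiv ℝ u x‖ ^ 2
      + 2 * (1 + 1/η) * ((‖fderiv ℝ χ x‖ ^ 2 + (Fintype.card J * Lc ^ 2 + 1) * χ x ^ 2) * u x ^ 2) := by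
  have h1 : ∀ j, ‖fderiv ℝ (fun y => χ y * φ j y * u y) x‖ ^ 2
      ≤ (1 + η) * (φ j x ^ 2 * ‖fderiv ℝ u x‖ ^ 2) +
        (1 + 1/η) * (2 * (φ j x ^ 2 * ‖fderiv ℝ χ x‖ ^ 2 + χ x ^ 2 * Lc ^ 2) * u x ^ 2) := by
    intro j
    have dχ := (hχ.differentiable one_ne_zero x).hasFDerivAt
    have dφ := ((hφ j).differentiable one_ne_zero x).hasFDerivAt
    have du := (hu.differentiable one_ne_zero x).hasFDerivAt
    have dd : HasFDerivAt (fun y => χ y * φ j y * u y) _ x := (dχ.mul dφ).mul du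
    rw [dd.fderiv]
    have n1 : ‖(χ x * φ j x) • fderiv ℝ u x‖ = (χ x * φ j x) * ‖fderiv ℝ u x‖ := by
      rw [norm_smul, Real.norm_eq_abs, abs_of_nonneg (mul_nonneg (hχ0 x) (hφ0 j x))]
    have n2 : ‖χ x • fderiv ℝ (φ j) x + φ j x • fderiv ℝ χ x‖
        ≤ χ x * Lc + φ j x * ‖fderiv ℝ χ x‖ := by
      refine (norm_add_le _ _).trans ?_
      rw [norm_smul, norm_smul, Real.norm_eq_abs, Real.norm_eq_abs, abs_of_nonneg (hχ0 x),
        abs_of_nonneg (hφ0 j x)]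
      gcongr
      · exact hχ0 x
      · exact hL j
    have n3 : ‖u x • (χ x • fderiv ℝ (φ j) x + φ j x • fderiv ℝ χ x)‖
        ≤ |u x| * (χ x * Lc + φ j x * ‖fderiv ℝ χ x‖) := by
      rw [norm_smul, Real.norm_eq_abs]
      gcongr
    have n4 := (norm_add_le ((χ x * φ j x) • fderiv ℝ u x)
      (u x • (χ x • fderiv ℝ (φ j) x + φ j x • fderiv ℝ χ x))).trans (add_le_add n1.le n3)
    refine (sq_add_eta hη (norm_nonneg _) n4).trans ?_
    refine add_le_add ?_ ?_
    · refine mul_le_mul_of_nonneg_left ?_ (by positivity)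
      have : χ x ^ 2 ≤ 1 := pow_le_one₀ (hχ0 x) (hχ1 x)
      have h0 : 0 ≤ φ j x ^ 2 * ‖fderiv ℝ u x‖ ^ 2 := by positivity
      calc _ = χ x ^ 2 * (φ j x ^ 2 * ‖fderiv ℝ u x‖ ^ 2) := by ring
        _ ≤ _ := mul_le_of_le_one_left h0 this
    · refine mul_le_mul_of_nonneg_left ?_ (by positivity)
      rw [mul_pow, sq_abs, mul_comm]
      refine mul_le_mul_of_nonneg_right ?_ (by positivity)
      have := add_sq_le (a := χ x * Lc) (b := φ j x * ‖fderiv ℝ χ x‖)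
      calc _ ≤ _ := this
        _ = _ := by ring
  refine (Finset.sum_le_sum fun j _ => h1 j).trans ?_
  have e : ∑ j, ((1 + η) * (φ j x ^ 2 * ‖fderiv ℝ u x‖ ^ 2) +
        (1 + 1/η) * (2 * (φ j x ^ 2 * ‖fderiv ℝ χ x‖ ^ 2 + χ x ^ 2 * Lc ^ 2) * u x ^ 2))
      = (∑ j, φ j x ^ 2) * ((1 + η) * ‖fderiv ℝ u x‖ ^ 2
        + 2 * (1 + 1/η) * (‖fderiv ℝ χ x‖ ^ 2 * u x ^ 2))
        + 2 * (1 + 1/η) * (Fintype.card J * Lc ^ 2 * χ x ^ 2 * u x ^ 2) := by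
    have : (Fintype.card J * Lc ^ 2 * χ x ^ 2 * u x ^ 2 : ℝ)
        = ∑ j : J, Lc ^ 2 * χ x ^ 2 * u x ^ 2 := by
      rw [Finset.sum_const, Finset.card_univ, nsmul_eq_mul]; ring
    rw [this, Finset.sum_mul, Finset.mul_sum, ← Finset.sum_add_distrib]
    exact Finset.sum_congr rfl fun j _ => by ring
  rw [e]
  have h2 : (∑ j, φ j x ^ 2) * ((1 + η) * ‖fderiv ℝ u x‖ ^ 2
        + 2 * (1 + 1/η) * (‖fderiv ℝ χ x‖ ^ 2 * u x ^ 2)) ≤ (1 + η) * ‖fderiv ℝ u x‖ ^ 2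
        + 2 * (1 + 1/η) * (‖fderiv ℝ χ x‖ ^ 2 * u x ^ 2) :=
    mul_le_of_le_one_left (by positivity) (hs x)
  have h3 : 0 ≤ 2 * (1 + 1/η) * (χ x ^ 2 * u x ^ 2) := by positivity
  linarith

lemma grad_int {n : ℕ} (hn : 0 < n) {J : Type} [Fintype J] {Lc η : ℝ} (hη : 0 < η) :
    ∃ χ : E n → ℝ, ∃ C > 0, ContDiff ℝ 1 χ ∧ (∀ x ∈ sphere (0 : E n) 1, χ x = 1) ∧
      ∀ (φ : J → E n → ℝ) (u : E n → ℝ), (∀ j, ContDiff ℝ 1 (φ j)) → ContDiff ℝ 1 u →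
      (∀ j x, 0 ≤ φ j x) → (∀ x, ∑ j, φ j x ^ 2 ≤ 1) →
      (∀ j, ∀ x ∈ closedBall (0 : E n) 1, ‖fderiv ℝ (φ j) x‖ ≤ Lc) →
      ∑ j, ∫ x in ball (0 : E n) 1, ‖fderiv ℝ (fun y => χ y * φ j y * u y) x‖ ^ 2
        ≤ (1 + 2 * η) * (∫ x in ball (0 : E n) 1, ‖fderiv ℝ u x‖ ^ 2)
          + C * ∫ x, u x ^ 2 ∂(sphMeasure n) := by
  set A := 2 * (1 + 1/η) with hA
  have hA0 : 0 < A := by positivity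
  obtain ⟨χ, C, hC, hχ, hχ0, hχ1, hχS, hcut⟩ := cutoff hn
    (L := Fintype.card J * Lc ^ 2 + 1) (η := η / A) (by positivity) (by positivity)
  refine ⟨χ, A * C, by positivity, hχ, hχS, ?_⟩
  intro φ u hφ hu hφ0 hs hL
  have hsub : ball (0 : E n) 1 ⊆ closedBall 0 1 := ball_subset_closedBall
  have hvc : ∀ j, Continuous fun x => ‖fderiv ℝ (fun y => χ y * φ j y * u y) x‖ ^ 2 := fun j =>
    ((((hχ.mul (hφ j)).mul hu).continuous_fderiv one_ne_zero).norm).pow 2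
  have hc1 : Continuous fun x => ‖fderiv ℝ u x‖ ^ 2 :=
    ((hu.continuous_fderiv one_ne_zero).norm).pow 2
  have hc2 : Continuous fun x =>
      (‖fderiv ℝ χ x‖ ^ 2 + (Fintype.card J * Lc ^ 2 + 1) * χ x ^ 2) * u x ^ 2 :=
    ((((hχ.continuous_fderiv one_ne_zero).norm).pow 2).add
      (continuous_const.mul (hχ.continuous.pow 2))).mul (hu.continuous.pow 2)
  rw [← integral_finsetSum _ fun j _ => cont_int_ball (hvc j) hsub]
  have h1 : ∫ x in ball (0 : E n) 1, ∑ j, ‖fderiv ℝ (fun y => χ y * φ j y * u y) x‖ ^ 2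
      ≤ ∫ x in ball (0 : E n) 1, ((1 + η) * ‖fderiv ℝ u x‖ ^ 2 + A *
        ((‖fderiv ℝ χ x‖ ^ 2 + (Fintype.card J * Lc ^ 2 + 1) * χ x ^ 2) * u x ^ 2)) := by
    refine setIntegral_mono_on
      (cont_int_ball (continuous_finsetSum _ fun j _ => hvc j) hsub)
      (cont_int_ball ((continuous_const.mul hc1).add (continuous_const.mul hc2)) hsub)
      measurableSet_ball fun x hx => ?_
    exact grad_pt hη hφ hχ hu hχ0 hχ1 hφ0 hs x fun j => hL j x (hsub hx)
  refine h1.trans ?_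
  rw [integral_add ((cont_int_ball hc1 hsub).const_mul _)
    ((cont_int_ball hc2 hsub).const_mul _), integral_const_mul, integral_const_mul]
  have h2 := mul_le_mul_of_nonneg_left (hcut u hu) hA0.le
  have h3 : A * (η / A * (∫ x in ball (0 : E n) 1, ‖fderiv ℝ u x‖ ^ 2)
      + C * ∫ x, u x ^ 2 ∂(sphMeasure n)) = η * (∫ x in ball (0 : E n) 1, ‖fderiv ℝ u x‖ ^ 2)
      + A * C * ∫ x, u x ^ 2 ∂(sphMeasure n) := by field_simp
  rw [h3] at h2
  linarith

lemma choose_e {c T ε : ℝ} (hT : 1 ≤ T) (hε : 0 < ε) :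
    ∃ e > 0, e < 1 ∧ (c + e) * (1 + 2 * e) / (T - e) ≤ c / T + ε := by
  have h : ContinuousAt (fun e : ℝ => (c + e) * (1 + 2 * e) / (T - e)) 0 := by
    refine ContinuousAt.div (by fun_prop) (by fun_prop) ?_
    simp; linarith
  have h2 : Tendsto (fun e : ℝ => (c + e) * (1 + 2 * e) / (T - e)) (nhds 0) (nhds (c / T)) := by
    have := h.tendsto; simpa using this
  have h3 := h2.eventually (Iic_mem_nhds (show c / T < c / T + ε by linarith))
  obtain ⟨ρ, hρ, hh⟩ := Metric.eventually_nhds_iff.1 h3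
  refine ⟨min (ρ/2) (1/2), by positivity, lt_of_le_of_lt (min_le_right _ _) (by norm_num), ?_⟩
  apply hh
  rw [Real.dist_eq, sub_zero, abs_of_pos (by positivity)]
  exact lt_of_le_of_lt (min_le_left _ _) (by linarith)

theorem main_d (d : ℕ) (hd : 2 ≤ d) (m : ℕ) {ε : ℝ} (hε : 0 < ε) :
    ∃ C > (0:ℝ), ∀ u : E (d+1) → ℝ, ContDiff ℝ 1 u →
      (∀ p ∈ P0 (d+1) m, ∫ x, MvPolynomial.eval (fun i => x i) p * |u x| ^ (2*(d:ℝ)/(d-1))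
          ∂(sphMeasure (d+1)) = 0) →
      (∫ x, |u x| ^ (2*(d:ℝ)/(d-1)) ∂(sphMeasure (d+1))) ^ (((d:ℝ)-1)/d) ≤
        (2/((d:ℝ)-1) * SA (d+1) ^ (-(1/(d:ℝ))) / Theta (d+1) m (((d:ℝ)-1)/d) + ε) *
            (∫ x in ball (0 : E (d+1)) 1, ‖fderiv ℝ u x‖ ^ 2) +
          C * ∫ x, (u x) ^ 2 ∂(sphMeasure (d+1)) := by
  have hd' : (2:ℝ) ≤ d := by exact_mod_cast hd
  set q := 2*(d:ℝ)/(d-1) with hq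
  set θ := ((d:ℝ)-1)/d with hθd
  set c := 2/((d:ℝ)-1) * SA (d+1) ^ (-(1/(d:ℝ))) with hcd
  have hd1 : 0 < (d:ℝ) - 1 := by linarith
  have hq2 : 2 ≤ q := by rw [hq, le_div_iff₀ hd1]; linarith
  have hq0 : 0 < q := by linarith
  have hθ : 0 < θ := by positivity
  have hθ1 : θ ≤ 1 := by rw [hθd, div_le_one (by linarith)]; linarith
  have hc0 : 0 ≤ c := by
    rw [hcd]
    have : 0 ≤ SA (d+1) := ENNReal.toReal_nonneg
    positivity
  set T := Theta (d+1) m θ with hTd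
  have hT1 : 1 ≤ T := (Theta_approx d m hθ hθ1).1
  obtain ⟨e, he, he1, hee⟩ := choose_e (c := c) hT1 hε
  obtain ⟨r, hr, hloc⟩ := local_thm d hd he
  obtain ⟨s, hs, δ, hδ, hth⟩ := theta_loc d m hθ hθ1 he
  obtain ⟨K, J, _, _, φ, Lc, hK, hLc, hφ, hφ0, hφ1, hL, hdiam, hdisj, hB⟩ :=
    grid (d+1) (r := min r s) (δ := δ) (by positivity) hδ
  obtain ⟨χ, C, hC, hχ, hχS, hgrad⟩ := grad_int (n := d+1) (by omega) (J := J) (Lc := Lc) he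
  have hTe : 0 < T - e := by linarith
  refine ⟨(c + e) * C / (T - e), by positivity, ?_⟩
  intro u hu hmom
  have hfc : Continuous fun x => |u x| ^ q :=
    hu.continuous.abs.rpow_const fun x => Or.inr hq0.le
  have hf0 : ∀ x, 0 ≤ |u x| ^ q := fun x => Real.rpow_nonneg (abs_nonneg _) _
  have hψc : ∀ l j, Continuous fun x => φ l j x ^ q := fun l j =>
    (hφ l j).continuous.rpow_const fun x => Or.inr hq0.le
  have hψ0 : ∀ l j x, 0 ≤ φ l j x ^ q := fun l j x => Real.rpow_nonneg (hφ0 l j x) _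
  obtain ⟨l, hl⟩ := pigeon (n := d+1) hK (ψ := fun l j x => φ l j x ^ q) (δ := δ) hψc hψ0
    (fun x hx => by
      obtain ⟨B, h1, h2⟩ := hB x hx
      refine ⟨B, h1, fun l hl => ?_⟩
      obtain ⟨j, hj⟩ := h2 l hl
      exact ⟨j, by rw [hj, Real.one_rpow]⟩) hfc hf0
  -- sums with disjoint supports
  have hsum : ∀ g : ℝ → ℝ, g 0 = 0 → (∀ t, 0 ≤ t → t ≤ 1 → g t ≤ 1) → ∀ x, ∑ j, g (φ l j x) ≤ 1 := by
    intro g g0 g1 x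
    by_cases h : ∃ j, φ l j x ≠ 0
    · obtain ⟨j, hj⟩ := h
      rw [Finset.sum_eq_single j]
      · exact g1 _ (hφ0 l j x) (hφ1 l j x)
      · intro j' _ hne
        have : φ l j' x = 0 := by
          by_contra hc
          exact hne (hdisj l j' j x hc hj)
        rw [this, g0]
      · intro h; exact absurd (Finset.mem_univ j) h
    · push Not at h
      rw [Finset.sum_eq_zero fun j _ => by rw [h j, g0]]
      exact zero_le_one
  have hψnz : ∀ j x, φ l j x ^ q ≠ 0 → φ l j x ≠ 0 := fun j x h h0 =>
    h (by rw [h0, Real.zero_rpow hq0.ne'])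
  have h1 := hth J (fun j x => φ l j x ^ q) (hψc l) (hψ0 l)
    (hsum (fun t => t ^ q) (Real.zero_rpow hq0.ne') fun t h0 h1 => Real.rpow_le_one h0 h1 hq0.le)
    (fun j x y hx hy => (hdiam l j x y (hψnz j x hx) (hψnz j y hy)).trans_le (min_le_right _ _))
    (fun x => |u x| ^ q) hfc hf0 hmom hl
  have h2 : ∀ j, (∫ x, φ l j x ^ q * |u x| ^ q ∂(sphMeasure (d+1))) ^ θ
      ≤ (c + e) * ∫ x in ball (0 : E (d+1)) 1, ‖fderiv ℝ (fun y => χ y * φ l j y * u y) x‖ ^ 2 := by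
    intro j
    have hint0 : 0 ≤ ∫ x in ball (0 : E (d+1)) 1,
        ‖fderiv ℝ (fun y => χ y * φ l j y * u y) x‖ ^ 2 := integral_nonneg fun x => by positivity
    by_cases h : ∃ ξ ∈ sphere (0 : E (d+1)) 1, φ l j ξ ≠ 0
    · obtain ⟨ξ, hξ, hne⟩ := h
      have h3 := hloc ξ hξ (fun y => χ y * φ l j y * u y) ((hχ.mul (hφ l j)).mul hu) (by
        intro x hx
        have : φ l j x = 0 := by
          by_contra hc
          have h5 := hdiam l j x ξ hc hne
          have h6 := min_le_left r s
          linarith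
        simp [this])
      refine le_trans (le_of_eq ?_) h3
      congr 1
      refine integral_congr_ae ?_
      filter_upwards [sph_ae (d+1)] with x hx
      rw [hχS x hx, one_mul, abs_mul, abs_of_nonneg (hφ0 l j x),
        Real.mul_rpow (hφ0 l j x) (abs_nonneg _)]
    · push Not at h
      have h3 : ∫ x, φ l j x ^ q * |u x| ^ q ∂(sphMeasure (d+1)) = 0 := by
        refine integral_eq_zero_of_ae ?_
        filter_upwards [sph_ae (d+1)] with x hx
        rw [h x hx, Real.zero_rpow hq0.ne', zero_mul]; rfl
      rw [h3, Real.zero_rpow hθ.ne']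
      positivity
  have h3 := hgrad (φ l) u (hφ l) hu (hφ0 l)
    (hsum (fun t => t ^ 2) (by norm_num) fun t h0 h1 => pow_le_one₀ h0 h1) (hL l)
  have h4 := h1.trans (Finset.sum_le_sum fun j _ => h2 j)
  rw [← Finset.mul_sum] at h4
  have h5 := h4.trans (mul_le_mul_of_nonneg_left h3 (by positivity : 0 ≤ c + e))
  rw [mul_comm, ← le_div_iff₀ hTe] at h5
  refine h5.trans ?_
  have hD0 : 0 ≤ ∫ x in ball (0 : E (d+1)) 1, ‖fderiv ℝ u x‖ ^ 2 :=
    integral_nonneg fun x => by positivity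
  have h6 := mul_le_mul_of_nonneg_right hee hD0
  refine le_trans (le_of_eq ?_) (add_le_add_left h6 _)
  field_simp

theorem stmt1 (n : ℕ) (hn : 3 ≤ n) (m : ℕ) :
    ∀ ε > (0:ℝ), ∃ C > (0:ℝ), ∀ u : E n → ℝ, ContDiff ℝ (⊤ : ℕ∞) u →
      (∀ p ∈ P0 n m,
        ∫ x, MvPolynomial.eval (fun i => x i) p * |u x| ^ (2 * ((n:ℝ) - 1) / ((n:ℝ) - 2))
          ∂(sphMeasure n) = 0) →
      (∫ x, |u x| ^ (2 * ((n:ℝ) - 1) / ((n:ℝ) - 2)) ∂(sphMeasure n)) ^ (((n:ℝ) - 2) / ((n:ℝ) - 1)) ≤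
        ((2 / ((n:ℝ) - 2)) * SA n ^ (-(1 / ((n:ℝ) - 1))) / Theta n m (((n:ℝ) - 2) / ((n:ℝ) - 1)) + ε) *
            (∫ x in Metric.ball (0 : E n) 1, ‖fderiv ℝ u x‖ ^ 2) +
          C * ∫ x, (u x) ^ 2 ∂(sphMeasure n) := by
  intro ε hε
  obtain ⟨d, rfl⟩ : ∃ d, n = d + 1 := ⟨n - 1, by omega⟩
  have e1 : ((d + 1 : ℕ) : ℝ) - 1 = d := by push_cast; ring
  have e2 : ((d + 1 : ℕ) : ℝ) - 2 = (d:ℝ) - 1 := by push_cast; ring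
  rw [e1, e2]
  obtain ⟨C, hC, h⟩ := main_d d (by omega) m hε
  exact ⟨C, hC, fun u hu hm => h u (hu.of_le (by exact_mod_cast le_top)) hm⟩
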